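/- arXiv:1407.1343 — 11 statements merged into one kernel-verified Lean document; each statement's English description precedes it below -/
import Mathlib

section
/- For every z = u + i·v with u ∈ ℝ, the function y ↦ e^{-izy} − 1 + izy·1_{|y|≤1} is ν-integrable and I(−z) := ∫_ℝ (e^{-izy} − 1 + izy·1_{|y|≤1}) ν(dy) satisfies |I(−z)| ≤ |z|²·(e^{v}/2)·∫_{|y|≤1} y² ν(dy) + ∫_{|y|>1} (e^{v·y} + 1) ν(dy). -/
open MeasureTheory

/-- Along the segment from `0` to `w`, `exp` moves by at most its maximal derivative. -/
lemma norm_exp_mul_sub_one_le_of_re_le {w : ℂ} {c : ℝ} (hc : 0 ≤ c) (hw : w.re ≤ c)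
    {t : ℝ} (ht : t ∈ Set.Icc (0 : ℝ) 1) :
    ‖Complex.exp (t * w) - 1‖ ≤ ‖w‖ * Real.exp c * t := by
  have hder (s : ℝ) :
      HasDerivAt (fun s : ℝ => Complex.exp (s * w) - 1) (Complex.exp (s * w) * w) s := by
    simpa using (((hasDerivAt_id s).ofReal_comp.mul_const w).cexp).sub_const 1
  have hB (s : ℝ) :
      HasDerivAt (fun s : ℝ => ‖w‖ * Real.exp c * s) (‖w‖ * Real.exp c) s := by
    simpa using (hasDerivAt_id s).const_mul (‖w‖ * Real.exp c)
  refine image_norm_le_of_norm_deriv_right_le_deriv_boundary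
    (fun s _ => (hder s).continuousAt.continuousWithinAt)
    (fun s _ => (hder s).hasDerivWithinAt) (by simp) hB (fun s hs => ?_) ht
  have hre : s * w.re ≤ c := by nlinarith [hs.1, hs.2.le]
  rw [norm_mul, Complex.norm_exp, Complex.re_ofReal_mul, mul_comm]
  gcongr

/-- Second-order Taylor bound for `exp`, with the growth controlled by the real part only. -/
lemma norm_exp_sub_one_sub_id_le_of_re_le {w : ℂ} {c : ℝ} (hc : 0 ≤ c) (hw : w.re ≤ c) :
    ‖Complex.exp w - 1 - w‖ ≤ ‖w‖ ^ 2 * (Real.exp c / 2) := by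
  have hder (s : ℝ) :
      HasDerivAt (fun s : ℝ => Complex.exp (s * w) - 1 - s * w)
        (Complex.exp (s * w) * w - w) s := by
    have h := (hasDerivAt_id s).ofReal_comp.mul_const w
    simpa using (h.cexp.sub_const 1).fun_sub h
  have hB (s : ℝ) :
      HasDerivAt (fun s : ℝ => ‖w‖ ^ 2 * (Real.exp c / 2) * s ^ 2)
        (‖w‖ ^ 2 * Real.exp c * s) s := by
    refine ((hasDerivAt_pow 2 s).const_mul (‖w‖ ^ 2 * (Real.exp c / 2))).congr_deriv ?_
    norm_num
    ring
  have h := image_norm_le_of_norm_deriv_right_le_deriv_boundary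
    (a := 0) (b := 1) (fun s _ => (hder s).continuousAt.continuousWithinAt)
    (fun s _ => (hder s).hasDerivWithinAt) (by simp) hB (fun s hs => ?_)
    (Set.right_mem_Icc.2 zero_le_one)
  · simpa using h
  · calc ‖Complex.exp (s * w) * w - w‖ = ‖Complex.exp (s * w) - 1‖ * ‖w‖ := by
          rw [← norm_mul, sub_one_mul]
      _ ≤ ‖w‖ * Real.exp c * s * ‖w‖ := by
          gcongr
          exact norm_exp_mul_sub_one_le_of_re_le hc hw ⟨hs.1, hs.2.le⟩
      _ = ‖w‖ ^ 2 * Real.exp c * s := by ring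

/-- Bound on `I(-z) = ∫ (e^{-izy} - 1 + izy·1_{|y|≤1}) ν(dy)` for `z = u + iv`, `v ≥ 0`
(first part of Lemma 3 of the paper). -/
theorem bound_I
    (v : ℝ) (hv : 0 ≤ v)
    (ν : Measure ℝ) [SigmaFinite ν]
    (hν0 : ν {0} = 0)
    (hν1 : IntegrableOn (fun y : ℝ => y ^ 2) {y : ℝ | |y| ≤ 1} ν)
    (hν2 : ν {y : ℝ | 1 < |y|} < ⊤)
    (hν3 : IntegrableOn (fun y : ℝ => Real.exp (v * y)) {y : ℝ | 1 < |y|} ν) :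
    ∀ u : ℝ,
      Integrable (fun y : ℝ =>
        Complex.exp (-(Complex.I * ((u : ℂ) + (v : ℂ) * Complex.I) * (y : ℂ))) - 1 +
          Complex.I * ((u : ℂ) + (v : ℂ) * Complex.I) * (y : ℂ) *
            (if |y| ≤ 1 then (1 : ℂ) else 0)) ν ∧
      ‖∫ y : ℝ,
          (Complex.exp (-(Complex.I * ((u : ℂ) + (v : ℂ) * Complex.I) * (y : ℂ))) - 1 +
            Complex.I * ((u : ℂ) + (v : ℂ) * Complex.I) * (y : ℂ) *
              (if |y| ≤ 1 then (1 : ℂ) else 0)) ∂ν‖ ≤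
        ‖(u : ℂ) + (v : ℂ) * Complex.I‖ ^ 2 * (Real.exp v / 2) *
            (∫ y in {y : ℝ | |y| ≤ 1}, y ^ 2 ∂ν) +
          ∫ y in {y : ℝ | 1 < |y|}, (Real.exp (v * y) + 1) ∂ν := by
  intro u
  set z : ℂ := (u : ℂ) + (v : ℂ) * Complex.I with hz
  set f : ℝ → ℂ := fun y => Complex.exp (-(Complex.I * z * (y : ℂ))) - 1 +
    Complex.I * z * (y : ℂ) * (if |y| ≤ 1 then (1 : ℂ) else 0) with hf
  have hre (y : ℝ) : (-(Complex.I * z * (y : ℂ))).re = v * y := by simp [hz]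
  have hAm : MeasurableSet {y : ℝ | |y| ≤ 1} := measurableSet_le (by fun_prop) (by fun_prop)
  have hBm : MeasurableSet {y : ℝ | 1 < |y|} := measurableSet_lt (by fun_prop) (by fun_prop)
  have hAB : {y : ℝ | |y| ≤ 1}ᶜ = {y : ℝ | 1 < |y|} := by ext; simp
  have hfm : Measurable f :=
    (by fun_prop : Measurable fun y : ℝ => Complex.exp (-(Complex.I * z * (y : ℂ))) - 1).add
      ((by fun_prop : Measurable fun y : ℝ => Complex.I * z * (y : ℂ)).mul
        (Measurable.ite hAm measurable_const measurable_const))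
  have hsmall (y : ℝ) (hy : |y| ≤ 1) : ‖f y‖ ≤ ‖z‖ ^ 2 * (Real.exp v / 2) * y ^ 2 := by
    have hvy : (-(Complex.I * z * (y : ℂ))).re ≤ v := by
      rw [hre]
      exact mul_le_of_le_one_right hv (abs_le.1 hy).2
    have h := norm_exp_sub_one_sub_id_le_of_re_le hv hvy
    rw [sub_neg_eq_add] at h
    simp only [hf, if_pos hy, mul_one]
    refine h.trans_eq ?_
    simp only [norm_neg, norm_mul, Complex.norm_I, Complex.norm_real, Real.norm_eq_abs, one_mul,
      mul_pow, sq_abs]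
    ring
  have hlarge (y : ℝ) (hy : 1 < |y|) : ‖f y‖ ≤ Real.exp (v * y) + 1 := by
    simp only [hf, if_neg hy.not_ge, mul_zero, add_zero]
    refine (norm_sub_le _ _).trans_eq ?_
    rw [Complex.norm_exp, hre, norm_one]
  have hgA : IntegrableOn (fun y : ℝ => ‖z‖ ^ 2 * (Real.exp v / 2) * y ^ 2)
      {y : ℝ | |y| ≤ 1} ν := hν1.const_mul _
  have hgB : IntegrableOn (fun y : ℝ => Real.exp (v * y) + 1) {y : ℝ | 1 < |y|} ν :=
    hν3.add (integrableOn_const hν2.ne)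
  have hfA : IntegrableOn f {y : ℝ | |y| ≤ 1} ν :=
    hgA.mono' hfm.aestronglyMeasurable ((ae_restrict_iff' hAm).2 (.of_forall hsmall))
  have hfB : IntegrableOn f {y : ℝ | 1 < |y|} ν :=
    hgB.mono' hfm.aestronglyMeasurable ((ae_restrict_iff' hBm).2 (.of_forall hlarge))
  have hfi : Integrable f ν := by
    rw [← integrableOn_univ, ← Set.union_compl_self {y : ℝ | |y| ≤ 1}, hAB]
    exact hfA.union hfB
  refine ⟨hfi, ?_⟩
  rw [← integral_add_compl hAm hfi, hAB, ← integral_const_mul]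
  exact (norm_add_le _ _).trans (add_le_add
    (norm_integral_le_of_norm_le hgA ((ae_restrict_iff' hAm).2 (.of_forall hsmall)))
    (norm_integral_le_of_norm_le hgB ((ae_restrict_iff' hBm).2 (.of_forall hlarge))))
end

section
/- Set M := (e^{max(v,1)}/2)·∫_{|y|≤1} y² ν(dy) + ∫_{|y|>1} (e^{v·y} + e^{y} + 2) ν(dy). Then for every σ ≥ 0 and every z = u + i·v with u ∈ ℝ, the full characteristic exponent Ψ(−z) := iz(1+iz)·σ²/2 + Ψ_J(−z) satisfies |Ψ(−z)| ≤ (1 + |z| + |z|²)·(M + σ²/2); in particular Ψ grows at most quadratically along the horizontal line iv + ℝ. -/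
open MeasureTheory

/-- Taylor bound for the complex exponential with the sharp dependence on the real part:
if `Re s ≤ c` and `0 ≤ c`, then `|e^s - 1 - s| ≤ e^c |s|² / 2`. -/
lemma norm_exp_sub_one_sub_self_le {s : ℂ} {c : ℝ} (hc : 0 ≤ c) (hs : s.re ≤ c) :
    ‖Complex.exp s - 1 - s‖ ≤ Real.exp c / 2 * ‖s‖ ^ 2 := by
  have hexp (t : ℝ) : HasDerivAt (fun t : ℝ => Complex.exp (t * s)) (Complex.exp (t * s) * s) t := by
    simpa using ((Complex.ofRealCLM.hasDerivAt (x := t)).mul_const s).cexp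
  have hfirst : ∀ t ∈ Set.Icc (0 : ℝ) 1,
      ‖Complex.exp (t * s) - 1‖ ≤ Real.exp c * ‖s‖ * t := by
    refine image_norm_le_of_norm_deriv_right_le_deriv_boundary
      (f' := fun t : ℝ => Complex.exp (t * s) * s) (B' := fun _ => Real.exp c * ‖s‖)
      (fun t _ => ((hexp t).sub_const 1).continuousAt.continuousWithinAt)
      (fun t _ => ((hexp t).sub_const 1).hasDerivWithinAt) (by simp)
      (fun t => by simpa using (hasDerivAt_id t).const_mul (Real.exp c * ‖s‖)) ?_
    intro t ht
    rw [norm_mul, Complex.norm_exp]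
    gcongr
    rw [Complex.re_ofReal_mul]
    nlinarith [ht.1, ht.2]
  have hder (t : ℝ) : HasDerivAt (fun t : ℝ => Complex.exp (t * s) - 1 - t * s)
      (Complex.exp (t * s) * s - s) t := by
    have hlin : HasDerivAt (fun t : ℝ => (t : ℂ) * s) s t := by
      simpa using (Complex.ofRealCLM.hasDerivAt (x := t)).mul_const s
    exact ((hexp t).sub_const 1).sub hlin
  have hsecond : ∀ t ∈ Set.Icc (0 : ℝ) 1,
      ‖Complex.exp (t * s) - 1 - t * s‖ ≤ Real.exp c / 2 * ‖s‖ ^ 2 * t ^ 2 := by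
    refine image_norm_le_of_norm_deriv_right_le_deriv_boundary
      (f' := fun t : ℝ => Complex.exp (t * s) * s - s)
      (B' := fun t => Real.exp c * ‖s‖ * t * ‖s‖)
      (fun t _ => (hder t).continuousAt.continuousWithinAt)
      (fun t _ => (hder t).hasDerivWithinAt) (by simp)
      (fun t => ?_) ?_
    · refine ((hasDerivAt_pow 2 t).const_mul (Real.exp c / 2 * ‖s‖ ^ 2)).congr_deriv ?_
      norm_num
      ring
    · intro t ht
      rw [← sub_one_mul, norm_mul]
      gcongr
      exact hfirst t ⟨ht.1, ht.2.le⟩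
  simpa using hsecond 1 (by simp)

/-- Bound of the compensated jump integrand near the origin. -/
lemma norm_jump_integrand_le_of_abs_le_one {w : ℂ} (hw : 0 ≤ w.re) {y : ℝ} (hy : |y| ≤ 1) :
    ‖Complex.exp (w * y) - 1 - w * (Complex.exp y - 1)‖ ≤
      (1 + ‖w‖ + ‖w‖ ^ 2) * (Real.exp (max w.re 1) / 2 * y ^ 2) := by
  have hy1 := (abs_le.1 hy).2
  have hre : (w * y).re ≤ max w.re 1 := by
    rw [Complex.re_mul_ofReal]
    exact (mul_le_of_le_one_right hw hy1).trans (le_max_left _ _)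
  have hmax : (0 : ℝ) ≤ max w.re 1 := zero_le_one.trans (le_max_right _ _)
  have h1 := norm_exp_sub_one_sub_self_le hmax hre
  have h2 := norm_exp_sub_one_sub_self_le (s := (y : ℂ)) hmax
    (by simpa using Or.inr hy1)
  rw [norm_mul, mul_pow, Complex.norm_real, Real.norm_eq_abs, sq_abs] at h1
  rw [Complex.norm_real, Real.norm_eq_abs, sq_abs] at h2
  calc ‖Complex.exp (w * y) - 1 - w * (Complex.exp y - 1)‖
      = ‖(Complex.exp (w * y) - 1 - w * y) - w * (Complex.exp y - 1 - y)‖ := by congr 1; ring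
    _ ≤ ‖Complex.exp (w * y) - 1 - w * y‖ + ‖w‖ * ‖Complex.exp y - 1 - y‖ := by
      rw [← norm_mul]; exact norm_sub_le _ _
    _ ≤ Real.exp (max w.re 1) / 2 * (‖w‖ ^ 2 * y ^ 2) +
        ‖w‖ * (Real.exp (max w.re 1) / 2 * y ^ 2) := by gcongr
    _ ≤ _ := by
      have : 0 ≤ Real.exp (max w.re 1) / 2 * y ^ 2 := by positivity
      linarith

/-- Bound of the compensated jump integrand, used away from the origin. -/
lemma norm_jump_integrand_le (w : ℂ) (y : ℝ) :
    ‖Complex.exp (w * y) - 1 - w * (Complex.exp y - 1)‖ ≤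
      (1 + ‖w‖ + ‖w‖ ^ 2) * (Real.exp (w.re * y) + Real.exp y + 2) := by
  have h1 : ‖Complex.exp (w * y) - 1‖ ≤ Real.exp (w.re * y) + 1 := by
    refine (norm_sub_le _ _).trans_eq ?_
    rw [Complex.norm_exp, Complex.re_mul_ofReal, norm_one]
  have h2 : ‖Complex.exp y - 1‖ ≤ Real.exp y + 1 := by
    refine (norm_sub_le _ _).trans_eq ?_
    rw [Complex.norm_exp, Complex.ofReal_re, norm_one]
  have hw := norm_nonneg w
  calc ‖Complex.exp (w * y) - 1 - w * (Complex.exp y - 1)‖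
      ≤ ‖Complex.exp (w * y) - 1‖ + ‖w‖ * ‖Complex.exp y - 1‖ := by
        rw [← norm_mul]; exact norm_sub_le _ _
    _ ≤ (Real.exp (w.re * y) + 1) + ‖w‖ * (Real.exp y + 1) := by gcongr
    _ ≤ _ := by
      have e1 := Real.exp_pos (w.re * y)
      have e2 := Real.exp_pos y
      have p1 := mul_nonneg hw e1.le
      have p2 : 0 ≤ ‖w‖ ^ 2 * (Real.exp (w.re * y) + Real.exp y + 2) := by positivity
      linarith

/-- Quadratic growth bound for the full characteristic exponent
`Ψ(-z) = iz(1+iz)σ²/2 + Ψ_J(-z)` along the line `iv + ℝ`: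
`|Ψ(-z)| ≤ (1 + |z| + |z|²)(M + σ²/2)` (Lemma 3 of the paper). -/
theorem bound_Psi
    (v : ℝ) (hv : 0 ≤ v)
    (ν : Measure ℝ) [SigmaFinite ν]
    (hν0 : ν {0} = 0)
    (hν1 : IntegrableOn (fun y : ℝ => y ^ 2) {y : ℝ | |y| ≤ 1} ν)
    (hν2 : ν {y : ℝ | 1 < |y|} < ⊤)
    (hν3 : IntegrableOn (fun y : ℝ => Real.exp (v * y)) {y : ℝ | 1 < |y|} ν)
    (hν4 : IntegrableOn (fun y : ℝ => Real.exp y) {y : ℝ | 1 < |y|} ν)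
    (M : ℝ)
    (hM : M = (Real.exp (max v 1) / 2) * (∫ y in {y : ℝ | |y| ≤ 1}, y ^ 2 ∂ν) +
      ∫ y in {y : ℝ | 1 < |y|}, (Real.exp (v * y) + Real.exp y + 2) ∂ν) :
    ∀ σ : ℝ, 0 ≤ σ → ∀ u : ℝ,
      ‖Complex.I * ((u : ℂ) + (v : ℂ) * Complex.I) *
            (1 + Complex.I * ((u : ℂ) + (v : ℂ) * Complex.I)) * (σ : ℂ) ^ 2 / 2 +
          ∫ y : ℝ,
            (Complex.exp (-(Complex.I * ((u : ℂ) + (v : ℂ) * Complex.I) * (y : ℂ))) - 1 +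
              Complex.I * ((u : ℂ) + (v : ℂ) * Complex.I) * (Complex.exp (y : ℂ) - 1)) ∂ν‖ ≤
        (1 + ‖(u : ℂ) + (v : ℂ) * Complex.I‖ + ‖(u : ℂ) + (v : ℂ) * Complex.I‖ ^ 2) *
          (M + σ ^ 2 / 2) := by
  intro σ _ u
  set z : ℂ := (u : ℂ) + (v : ℂ) * Complex.I with hz
  have hre : (-(Complex.I * z)).re = v := by simp [hz]
  have hnorm : ‖-(Complex.I * z)‖ = ‖z‖ := by simp
  have hS : MeasurableSet {y : ℝ | |y| ≤ 1} := measurableSet_le measurable_norm measurable_const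
  have hT : MeasurableSet {y : ℝ | 1 < |y|} := measurableSet_lt measurable_const measurable_norm
  have hsmall : IntegrableOn (fun y : ℝ => Real.exp (max v 1) / 2 * y ^ 2) {y : ℝ | |y| ≤ 1} ν :=
    hν1.const_mul _
  have hlarge : IntegrableOn (fun y : ℝ => Real.exp (v * y) + Real.exp y + 2)
      {y : ℝ | 1 < |y|} ν := (hν3.add hν4).add (integrableOn_const hν2.ne)
  have hjump : ‖∫ y : ℝ, (Complex.exp (-(Complex.I * z * (y : ℂ))) - 1 +
      Complex.I * z * (Complex.exp (y : ℂ) - 1)) ∂ν‖ ≤ (1 + ‖z‖ + ‖z‖ ^ 2) * M := by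
    have hM' : (1 + ‖z‖ + ‖z‖ ^ 2) * M = ∫ y, (1 + ‖z‖ + ‖z‖ ^ 2) *
        ({y : ℝ | |y| ≤ 1}.indicator (fun y : ℝ => Real.exp (max v 1) / 2 * y ^ 2) y +
        {y : ℝ | 1 < |y|}.indicator
          (fun y : ℝ => Real.exp (v * y) + Real.exp y + 2) y) ∂ν := by
      rw [integral_const_mul, integral_add (hsmall.integrable_indicator hS)
        (hlarge.integrable_indicator hT), integral_indicator hS, integral_indicator hT,
        integral_const_mul, hM]
    rw [hM']
    refine norm_integral_le_of_norm_le (((hsmall.integrable_indicator hS).add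
      (hlarge.integrable_indicator hT)).const_mul _) (Filter.Eventually.of_forall fun y => ?_)
    have hform : Complex.exp (-(Complex.I * z * (y : ℂ))) - 1 +
        Complex.I * z * (Complex.exp (y : ℂ) - 1) =
        Complex.exp (-(Complex.I * z) * y) - 1 - -(Complex.I * z) * (Complex.exp y - 1) := by
      rw [neg_mul, neg_mul, sub_neg_eq_add]
    rw [hform]
    by_cases hy : |y| ≤ 1
    · have h := norm_jump_integrand_le_of_abs_le_one (hre.symm ▸ hv) hy
      rw [hre, hnorm] at h
      simpa [Set.indicator, hy, not_lt.2 hy] using h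
    · have h := norm_jump_integrand_le (-(Complex.I * z)) y
      rw [hre, hnorm] at h
      simpa [Set.indicator, hy, not_le.1 hy] using h
  have hgauss : ‖Complex.I * z * (1 + Complex.I * z) * (σ : ℂ) ^ 2 / 2‖ ≤
      (1 + ‖z‖ + ‖z‖ ^ 2) * (σ ^ 2 / 2) := by
    have h1 : ‖1 + Complex.I * z‖ ≤ 1 + ‖z‖ := by
      simpa using norm_add_le 1 (Complex.I * z)
    calc ‖Complex.I * z * (1 + Complex.I * z) * (σ : ℂ) ^ 2 / 2‖
        = ‖z‖ * ‖1 + Complex.I * z‖ * (σ ^ 2 / 2) := by simp [mul_div_assoc]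
      _ ≤ ‖z‖ * (1 + ‖z‖) * (σ ^ 2 / 2) := by gcongr
      _ ≤ _ := by gcongr; linarith
  exact (norm_add_le _ _).trans ((add_le_add hgauss hjump).trans_eq (by ring))
end

section
/- Assume ∫_ℝ |φ(u+iv)| / |u+iv| du < ∞. Then for every x ∈ ℝ, μ((x,∞)) = −(1/2π) ∫_ℝ e^{i(u+iv)x} · φ(u+iv) / (i(u+iv)) du. -/
open MeasureTheory

open Set in
lemma integrable_prod_indicator_Iio_cexp {μ : Measure ℝ} [SFinite μ] {a : ℂ} (ha : 0 < a.re)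
    (hμ : Integrable (fun s : ℝ => Real.exp (a.re * s)) μ) :
    Integrable (fun p : ℝ × ℝ => (Set.Iio p.1).indicator (fun x : ℝ => Complex.exp (a * x)) p.2)
      (μ.prod volume) := by
  have hmeas : AEStronglyMeasurable
      (fun p : ℝ × ℝ => (Set.Iio p.1).indicator (fun x : ℝ => Complex.exp (a * x)) p.2)
      (μ.prod volume) := by
    have hS : MeasurableSet {p : ℝ × ℝ | p.2 < p.1} := measurableSet_lt measurable_snd measurable_fst
    have hf : Measurable (fun p : ℝ × ℝ => Complex.exp (a * p.2)) := by fun_prop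
    exact (hf.indicator hS).aestronglyMeasurable
  rw [integrable_prod_iff hmeas]
  refine ⟨.of_forall fun s => ?_, ?_⟩
  · exact (integrable_indicator_iff measurableSet_Iio).2
      ((integrableOn_exp_mul_complex_Iic ha s).mono_set Iio_subset_Iic_self)
  · have hnorm (s : ℝ) :
        ∫ x : ℝ, ‖(Set.Iio s).indicator (fun x : ℝ => Complex.exp (a * x)) x‖ =
          Real.exp (a.re * s) / a.re := by
      simp_rw [norm_indicator_eq_indicator_norm, Complex.norm_exp]
      rw [integral_indicator measurableSet_Iio, ← integral_Iic_eq_integral_Iio,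
        ← integral_exp_mul_Iic ha]
      simp
    simp_rw [hnorm]
    exact hμ.div_const _

lemma integral_indicator_Iio_cexp (μ : Measure ℝ) (a : ℂ) (x : ℝ) :
    ∫ s : ℝ, (Set.Iio s).indicator (fun x : ℝ => Complex.exp (a * x)) x ∂μ =
      Complex.exp (a * x) * μ.real (Set.Ioi x) := by
  have h : (fun s : ℝ => (Set.Iio s).indicator (fun x : ℝ => Complex.exp (a * x)) x) =
      (Set.Ioi x).indicator (fun _ => Complex.exp (a * x)) := by
    ext s
    simp [Set.indicator_apply]
  rw [h, integral_indicator measurableSet_Ioi, setIntegral_const, Complex.real_smul, mul_comm]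

/-- The exponentially damped tail `x ↦ e^{ax} μ((x,∞))` is integrable. -/
lemma integrable_cexp_mul_tail {μ : Measure ℝ} [SFinite μ] {a : ℂ} (ha : 0 < a.re)
    (hμ : Integrable (fun s : ℝ => Real.exp (a.re * s)) μ) :
    Integrable (fun x : ℝ => Complex.exp (a * x) * μ.real (Set.Ioi x)) := by
  simpa only [integral_indicator_Iio_cexp] using
    (integrable_prod_indicator_Iio_cexp ha hμ).integral_prod_right

lemma integral_cexp_mul_tail {μ : Measure ℝ} [SFinite μ] {a : ℂ} (ha : 0 < a.re)
    (hμ : Integrable (fun s : ℝ => Real.exp (a.re * s)) μ) :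
    ∫ x : ℝ, Complex.exp (a * x) * μ.real (Set.Ioi x) = (∫ s : ℝ, Complex.exp (a * s) ∂μ) / a := by
  simp_rw [← integral_indicator_Iio_cexp]
  rw [← integral_integral_swap (f := fun s x : ℝ =>
      (Set.Iio s).indicator (fun x : ℝ => Complex.exp (a * x)) x)
      (integrable_prod_indicator_Iio_cexp ha hμ), ← integral_div]
  congr 1
  ext s
  rw [integral_indicator measurableSet_Iio, ← integral_Iic_eq_integral_Iio,
    integral_exp_mul_complex_Iic ha]

open FourierTransform in
/-- The Fourier transform of the damped tail of `μ`. -/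
lemma fourier_cexp_mul_tail {μ : Measure ℝ} [SFinite μ] {v : ℝ} (hv : 0 < v)
    (hμ : Integrable (fun s : ℝ => Real.exp (v * s)) μ) (w : ℝ) :
    𝓕 (fun x : ℝ => Complex.exp (v * x) * μ.real (Set.Ioi x)) w =
      (∫ s : ℝ, Complex.exp ((v - 2 * Real.pi * w * Complex.I) * s) ∂μ) /
        (v - 2 * Real.pi * w * Complex.I) := by
  have hre : ((v : ℂ) - 2 * Real.pi * w * Complex.I).re = v := by simp
  rw [← integral_cexp_mul_tail (by rwa [hre]) (by rwa [hre]), Real.fourier_real_eq_integral_exp_smul]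
  congr 1
  ext x
  rw [smul_eq_mul, ← mul_assoc, ← Complex.exp_add]
  push_cast
  ring_nf

lemma antitone_measureReal_Ioi (μ : Measure ℝ) [IsFiniteMeasure μ] :
    Antitone fun x : ℝ => μ.real (Set.Ioi x) :=
  fun _ _ h => measureReal_mono (Set.Ioi_subset_Ioi h)

lemma continuousWithinAt_measureReal_Ioi (μ : Measure ℝ) [IsProbabilityMeasure μ] (x : ℝ) :
    ContinuousWithinAt (fun x : ℝ => μ.real (Set.Ioi x)) (Set.Ici x) x := by
  have h : (fun x : ℝ => μ.real (Set.Ioi x)) = fun x => 1 - ProbabilityTheory.cdf μ x := by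
    ext y
    rw [ProbabilityTheory.cdf_eq_real, ← Set.compl_Iic, probReal_compl_eq_one_sub measurableSet_Iic]
  rw [h]
  exact continuousWithinAt_const.sub ((ProbabilityTheory.cdf μ).right_continuous x)

/-- Two right-continuous functions that agree off a countable set are equal. -/
lemma eq_of_continuousWithinAt_Ici_of_countable {E : Type*} [TopologicalSpace E] [T2Space E]
    {f g : ℝ → E} {s : Set ℝ} (hs : s.Countable) (hfg : ∀ y ∉ s, f y = g y) {x : ℝ}
    (hf : ContinuousWithinAt f (Set.Ici x) x) (hg : ContinuousWithinAt g (Set.Ici x) x) :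
    f x = g x := by
  have hx : x ∈ closure (Set.Ioi x ∩ sᶜ) :=
    closure_minimal ((hs.dense_compl ℝ).open_subset_closure_inter isOpen_Ioi) isClosed_closure
      (by rw [closure_Ioi]; exact Set.self_mem_Ici)
  have : (nhdsWithin x (Set.Ioi x ∩ sᶜ)).NeBot := mem_closure_iff_nhdsWithin_neBot.1 hx
  have hsub : Set.Ioi x ∩ sᶜ ⊆ Set.Ici x := Set.inter_subset_left.trans Set.Ioi_subset_Ici_self
  refine tendsto_nhds_unique (hf.mono hsub) ((hg.mono hsub).congr' ?_)
  filter_upwards [self_mem_nhdsWithin] with y hy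
  exact (hfg y hy.2).symm

open FourierTransform in
lemma Real.continuous_fourier_of_integrable {f : ℝ → ℂ} (hf : Integrable f) : Continuous (𝓕 f) :=
  VectorFourier.fourierIntegral_continuous Real.continuous_fourierChar
    (innerSL ℝ).continuous₂ hf

open FourierTransform in
/-- Fourier inversion for the damped tail, valid at every point. -/
lemma fourierInv_fourier_cexp_mul_tail {μ : Measure ℝ} [IsProbabilityMeasure μ] {v : ℝ}
    (hv : 0 < v) (hμ : Integrable (fun s : ℝ => Real.exp (v * s)) μ)
    (hF : Integrable (𝓕 fun x : ℝ => Complex.exp (v * x) * μ.real (Set.Ioi x))) (x : ℝ) :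
    𝓕⁻ (𝓕 fun x : ℝ => Complex.exp (v * x) * μ.real (Set.Ioi x)) x =
      Complex.exp (v * x) * μ.real (Set.Ioi x) := by
  have hexp : Continuous fun x : ℝ => Complex.exp (v * x) := by fun_prop
  have hinv : Continuous
      (𝓕⁻ (𝓕 fun x : ℝ => Complex.exp (v * x) * μ.real (Set.Ioi x))) := by
    rw [Real.fourierInv_eq_fourier_comp_neg]
    exact Real.continuous_fourier_of_integrable hF.comp_neg
  refine eq_of_continuousWithinAt_Ici_of_countable
    (g := fun x : ℝ => Complex.exp (v * x) * μ.real (Set.Ioi x))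
    (antitone_measureReal_Ioi μ).countable_not_continuousAt (fun y hy => ?_)
    hinv.continuousWithinAt (hexp.continuousWithinAt.mul
      (Complex.continuous_ofReal.continuousAt.comp_continuousWithinAt
        (continuousWithinAt_measureReal_Ioi μ x)))
  refine (integrable_cexp_mul_tail (a := v) (by simpa) (by simpa)).fourierInv_fourier_eq hF
    (hexp.continuousAt.mul (Complex.continuous_ofReal.continuousAt.comp ?_))
  simpa using hy

/-- Lewis-type representation of the tail probability (digital option price),
equation (7) of the paper: if `∫ |φ(u+iv)|/|u+iv| du < ∞` then
`μ((x,∞)) = -(1/2π) ∫ e^{i(u+iv)x} φ(u+iv) / (i(u+iv)) du`. -/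
theorem prob_Lewis
    (v τ : ℝ) (hv : 0 < v) (hτ : 0 < τ)
    (μ : Measure ℝ) [IsProbabilityMeasure μ]
    (hμv : Integrable (fun s : ℝ => Real.exp (v * s)) μ)
    (hmart1 : Integrable (fun s : ℝ => Real.exp s) μ)
    (hmart2 : ∫ s : ℝ, Real.exp s ∂μ = 1)
    (φ : ℂ → ℂ)
    (hφ : ∀ z : ℂ, φ z = ∫ s : ℝ, Complex.exp (-(Complex.I * z * (s : ℂ))) ∂μ)
    (hint : Integrable (fun u : ℝ =>
      ‖φ ((u : ℂ) + (v : ℂ) * Complex.I)‖ / ‖(u : ℂ) + (v : ℂ) * Complex.I‖)) :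
    ∀ x : ℝ,
      ((μ (Set.Ioi x)).toReal : ℂ) =
        -(1 / (2 * (Real.pi : ℂ))) *
          ∫ u : ℝ,
            Complex.exp (Complex.I * ((u : ℂ) + (v : ℂ) * Complex.I) * (x : ℂ)) *
              φ ((u : ℂ) + (v : ℂ) * Complex.I) /
                (Complex.I * ((u : ℂ) + (v : ℂ) * Complex.I)) := by
  intro x
  set T : ℝ → ℂ := fun x : ℝ => Complex.exp (v * x) * μ.real (Set.Ioi x)
  have hFT (w : ℝ) : FourierTransform.fourier T w =
      -(φ ((2 * Real.pi * w : ℝ) + v * Complex.I) /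
        (Complex.I * ((2 * Real.pi * w : ℝ) + v * Complex.I))) := by
    have hden : (v : ℂ) - 2 * Real.pi * w * Complex.I =
        -(Complex.I * ((2 * Real.pi * w : ℝ) + v * Complex.I)) := by
      push_cast
      linear_combination (v : ℂ) * Complex.I_sq
    rw [fourier_cexp_mul_tail hv hμv, hφ, hden, div_neg]
    simp only [neg_mul]
  have hTint : Integrable T := integrable_cexp_mul_tail (a := v) (by simpa) (by simpa)
  have hF : Integrable (FourierTransform.fourier T) := by
    refine (integrable_norm_iff
      (Real.continuous_fourier_of_integrable hTint).aestronglyMeasurable).1 ?_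
    refine (hint.comp_mul_left' (R := 2 * Real.pi) (by positivity)).congr (.of_forall fun w => ?_)
    simp only [hFT, norm_neg, norm_div, norm_mul, Complex.norm_I, one_mul]
  have hinv := fourierInv_fourier_cexp_mul_tail hv hμv hF x
  rw [Real.fourierInv_eq'] at hinv
  have hmul : (μ.real (Set.Ioi x) : ℂ) = Complex.exp (-(v * x)) *
      ∫ w : ℝ, Complex.exp ((2 * Real.pi * inner ℝ w x : ℝ) * Complex.I) •
        FourierTransform.fourier T w := by
    rw [hinv, ← mul_assoc, ← Complex.exp_add, neg_add_cancel, Complex.exp_zero, one_mul]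
  change (μ.real (Set.Ioi x) : ℂ) = _
  set G : ℝ → ℂ := fun u => Complex.exp (Complex.I * (u + v * Complex.I) * x) *
    φ (u + v * Complex.I) / (Complex.I * (u + v * Complex.I)) with hG
  have hscale : ∫ w : ℝ, G (2 * Real.pi * w) = (1 / (2 * Real.pi : ℂ)) * ∫ u : ℝ, G u := by
    rw [Measure.integral_comp_mul_left, abs_of_pos (by positivity), Complex.real_smul]
    push_cast
    rw [one_div]
  rw [hmul, neg_mul, ← hscale, ← integral_const_mul, ← integral_neg]
  congr 1
  ext w
  have hexp : Complex.exp (Complex.I * ((2 * Real.pi * w : ℝ) + v * Complex.I) * x) =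
      Complex.exp (-(v * x)) * Complex.exp ((2 * Real.pi * inner ℝ w x : ℝ) * Complex.I) := by
    rw [← Complex.exp_add]
    congr 1
    simp only [RCLike.inner_apply, conj_trivial]
    push_cast
    linear_combination (v * x : ℂ) * Complex.I_sq
  simp only [hG]
  rw [hexp, hFT, smul_eq_mul]
  ring
end

section
/- Let n ∈ ℕ and assume ∫_ℝ |u+iv|^n · |φ(u+iv)| du < ∞. Then μ is absolutely continuous with respect to Lebesgue measure with a density f : ℝ → ℝ that is n times continuously differentiable, and for every x ∈ ℝ, f^{(n)}(x) = (1/2π) ∫_ℝ (i(u+iv))^n · e^{i(u+iv)x} · φ(u+iv) du. -/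
open MeasureTheory

open Filter Set Function
open scoped FourierTransform SchwartzMap Topology ContDiff

/-- Two measures on `ℝ` with the same integrals of nonnegative smooth compactly supported functions
are equal. -/
theorem Real.measure_ext_of_lintegral_contDiff {μ ν : Measure ℝ} [IsLocallyFiniteMeasure μ]
    (h : ∀ g : ℝ → ℝ, ContDiff ℝ ∞ g → HasCompactSupport g → (∀ x, 0 ≤ g x) →
      ∫⁻ x, ENNReal.ofReal (g x) ∂μ = ∫⁻ x, ENNReal.ofReal (g x) ∂ν) :
    μ = ν := by
  refine Real.measure_ext_Ioo_rat fun a b => ?_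
  obtain ⟨p, hp_supp, hp_smooth, hp_range⟩ :=
    (isOpen_Ioo (a := (a : ℝ)) (b := (b : ℝ))).exists_contDiff_support_eq (n := ⊤)
  have hp0 : ∀ x, 0 ≤ p x := fun x => (hp_range (mem_range_self x)).1
  let g : ℕ → ℝ → ℝ := fun k x => Real.smoothTransition (k * p x)
  have hg_smooth : ∀ k, ContDiff ℝ ∞ (g k) := fun k =>
    Real.smoothTransition.contDiff.comp (contDiff_const.mul hp_smooth)
  have hg_supp : ∀ k, HasCompactSupport (g k) := fun k => by
    refine HasCompactSupport.of_support_subset_isCompact (isCompact_Icc (a := (a : ℝ)) (b := b)) ?_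
    intro x hx
    refine Ioo_subset_Icc_self (hp_supp ▸ ?_)
    intro hpx
    exact hx (by simp [g, hpx])
  have key : ∀ m : Measure ℝ, Tendsto (fun k => ∫⁻ x, ENNReal.ofReal (g k x) ∂m) atTop
      (𝓝 (m (Ioo (a : ℝ) b))) := fun m => by
    rw [← lintegral_indicator_one measurableSet_Ioo]
    refine lintegral_tendsto_of_tendsto_of_monotone
      (fun k => (hg_smooth k).continuous.measurable.ennreal_ofReal.aemeasurable)
      (ae_of_all _ fun x i j hij => ENNReal.ofReal_le_ofReal (Real.smoothTransition.monotone ?_))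
      (ae_of_all _ fun x => ?_)
    · exact mul_le_mul_of_nonneg_right (mod_cast hij) (hp0 x)
    · by_cases hx : x ∈ Ioo (a : ℝ) b
      · have hpx : 0 < p x := lt_of_le_of_ne (hp0 x) (Ne.symm (by rwa [← hp_supp] at hx))
        have hev : ∀ᶠ k : ℕ in atTop, (1 : ℝ) ≤ k * p x :=
          ((tendsto_natCast_atTop_atTop (R := ℝ)).atTop_mul_const hpx).eventually_ge_atTop 1
        refine tendsto_const_nhds.congr' (hev.mono fun k hk => ?_)
        simp [g, hx, Real.smoothTransition.one_of_one_le hk]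
      · have hpx : p x = 0 := by rwa [← hp_supp, notMem_support] at hx
        simp [g, hx, hpx]
  refine tendsto_nhds_unique (key μ) ((key ν).congr fun k => ?_)
  exact (h (g k) (hg_smooth k) (hg_supp k) fun x => Real.smoothTransition.nonneg _).symm

theorem Real.continuous_fourier_charFun (ν : Measure ℝ) (hν : Integrable (charFun ν)) :
    Continuous (𝓕 (fun ξ : ℝ => charFun ν (2 * Real.pi * ξ))) :=
  VectorFourier.fourierIntegral_continuous Real.continuous_fourierChar (by simp; fun_prop)
    (hν.comp_mul_left' (by positivity))

/-- Parseval's identity between a Schwartz function and a finite measure with integrable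
characteristic function. -/
theorem SchwartzMap.integral_eq_integral_mul_fourier_charFun (ν : Measure ℝ) [IsFiniteMeasure ν]
    (hν : Integrable (charFun ν)) (H : 𝓢(ℝ, ℂ)) :
    ∫ x, H x ∂ν = ∫ x, H x * 𝓕 (fun ξ : ℝ => charFun ν (2 * Real.pi * ξ)) x := by
  have hint : Integrable (fun ξ : ℝ => charFun ν (2 * Real.pi * ξ)) :=
    hν.comp_mul_left' (by positivity)
  have hinv : 𝓕⁻ (𝓕 (H : ℝ → ℂ)) = H := by
    rw [← SchwartzMap.fourier_coe, ← SchwartzMap.fourierInv_coe,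
      FourierTransform.fourierInv_fourier_eq]
  have h1 := VectorFourier.integral_fourierIntegral_smul_eq_flip (L := -innerₗ ℝ)
    (μ := volume) (ν := ν) (f := 𝓕 (H : ℝ → ℂ)) (g := fun _ => (1 : ℂ)) Real.continuous_fourierChar
    (by simp; fun_prop) (𝓕 H).integrable (integrable_const 1)
  have h2 := VectorFourier.integral_fourierIntegral_smul_eq_flip (L := innerₗ ℝ)
    (μ := volume) (ν := volume) (f := (H : ℝ → ℂ)) Real.continuous_fourierChar
    (by simp; fun_prop) H.integrable hint
  calc ∫ x, H x ∂ν = ∫ x, 𝓕⁻ (𝓕 (H : ℝ → ℂ)) x • (1 : ℂ) ∂ν := by simp [hinv]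
    _ = _ := h1
    _ = ∫ ξ, 𝓕 (H : ℝ → ℂ) ξ • charFun ν (2 * Real.pi * ξ) := by
      congr with ξ
      congr 1
      simp only [VectorFourier.fourierIntegral, charFun_apply_real, Circle.smul_def,
        Real.fourierChar_apply]
      congr with x
      simp
      ring_nf
    _ = _ := h2
    _ = _ := by simp [Real.fourier_eq, VectorFourier.fourierIntegral]

theorem Real.integral_eq_integral_mul_re_fourier_charFun (ν : Measure ℝ) [IsFiniteMeasure ν]
    (hν : Integrable (charFun ν)) {g : ℝ → ℝ} (hg : ContDiff ℝ ∞ g) (hgc : HasCompactSupport g) :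
    ∫ x, g x ∂ν = ∫ x, g x * (𝓕 (fun ξ : ℝ => charFun ν (2 * Real.pi * ξ)) x).re := by
  have hc : HasCompactSupport (fun x => (g x : ℂ)) := hgc.comp_left Complex.ofReal_zero
  have key := SchwartzMap.integral_eq_integral_mul_fourier_charFun ν hν
    (hc.toSchwartzMap (Complex.ofRealCLM.contDiff.comp hg))
  have hI : Integrable (fun x => (g x : ℂ) * 𝓕 (fun ξ : ℝ => charFun ν (2 * Real.pi * ξ)) x) :=
    ((Complex.continuous_ofReal.comp hg.continuous).mul
      (Real.continuous_fourier_charFun ν hν)).integrable_of_hasCompactSupport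
      hc.mul_right
  have key' : ∫ x, (g x : ℂ) ∂ν =
      ∫ x, (g x : ℂ) * 𝓕 (fun ξ : ℝ => charFun ν (2 * Real.pi * ξ)) x := key
  have hre := congrArg Complex.re key'
  rw [integral_complex_ofReal, Complex.ofReal_re, ← RCLike.re_eq_complex_re,
    ← integral_re hI] at hre
  simpa using hre

/-- The candidate density given by Fourier inversion is nonnegative. -/
theorem Real.re_fourier_charFun_nonneg (ν : Measure ℝ) [IsFiniteMeasure ν]
    (hν : Integrable (charFun ν)) (x : ℝ) :
    0 ≤ (𝓕 (fun ξ : ℝ => charFun ν (2 * Real.pi * ξ)) x).re := by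
  set r : ℝ → ℝ := fun x => (𝓕 (fun ξ : ℝ => charFun ν (2 * Real.pi * ξ)) x).re
  have hcont : Continuous r :=
    Complex.continuous_re.comp (Real.continuous_fourier_charFun ν hν)
  by_contra! hx
  obtain ⟨g, hg_supp, hgc, hg, hg_range, hgx⟩ := exists_contDiff_tsupport_subset (n := ⊤)
    ((isOpen_lt hcont continuous_const).mem_nhds (show r x < 0 from hx))
  have hg0 : ∀ y, 0 ≤ g y := fun y => (hg_range (mem_range_self y)).1
  have hpos : 0 < ∫ y, g y * -r y := by
    refine (hg.continuous.mul hcont.neg).integral_pos_of_hasCompactSupport_nonneg_nonzero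
      hgc.mul_right (fun y => ?_) (x := x) ?_
    · by_cases hy : g y = 0
      · simp [hy]
      · have : r y < 0 := hg_supp (subset_tsupport g hy)
        exact mul_nonneg (hg0 y) (by linarith)
    · rw [hgx, one_mul]
      exact neg_ne_zero.2 hx.ne
  have hkey := Real.integral_eq_integral_mul_re_fourier_charFun ν hν hg hgc
  have hnn : 0 ≤ ∫ y, g y ∂ν := integral_nonneg hg0
  simp only [mul_neg, integral_neg] at hpos
  linarith

/-- A finite measure with integrable characteristic function has the density given by Fourier
inversion. -/
theorem Real.eq_withDensity_re_fourier_charFun (ν : Measure ℝ) [IsFiniteMeasure ν]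
    (hν : Integrable (charFun ν)) :
    ν = volume.withDensity (fun x =>
      ENNReal.ofReal (𝓕 (fun ξ : ℝ => charFun ν (2 * Real.pi * ξ)) x).re) := by
  have hcont : Continuous (fun x => (𝓕 (fun ξ : ℝ => charFun ν (2 * Real.pi * ξ)) x).re) :=
    Complex.continuous_re.comp (Real.continuous_fourier_charFun ν hν)
  refine Real.measure_ext_of_lintegral_contDiff fun g hg hgc hg0 => ?_
  rw [lintegral_withDensity_eq_lintegral_mul _ hcont.measurable.ennreal_ofReal
    hg.continuous.measurable.ennreal_ofReal, ← ofReal_integral_eq_lintegral_ofReal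
    (hg.continuous.integrable_of_hasCompactSupport hgc) (ae_of_all _ hg0),
    Real.integral_eq_integral_mul_re_fourier_charFun ν hν hg hgc,
    ofReal_integral_eq_lintegral_ofReal
    ((hg.continuous.fun_mul hcont).integrable_of_hasCompactSupport hgc.mul_right)
    (ae_of_all _ fun x => mul_nonneg (hg0 x) (Real.re_fourier_charFun_nonneg ν hν x))]
  congr with x
  rw [ENNReal.ofReal_mul (hg0 x), mul_comm]
  rfl

/-- A chain of `n` successive derivatives ending in a continuous function computes the iterated
derivative. -/
theorem contDiff_and_iteratedDeriv_of_hasDerivAt {E : Type*} [NormedAddCommGroup E]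
    [NormedSpace ℝ E] {n : ℕ} {F : ℕ → ℝ → E}
    (hF : ∀ k < n, ∀ x, HasDerivAt (F k) (F (k + 1) x) x) (hcont : Continuous (F n)) :
    ContDiff ℝ n (F 0) ∧ iteratedDeriv n (F 0) = F n := by
  induction n generalizing F with
  | zero => exact ⟨contDiff_zero.2 hcont, iteratedDeriv_zero⟩
  | succ n ih =>
    have hderiv : deriv (F 0) = F 1 := funext fun x => (hF 0 n.succ_pos x).deriv
    obtain ⟨h1, h2⟩ := ih (F := fun k => F (k + 1)) (fun k hk => hF (k + 1) (by omega)) hcont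
    refine ⟨?_, ?_⟩
    · push_cast
      exact contDiff_succ_iff_deriv.2
        ⟨fun x => (hF 0 n.succ_pos x).differentiableAt, by simp, hderiv ▸ h1⟩
    · rw [iteratedDeriv_succ', hderiv, h2]

/-- The integrand of the inversion formula, along the horizontal line at height `v`. -/
noncomputable def lewisIntegrand (v : ℝ) (g : ℝ → ℂ) (k : ℕ) (x u : ℝ) : ℂ :=
  (Complex.I * ((u : ℂ) + (v : ℂ) * Complex.I)) ^ k *
    Complex.exp (Complex.I * ((u : ℂ) + (v : ℂ) * Complex.I) * (x : ℂ)) * g u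

section lewisIntegrand

variable {v : ℝ} {g : ℝ → ℂ} {k : ℕ}

theorem norm_lewisIntegrand (x u : ℝ) : ‖lewisIntegrand v g k x u‖ =
    Real.exp (-(v * x)) * (‖(u : ℂ) + (v : ℂ) * Complex.I‖ ^ k * ‖g u‖) := by
  rw [lewisIntegrand, norm_mul, norm_mul, norm_pow, norm_mul, Complex.norm_I, one_mul,
    Complex.norm_exp]
  have : (Complex.I * ((u : ℂ) + (v : ℂ) * Complex.I) * (x : ℂ)).re = -(v * x) := by simp
  rw [this]
  ring

theorem norm_lewisIntegrand_le {x₀ x : ℝ} (hx : x ∈ Metric.ball x₀ 1) (u : ℝ) :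
    ‖lewisIntegrand v g k x u‖ ≤
      Real.exp (|v| * (|x₀| + 1)) * (‖(u : ℂ) + (v : ℂ) * Complex.I‖ ^ k * ‖g u‖) := by
  rw [norm_lewisIntegrand]
  gcongr
  rw [Metric.mem_ball, Real.dist_eq] at hx
  have hx' : |x| ≤ |x₀| + 1 := by linarith [abs_sub_abs_le_abs_sub x x₀]
  calc -(v * x) ≤ |v * x| := neg_le_abs _
    _ = |v| * |x| := abs_mul _ _
    _ ≤ _ := by gcongr

theorem hasDerivAt_lewisIntegrand (x u : ℝ) :
    HasDerivAt (fun x => lewisIntegrand v g k x u) (lewisIntegrand v g (k + 1) x u) x := by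
  have h : HasDerivAt (fun x : ℝ =>
      Complex.exp (Complex.I * ((u : ℂ) + (v : ℂ) * Complex.I) * (x : ℂ)))
      (Complex.exp (Complex.I * ((u : ℂ) + (v : ℂ) * Complex.I) * (x : ℂ)) *
        (Complex.I * ((u : ℂ) + (v : ℂ) * Complex.I) * 1)) x :=
    (Complex.ofRealCLM.hasDerivAt.const_mul _).cexp
  refine ((h.const_mul ((Complex.I * ((u : ℂ) + (v : ℂ) * Complex.I)) ^ k)).mul_const
    (g u)).congr_deriv ?_
  rw [lewisIntegrand]
  ring

theorem aestronglyMeasurable_lewisIntegrand (hg : AEStronglyMeasurable g) (x : ℝ) :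
    AEStronglyMeasurable (lewisIntegrand v g k x) :=
  (Continuous.aestronglyMeasurable (by fun_prop)).mul hg

theorem integrable_norm_pow_mul_of_le (hv : 0 < v) (hg : AEStronglyMeasurable g) {n : ℕ}
    (hkn : k ≤ n)
    (hint : Integrable (fun u : ℝ => ‖(u : ℂ) + (v : ℂ) * Complex.I‖ ^ n * ‖g u‖)) :
    Integrable (fun u : ℝ => ‖(u : ℂ) + (v : ℂ) * Complex.I‖ ^ k * ‖g u‖) := by
  refine (hint.const_mul ((v ^ (n - k))⁻¹)).mono'
    ((Continuous.aestronglyMeasurable (by fun_prop)).mul hg.norm) (ae_of_all _ fun u => ?_)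
  have hle : v ≤ ‖(u : ℂ) + (v : ℂ) * Complex.I‖ := by
    simpa [abs_of_pos hv] using Complex.abs_im_le_norm ((u : ℂ) + (v : ℂ) * Complex.I)
  rw [Real.norm_of_nonneg (by positivity), ← mul_assoc]
  gcongr
  rw [le_inv_mul_iff₀ (by positivity), ← Nat.sub_add_cancel hkn, pow_add, Nat.add_sub_cancel]
  gcongr

theorem integrable_lewisIntegrand (hg : AEStronglyMeasurable g)
    (hint : Integrable (fun u : ℝ => ‖(u : ℂ) + (v : ℂ) * Complex.I‖ ^ k * ‖g u‖)) (x : ℝ) :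
    Integrable (lewisIntegrand v g k x) := by
  refine (hint.const_mul (Real.exp (-(v * x)))).mono'
    (aestronglyMeasurable_lewisIntegrand hg x) (ae_of_all _ fun u => ?_)
  rw [norm_lewisIntegrand]

theorem continuous_integral_lewisIntegrand (hg : AEStronglyMeasurable g)
    (hint : Integrable (fun u : ℝ => ‖(u : ℂ) + (v : ℂ) * Complex.I‖ ^ k * ‖g u‖)) :
    Continuous (fun x => ∫ u, lewisIntegrand v g k x u) := by
  refine continuous_iff_continuousAt.2 fun x₀ => ?_
  refine continuousAt_of_dominated
    (Eventually.of_forall fun x => aestronglyMeasurable_lewisIntegrand hg x) ?_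
    (hint.const_mul (Real.exp (|v| * (|x₀| + 1))))
    (ae_of_all _ fun u => (hasDerivAt_lewisIntegrand x₀ u).continuousAt)
  filter_upwards [Metric.ball_mem_nhds x₀ one_pos] with x hx
  exact ae_of_all _ fun u => norm_lewisIntegrand_le hx u

theorem hasDerivAt_integral_lewisIntegrand (hg : AEStronglyMeasurable g)
    (hint : Integrable (fun u : ℝ => ‖(u : ℂ) + (v : ℂ) * Complex.I‖ ^ k * ‖g u‖))
    (hint' : Integrable (fun u : ℝ => ‖(u : ℂ) + (v : ℂ) * Complex.I‖ ^ (k + 1) * ‖g u‖))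
    (x₀ : ℝ) :
    HasDerivAt (fun x => ∫ u, lewisIntegrand v g k x u)
      (∫ u, lewisIntegrand v g (k + 1) x₀ u) x₀ :=
  (hasDerivAt_integral_of_dominated_loc_of_deriv_le (Metric.ball_mem_nhds x₀ one_pos)
    (Eventually.of_forall fun x => aestronglyMeasurable_lewisIntegrand hg x)
    (integrable_lewisIntegrand hg hint x₀) (aestronglyMeasurable_lewisIntegrand hg x₀)
    (ae_of_all _ fun u _ hx => norm_lewisIntegrand_le hx u)
    (hint'.const_mul (Real.exp (|v| * (|x₀| + 1))))
    (ae_of_all _ fun u x _ => hasDerivAt_lewisIntegrand x u)).2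

open ComplexConjugate in
/-- The inversion integral of a Hermitian function is real. -/
theorem im_integral_lewisIntegrand (hg : ∀ u, g (-u) = conj (g u)) (x : ℝ) :
    (∫ u, lewisIntegrand v g k x u).im = 0 := by
  rw [← Complex.conj_eq_iff_im, ← integral_conj, ← integral_neg_eq_self]
  congr with u
  have hI : conj (Complex.I * (((-u : ℝ) : ℂ) + (v : ℂ) * Complex.I)) =
      Complex.I * ((u : ℂ) + (v : ℂ) * Complex.I) := by
    simp
    ring_nf
  rw [lewisIntegrand, map_mul, map_mul, map_pow, hI, ← Complex.exp_conj, map_mul, hI, hg,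
    Complex.conj_conj, Complex.conj_ofReal, lewisIntegrand]

end lewisIntegrand

/-- Fourier inversion along a shifted contour, in terms of the characteristic function. -/
theorem integral_lewisIntegrand_zero_charFun (ν : Measure ℝ) (v x : ℝ) :
    (1 / (2 * (Real.pi : ℂ))) * ∫ u, lewisIntegrand v (fun u => charFun ν (-u)) 0 x u =
      Real.exp (-(v * x)) * 𝓕 (fun ξ : ℝ => charFun ν (2 * Real.pi * ξ)) x := by
  have h1 : ∫ u, lewisIntegrand v (fun u => charFun ν (-u)) 0 x u =
      ∫ u : ℝ, Real.exp (-(v * x)) * (Complex.exp (-(Complex.I * u * x)) * charFun ν u) := by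
    rw [← integral_neg_eq_self]
    congr with u
    rw [lewisIntegrand, pow_zero, one_mul, neg_neg, ← mul_assoc, Complex.ofReal_exp,
      ← Complex.exp_add]
    congr 2
    push_cast
    linear_combination (v * x : ℂ) * Complex.I_sq
  rw [h1, integral_const_mul, Real.fourier_real_eq_integral_exp_smul]
  have h2 := Measure.integral_comp_mul_left
    (fun u : ℝ => Complex.exp (-(Complex.I * u * x)) * charFun ν u) (2 * Real.pi)
  have h3 : (∫ u : ℝ, Complex.exp ((-2 * Real.pi * u * x : ℝ) * Complex.I) •
      charFun ν (2 * Real.pi * u)) =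
      ∫ u : ℝ, Complex.exp (-(Complex.I * (2 * Real.pi * u : ℝ) * x)) *
        charFun ν (2 * Real.pi * u) := by
    congr with u
    rw [smul_eq_mul]
    congr 2
    push_cast
    ring
  rw [h3, h2, abs_of_pos (by positivity), Complex.real_smul]
  push_cast
  ring

/-- The exponential tilt of `μ`: the measure with density `s ↦ exp (v * s)`. -/
noncomputable def expTilt (v : ℝ) (μ : Measure ℝ) : Measure ℝ :=
  μ.withDensity fun s => ENNReal.ofReal (Real.exp (v * s))

theorem expTilt_neg_expTilt (v : ℝ) (μ : Measure ℝ) : expTilt (-v) (expTilt v μ) = μ := by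
  rw [expTilt, expTilt, ← withDensity_mul _ (by fun_prop) (by fun_prop)]
  convert withDensity_one using 2
  ext s
  simp [← ENNReal.ofReal_mul (Real.exp_nonneg _), ← Real.exp_add]

theorem charFun_expTilt_neg (v u : ℝ) (μ : Measure ℝ) :
    charFun (expTilt v μ) (-u) =
      ∫ s : ℝ, Complex.exp (-(Complex.I * ((u : ℂ) + (v : ℂ) * Complex.I) * (s : ℂ))) ∂μ := by
  rw [charFun_apply_real, expTilt, integral_withDensity_eq_integral_toReal_smul (by fun_prop)
    (ae_of_all _ fun _ => ENNReal.ofReal_lt_top)]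
  congr with s
  rw [ENNReal.toReal_ofReal (Real.exp_nonneg _), Complex.real_smul, Complex.ofReal_exp,
    ← Complex.exp_add]
  congr 1
  push_cast
  linear_combination (v * s : ℂ) * Complex.I_sq

/-- Smoothness of the density (equation (9) of the paper): if
`∫ |u+iv|^n |φ(u+iv)| du < ∞` then `μ` has a density `f` of class `C^n` with respect to
Lebesgue measure and `f⁽ⁿ⁾(x) = (1/2π) ∫ (i(u+iv))^n e^{i(u+iv)x} φ(u+iv) du`. -/
theorem density_Lewis
    (v τ : ℝ) (hv : 0 < v) (hτ : 0 < τ) (n : ℕ)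
    (μ : Measure ℝ) [IsProbabilityMeasure μ]
    (hμv : Integrable (fun s : ℝ => Real.exp (v * s)) μ)
    (hmart1 : Integrable (fun s : ℝ => Real.exp s) μ)
    (hmart2 : ∫ s : ℝ, Real.exp s ∂μ = 1)
    (φ : ℂ → ℂ)
    (hφ : ∀ z : ℂ, φ z = ∫ s : ℝ, Complex.exp (-(Complex.I * z * (s : ℂ))) ∂μ)
    (hint : Integrable (fun u : ℝ =>
      ‖(u : ℂ) + (v : ℂ) * Complex.I‖ ^ n * ‖φ ((u : ℂ) + (v : ℂ) * Complex.I)‖)) :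
    ∃ f : ℝ → ℝ,
      ContDiff ℝ n f ∧
      μ = volume.withDensity (fun x => ENNReal.ofReal (f x)) ∧
      ∀ x : ℝ,
        ((iteratedDeriv n f x : ℝ) : ℂ) =
          (1 / (2 * (Real.pi : ℂ))) *
            ∫ u : ℝ,
              (Complex.I * ((u : ℂ) + (v : ℂ) * Complex.I)) ^ n *
                Complex.exp (Complex.I * ((u : ℂ) + (v : ℂ) * Complex.I) * (x : ℂ)) *
                  φ ((u : ℂ) + (v : ℂ) * Complex.I) := by
  set ν := expTilt v μ with hν
  have : IsFiniteMeasure ν := isFiniteMeasure_withDensity_ofReal hμv.2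
  set g : ℝ → ℂ := fun u => charFun ν (-u) with hg
  have hφg : ∀ u : ℝ, φ ((u : ℂ) + (v : ℂ) * Complex.I) = g u := fun u => by
    rw [hφ, ← charFun_expTilt_neg]
  simp only [hφg] at hint ⊢
  have hg_meas : AEStronglyMeasurable g :=
    (measurable_charFun.comp measurable_neg).aestronglyMeasurable
  have hint_le : ∀ k ≤ n,
      Integrable (fun u : ℝ => ‖(u : ℂ) + (v : ℂ) * Complex.I‖ ^ k * ‖g u‖) :=
    fun k hk => integrable_norm_pow_mul_of_le hv hg_meas hk hint
  have hchar : Integrable (charFun ν) := by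
    have hg_int : Integrable g :=
      (integrable_norm_iff hg_meas).1 (by simpa using hint_le 0 n.zero_le)
    simpa [hg] using hg_int.comp_neg
  let F : ℕ → ℝ → ℂ := fun k x =>
    (1 / (2 * (Real.pi : ℂ))) * ∫ u, lewisIntegrand v g k x u
  have hF_real : ∀ k x, (((F k x).re : ℝ) : ℂ) = F k x := fun k x => by
    have him : (F k x).im = 0 := by
      have hc : (1 / (2 * (Real.pi : ℂ))) = ((1 / (2 * Real.pi) : ℝ) : ℂ) := by push_cast; rfl
      simp only [F]
      rw [hc, Complex.im_ofReal_mul, im_integral_lewisIntegrand (fun u => ?_), mul_zero]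
      simp only [hg, charFun_neg]
    exact Complex.ext rfl (by simp [him])
  obtain ⟨hsmooth, hiter⟩ := contDiff_and_iteratedDeriv_of_hasDerivAt (n := n)
    (F := fun k x => (F k x).re)
    (fun k hk x => Complex.reCLM.hasFDerivAt.comp_hasDerivAt x
      ((hasDerivAt_integral_lewisIntegrand hg_meas (hint_le k hk.le) (hint_le (k + 1) hk)
        x).const_mul _))
    (Complex.continuous_re.comp
      ((continuous_integral_lewisIntegrand hg_meas hint).const_mul _))
  refine ⟨fun x => (F 0 x).re, hsmooth, ?_, fun x => ?_⟩
  · have hdens := Real.eq_withDensity_re_fourier_charFun ν hchar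
    have hcont : Continuous (fun x => (𝓕 (fun ξ : ℝ => charFun ν (2 * Real.pi * ξ)) x).re) :=
    Complex.continuous_re.comp (Real.continuous_fourier_charFun ν hchar)
    conv_lhs => rw [← expTilt_neg_expTilt v μ, ← hν, hdens, expTilt]
    rw [← withDensity_mul _ hcont.measurable.ennreal_ofReal (by fun_prop)]
    congr with x
    simp only [F, hg, integral_lewisIntegrand_zero_charFun, Complex.re_ofReal_mul, Pi.mul_apply,
      ENNReal.ofReal_mul (Real.exp_nonneg _), neg_mul]
    exact mul_comm _ _
  · rw [hiter, hF_real]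
    rfl
end

section
/- For every x ∈ ℝ, the Lewis representation of the call price holds: ∫_ℝ (e^{s} − e^{x})⁺ μ(ds) = (e^{x}/2π) ∫_ℝ e^{i(u+iv)x} · φ(u+iv) / ( i(u+iv)·(1+i(u+iv)) ) du. -/
open MeasureTheory

namespace Lewis

open Complex Set FourierTransform

/-- The exponentially damped call payoff `e^{-vy} (e^y - 1)⁺`. -/
noncomputable def dampedCall (v y : ℝ) : ℂ :=
  ((Real.exp (-v * y) * max (Real.exp y - 1) 0 : ℝ) : ℂ)

/-- The multiplier `1 / (iz (1 + iz))` on the line `z = u + iv`. -/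
noncomputable def kernel (v u : ℝ) : ℂ :=
  (I * ((u : ℂ) + (v : ℂ) * I) * (1 + I * ((u : ℂ) + (v : ℂ) * I)))⁻¹

theorem continuous_dampedCall (v : ℝ) : Continuous (dampedCall v) := by
  unfold dampedCall
  fun_prop

theorem dampedCall_eq_indicator (v : ℝ) :
    dampedCall v =
      (Ioi 0).indicator fun y : ℝ => cexp ((1 - v : ℂ) * y) - cexp ((-v : ℂ) * y) := by
  ext y
  unfold dampedCall
  by_cases hy : 0 < y
  · have h : 0 ≤ Real.exp y - 1 := by linarith [Real.one_lt_exp_iff.mpr hy]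
    rw [indicator_of_mem (mem_Ioi.mpr hy), max_eq_left h]
    push_cast
    rw [mul_sub, ← Complex.exp_add]
    ring_nf
  · have h : Real.exp y - 1 ≤ 0 := by linarith [Real.exp_le_one_iff.mpr (not_lt.mp hy)]
    rw [indicator_of_notMem (by simpa using hy), max_eq_right h]
    simp

theorem integrable_dampedCall {v : ℝ} (hv : 1 < v) : Integrable (dampedCall v) := by
  rw [dampedCall_eq_indicator, integrable_indicator_iff measurableSet_Ioi]
  exact (integrableOn_exp_mul_complex_Ioi (by simpa using hv) 0).sub
    (integrableOn_exp_mul_complex_Ioi (by simp; linarith) 0)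

theorem fourierInv_dampedCall {v : ℝ} (hv : 1 < v) (w : ℝ) :
    𝓕⁻ (dampedCall v) w = kernel v (2 * Real.pi * w) := by
  have ha : (1 - v + 2 * Real.pi * w * I : ℂ).re < 0 := by simpa using hv
  have hb : (-v + 2 * Real.pi * w * I : ℂ).re < 0 := by simp; linarith
  have ha0 : (1 - v + 2 * Real.pi * w * I : ℂ) ≠ 0 := fun h => by simp [h] at ha
  have hb0 : (-v + 2 * Real.pi * w * I : ℂ) ≠ 0 := fun h => by simp [h] at hb
  rw [Real.fourierInv_eq', dampedCall_eq_indicator]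
  have key : ∀ y : ℝ, cexp (↑(2 * Real.pi * inner ℝ y w) * I) •
      (Ioi 0).indicator (fun y : ℝ => cexp ((1 - v : ℂ) * y) - cexp ((-v : ℂ) * y)) y =
      (Ioi 0).indicator (fun y : ℝ => cexp ((1 - v + 2 * Real.pi * w * I : ℂ) * y) -
        cexp ((-v + 2 * Real.pi * w * I : ℂ) * y)) y := by
    intro y
    by_cases hy : y ∈ Ioi (0 : ℝ)
    · simp only [indicator_of_mem hy, smul_eq_mul, mul_sub, ← Complex.exp_add]
      simp only [RCLike.inner_apply, conj_trivial]
      push_cast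
      ring_nf
    · simp [indicator_of_notMem hy]
  simp_rw [key]
  rw [integral_indicator measurableSet_Ioi,
    integral_sub (integrableOn_exp_mul_complex_Ioi ha 0) (integrableOn_exp_mul_complex_Ioi hb 0),
    integral_exp_mul_complex_Ioi ha, integral_exp_mul_complex_Ioi hb]
  have e : I * (((2 * Real.pi * w : ℝ) : ℂ) + (v : ℂ) * I) = -v + 2 * Real.pi * w * I := by
    push_cast
    linear_combination (v : ℂ) * I_sq
  have e' : (1 + (-v + 2 * Real.pi * w * I) : ℂ) = 1 - v + 2 * Real.pi * w * I := by ring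
  rw [kernel, e, e']
  simp only [ofReal_zero, mul_zero, Complex.exp_zero]
  field_simp
  ring

theorem measurable_kernel (v : ℝ) : Measurable (kernel v) := by
  unfold kernel
  fun_prop

theorem norm_kernel_le {v : ℝ} (hv : 1 < v) (u : ℝ) :
    ‖kernel v u‖ ≤ (min 1 ((v - 1) ^ 2))⁻¹ * (1 + u ^ 2)⁻¹ := by
  have h1 : ‖I * ((u : ℂ) + (v : ℂ) * I)‖ = √(v ^ 2 + u ^ 2) := by
    rw [Complex.norm_eq_sqrt_sq_add_sq]
    simp
  have h2 : ‖1 + I * ((u : ℂ) + (v : ℂ) * I)‖ = √((v - 1) ^ 2 + u ^ 2) := by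
    rw [Complex.norm_eq_sqrt_sq_add_sq]
    simp
    ring_nf
  have hc : 0 < min 1 ((v - 1) ^ 2) := lt_min one_pos (by nlinarith)
  rw [kernel, norm_inv, norm_mul, h1, h2, ← mul_inv]
  apply inv_anti₀ (by positivity)
  calc min 1 ((v - 1) ^ 2) * (1 + u ^ 2)
      ≤ (v - 1) ^ 2 + u ^ 2 := by
        nlinarith [min_le_left 1 ((v - 1) ^ 2), min_le_right 1 ((v - 1) ^ 2), sq_nonneg u]
    _ = √((v - 1) ^ 2 + u ^ 2) * √((v - 1) ^ 2 + u ^ 2) :=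
        (Real.mul_self_sqrt (by positivity)).symm
    _ ≤ √(v ^ 2 + u ^ 2) * √((v - 1) ^ 2 + u ^ 2) := by
        gcongr
        linarith

theorem integrable_kernel {v : ℝ} (hv : 1 < v) : Integrable (kernel v) :=
  (integrable_inv_one_add_sq.const_mul _).mono' (measurable_kernel v).aestronglyMeasurable
    (.of_forall (norm_kernel_le hv))

theorem integral_exp_mul_kernel {v : ℝ} (hv : 1 < v) (y : ℝ) :
    ∫ u : ℝ, cexp (-(u * y * I)) * kernel v u = 2 * Real.pi * dampedCall v y := by
  have hF : 𝓕⁻ (dampedCall v) = fun w => kernel v (2 * Real.pi * w) :=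
    funext (fourierInv_dampedCall hv)
  have hFint : Integrable (𝓕 (dampedCall v)) := by
    have h := ((integrable_kernel hv).comp_mul_left' (R := 2 * Real.pi) (by positivity)).comp_neg
    simpa only [← fourierInv_dampedCall hv, Real.fourierInv_eq_fourier_neg, neg_neg] using h
  have hinv := congrFun ((continuous_dampedCall v).fourier_fourierInv_eq
    (integrable_dampedCall hv) hFint) y
  rw [hF, Real.fourier_eq'] at hinv
  have hcov := Measure.integral_comp_mul_left
    (fun u : ℝ => cexp (-(u * y * I)) * kernel v u) (2 * Real.pi)
  rw [abs_of_pos (by positivity)] at hcov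
  have heq : ∀ w : ℝ, cexp (↑(-2 * Real.pi * inner ℝ w y) * I) • kernel v (2 * Real.pi * w) =
      cexp (-(((2 * Real.pi * w : ℝ) : ℂ) * y * I)) * kernel v (2 * Real.pi * w) := by
    intro w
    simp only [RCLike.inner_apply, conj_trivial, smul_eq_mul]
    push_cast
    ring_nf
  simp_rw [heq] at hinv
  rw [hinv] at hcov
  rw [hcov, Complex.real_smul]
  have hpi : (2 * Real.pi : ℂ) ≠ 0 := by exact_mod_cast Real.two_pi_pos.ne'
  push_cast
  rw [mul_inv_cancel_left₀ hpi]

theorem integrable_prod_exp_mul_kernel {v : ℝ} (hv : 1 < v) {μ : Measure ℝ} [SFinite μ]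
    (hμ : Integrable (fun s : ℝ => Real.exp (v * s)) μ) (x : ℝ) :
    Integrable (fun p : ℝ × ℝ => cexp (I * ((p.1 : ℂ) + (v : ℂ) * I) * ((x : ℂ) - p.2)) *
      kernel v p.1) (volume.prod μ) := by
  refine (((integrable_kernel hv).norm.mul_prod hμ).const_mul (Real.exp (-v * x))).mono' ?_
    (.of_forall fun p => le_of_eq ?_)
  · have := measurable_kernel v
    exact Measurable.aestronglyMeasurable (by fun_prop)
  · rw [norm_mul, Complex.norm_exp, mul_left_comm, ← Real.exp_add, mul_comm]
    congr 2
    simp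
    ring

theorem max_exp_sub_exp_eq_dampedCall (v x s : ℝ) :
    ((max (Real.exp s - Real.exp x) 0 : ℝ) : ℂ) =
      Real.exp x * (cexp (v * (s - x)) * dampedCall v (s - x)) := by
  have h : max (Real.exp s - Real.exp x) 0 =
      Real.exp x * (Real.exp (v * (s - x)) *
        (Real.exp (-v * (s - x)) * max (Real.exp (s - x) - 1) 0)) := by
    rw [← mul_assoc (Real.exp (v * (s - x))), ← Real.exp_add, neg_mul, add_neg_cancel,
      Real.exp_zero, one_mul, mul_max_of_nonneg _ _ (Real.exp_pos x).le, mul_sub,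
      ← Real.exp_add]
    simp
  rw [h, dampedCall]
  push_cast
  rfl

end Lewis

/-- Lewis formula for the (normalized) call price, equation (10) of the paper:
`∫ (e^s - e^x)⁺ μ(ds) = (e^x/2π) ∫ e^{i(u+iv)x} φ(u+iv) / (i(u+iv)(1+i(u+iv))) du`
for `v > 1`. -/
theorem call_Lewis
    (v τ : ℝ) (hv : 1 < v) (hτ : 0 < τ)
    (μ : Measure ℝ) [IsProbabilityMeasure μ]
    (hμv : Integrable (fun s : ℝ => Real.exp (v * s)) μ)
    (hmart1 : Integrable (fun s : ℝ => Real.exp s) μ)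
    (hmart2 : ∫ s : ℝ, Real.exp s ∂μ = 1)
    (φ : ℂ → ℂ)
    (hφ : ∀ z : ℂ, φ z = ∫ s : ℝ, Complex.exp (-(Complex.I * z * (s : ℂ))) ∂μ) :
    ∀ x : ℝ,
      ((∫ s : ℝ, max (Real.exp s - Real.exp x) 0 ∂μ : ℝ) : ℂ) =
        ((Real.exp x : ℂ) / (2 * (Real.pi : ℂ))) *
          ∫ u : ℝ,
            Complex.exp (Complex.I * ((u : ℂ) + (v : ℂ) * Complex.I) * (x : ℂ)) *
              φ ((u : ℂ) + (v : ℂ) * Complex.I) /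
                (Complex.I * ((u : ℂ) + (v : ℂ) * Complex.I) *
                  (1 + Complex.I * ((u : ℂ) + (v : ℂ) * Complex.I))) := by
  intro x
  have hu : ∀ u : ℝ,
      Complex.exp (Complex.I * ((u : ℂ) + (v : ℂ) * Complex.I) * (x : ℂ)) *
        φ ((u : ℂ) + (v : ℂ) * Complex.I) /
          (Complex.I * ((u : ℂ) + (v : ℂ) * Complex.I) *
            (1 + Complex.I * ((u : ℂ) + (v : ℂ) * Complex.I))) =
      ∫ s : ℝ, Complex.exp (Complex.I * ((u : ℂ) + (v : ℂ) * Complex.I) * ((x : ℂ) - s)) *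
        Lewis.kernel v u ∂μ := by
    intro u
    rw [hφ, div_eq_mul_inv, ← Lewis.kernel, ← integral_const_mul, ← integral_mul_const]
    refine integral_congr_ae (.of_forall fun s => ?_)
    simp only [← Complex.exp_add]
    ring_nf
  have hs : ∀ s : ℝ,
      ∫ u : ℝ, Complex.exp (Complex.I * ((u : ℂ) + (v : ℂ) * Complex.I) * ((x : ℂ) - s)) *
        Lewis.kernel v u =
      Complex.exp (v * (s - x)) * (2 * Real.pi * Lewis.dampedCall v (s - x)) := by
    intro s
    rw [← Lewis.integral_exp_mul_kernel hv, ← integral_const_mul]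
    refine integral_congr_ae (.of_forall fun u => ?_)
    simp only [← mul_assoc, ← Complex.exp_add]
    congr 2
    push_cast
    linear_combination (v : ℂ) * (x - s) * Complex.I_sq
  simp_rw [hu]
  rw [integral_integral_swap (Lewis.integrable_prod_exp_mul_kernel hv hμv x)]
  simp_rw [hs]
  rw [← integral_complex_ofReal, ← integral_const_mul]
  refine integral_congr_ae (.of_forall fun s => ?_)
  have hpi : (Real.pi : ℂ) ≠ 0 := by exact_mod_cast Real.pi_ne_zero
  simp only [Lewis.max_exp_sub_exp_eq_dampedCall v]
  field_simp
end

section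
/- Assume ∫_ℝ |φ(u+iv)| / |u+iv| du < ∞. Fix K > 0, r ≥ 0, and for S > 0 set x(S) := ln(K/S) − rτ and C(S) := S·∫_ℝ (e^{s} − e^{x(S)})⁺ μ(ds) (the call price as a function of the spot S). Then C is differentiable on (0,∞) and the Delta satisfies C'(S) = ∫_{(x(S),∞)} e^{s} μ(ds) = μ̃((x(S),∞)), where μ̃(A) = ∫_A e^{s} μ(ds) is the dual (Esscher) measure. -/
open MeasureTheory

open Filter Topology

/-- Averages of the form `∫ sinc (n x) dν` recover the mass of the atom at `0`. -/
theorem tendsto_integral_sinc_atTop (ν : Measure ℝ) [IsFiniteMeasure ν] :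
    Tendsto (fun n : ℕ => ∫ x, Real.sinc (n * x) ∂ν) atTop (𝓝 (ν.real {0})) := by
  have h0 : ∫ x, Set.indicator {(0 : ℝ)} (fun _ => (1 : ℝ)) x ∂ν = ν.real {0} := by
    rw [integral_indicator_const _ (measurableSet_singleton 0), smul_eq_mul, mul_one]
  rw [← h0]
  refine tendsto_integral_of_dominated_convergence (fun _ => 1) (fun n => ?_)
    (integrable_const _) (fun n => .of_forall fun x => Real.abs_sinc_le_one _)
    (.of_forall fun x => ?_)
  · exact (Real.continuous_sinc.comp (continuous_const.mul continuous_id)).aestronglyMeasurable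
  · by_cases hx : x = 0
    · simp [hx]
    have hxs : x ∉ ({0} : Set ℝ) := hx
    rw [Set.indicator_of_notMem hxs]
    have hlim : Tendsto (fun n : ℕ => |x|⁻¹ * (n : ℝ)⁻¹) atTop (𝓝 0) := by
      simpa using (tendsto_inv_atTop_nhds_zero_nat (𝕜 := ℝ)).const_mul |x|⁻¹
    refine squeeze_zero_norm' ?_ hlim
    filter_upwards [eventually_gt_atTop 0] with n hn
    have hn' : (0 : ℝ) < n := by exact_mod_cast hn
    rw [Real.sinc_of_ne_zero (mul_ne_zero hn'.ne' hx), norm_div, Real.norm_eq_abs,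
      Real.norm_eq_abs, abs_mul, abs_of_pos hn', div_eq_mul_inv, mul_inv, mul_comm (n : ℝ)⁻¹]
    exact mul_le_of_le_one_left (by positivity) (Real.abs_sin_le_one _)

/-- If `‖charFun ν u‖ / (1 + |u|)` is integrable, then `ν` has no atom at the origin. -/
theorem measure_singleton_zero_of_integrable_charFun (ν : Measure ℝ) [IsFiniteMeasure ν]
    (h : Integrable fun u : ℝ => ‖charFun ν u‖ / (1 + |u|)) : ν {0} = 0 := by
  have hbound : Tendsto (fun n : ℕ => ∫ u : ℝ, Set.indicator (Set.Ioc (-(n : ℝ)) n)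
      (fun u => (2 * (n : ℝ))⁻¹ * ‖charFun ν u‖) u) atTop (𝓝 0) := by
    rw [← integral_zero ℝ ℝ (μ := volume)]
    refine tendsto_integral_filter_of_dominated_convergence
      (fun u : ℝ => ‖charFun ν u‖ / (1 + |u|)) (.of_forall fun n => ?_) ?_ h
      (.of_forall fun u => ?_)
    · exact ((measurable_charFun.norm.const_mul _).indicator
        measurableSet_Ioc).aestronglyMeasurable
    · filter_upwards [eventually_ge_atTop 1] with n hn
      refine .of_forall fun u => ?_
      have hn' : (1 : ℝ) ≤ n := by exact_mod_cast hn
      by_cases hu : u ∈ Set.Ioc (-(n : ℝ)) n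
      · have hun : |u| ≤ n := abs_le.2 ⟨hu.1.le, hu.2⟩
        rw [Set.indicator_of_mem hu, Real.norm_of_nonneg (by positivity), mul_comm,
          ← div_eq_mul_inv]
        gcongr
        linarith
      · rw [Set.indicator_of_notMem hu, norm_zero]
        positivity
    · have hlim : Tendsto (fun n : ℕ => (2⁻¹ * ‖charFun ν u‖) * (n : ℝ)⁻¹) atTop (𝓝 0) := by
        simpa using (tendsto_inv_atTop_nhds_zero_nat (𝕜 := ℝ)).const_mul (2⁻¹ * ‖charFun ν u‖)
      refine squeeze_zero_norm (fun n => ?_) hlim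
      refine (norm_indicator_le_norm_self _ _).trans (le_of_eq ?_)
      rw [Real.norm_of_nonneg (by positivity), mul_inv]
      ring
  have hzero : Tendsto (fun n : ℕ => ∫ x, Real.sinc (n * x) ∂ν) atTop (𝓝 0) := by
    refine squeeze_zero_norm' ?_ hbound
    filter_upwards [eventually_gt_atTop 0] with n hn
    have hn' : (0 : ℝ) < n := by exact_mod_cast hn
    have hle : -(n : ℝ) ≤ n := by linarith
    have hnorm : ‖∫ t in -(n : ℝ)..n, charFun ν t‖ = 2 * n * ‖∫ x, Real.sinc (n * x) ∂ν‖ := by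
      rw [integral_charFun_Icc hn', ← Complex.norm_real]
      simp
    have hint := intervalIntegral.norm_integral_le_integral_norm (f := charFun ν)
      (μ := volume) hle
    rw [hnorm, intervalIntegral.integral_of_le hle] at hint
    rw [integral_indicator measurableSet_Ioc, integral_const_mul]
    rwa [le_inv_mul_iff₀ (by positivity)]
  have hreal := tendsto_nhds_unique (tendsto_integral_sinc_atTop ν) hzero
  exact (measureReal_eq_zero_iff).1 hreal

/-- If `‖charFun ν u‖ / (1 + |u|)` is integrable, then `ν` has no atoms. -/
theorem measure_singleton_of_integrable_charFun (ν : Measure ℝ) [IsFiniteMeasure ν]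
    (h : Integrable fun u : ℝ => ‖charFun ν u‖ / (1 + |u|)) (a : ℝ) : ν {a} = 0 := by
  have hshift : (ν.map (· + -a)) {0} = 0 := by
    refine measure_singleton_zero_of_integrable_charFun _ ?_
    simpa only [charFun_map_add_const, norm_mul, Complex.norm_exp_ofReal_mul_I, mul_one] using h
  rw [Measure.map_apply (measurable_add_const _) (measurableSet_singleton 0)] at hshift
  convert hshift using 2
  ext x
  simp [← sub_eq_add_neg, sub_eq_zero]

/-- Integrability of the generalized characteristic function against `1 / ‖z‖` on a horizontal
line excludes atoms. -/
theorem measure_singleton_of_integrable_generalized_charFun {v : ℝ} (hv : 1 < v) (μ : Measure ℝ)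
    (hμv : Integrable (fun s : ℝ => Real.exp (v * s)) μ) (φ : ℂ → ℂ)
    (hφ : ∀ z : ℂ, φ z = ∫ s : ℝ, Complex.exp (-(Complex.I * z * (s : ℂ))) ∂μ)
    (hint : Integrable (fun u : ℝ =>
      ‖φ ((u : ℂ) + (v : ℂ) * Complex.I)‖ / ‖(u : ℂ) + (v : ℂ) * Complex.I‖)) (a : ℝ) :
    μ {a} = 0 := by
  set ν := μ.withDensity fun s => ENNReal.ofReal (Real.exp (v * s)) with hν
  have : IsFiniteMeasure ν := isFiniteMeasure_withDensity_ofReal hμv.2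
  have hmeas : Measurable fun s : ℝ => ENNReal.ofReal (Real.exp (v * s)) := by fun_prop
  have hchar (u : ℝ) : charFun ν u = φ (((-u : ℝ) : ℂ) + (v : ℂ) * Complex.I) := by
    rw [charFun_apply_real, hφ, hν, integral_withDensity_eq_integral_toReal_smul hmeas
      (.of_forall fun _ => ENNReal.ofReal_lt_top)]
    refine integral_congr_ae (.of_forall fun s => ?_)
    simp only
    rw [ENNReal.toReal_ofReal (Real.exp_pos _).le, Complex.real_smul, Complex.ofReal_exp,
      ← Complex.exp_add]
    congr 1
    push_cast
    linear_combination ((v : ℂ) * s) * Complex.I_mul_I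
  have hcharint : Integrable fun u : ℝ => ‖charFun ν u‖ / (1 + |u|) := by
    refine (hint.comp_neg.const_mul v).mono'
      ((measurable_charFun.norm.div (by fun_prop)).aestronglyMeasurable) (.of_forall fun u => ?_)
    have hz : ‖((-u : ℝ) : ℂ) + (v : ℂ) * Complex.I‖ ≤ v * (1 + |u|) := by
      refine (norm_add_le _ _).trans ?_
      rw [norm_mul, Complex.norm_I, Complex.norm_real, Complex.norm_real, Real.norm_eq_abs,
        Real.norm_eq_abs, abs_neg, abs_of_pos (by linarith : 0 < v)]
      nlinarith [abs_nonneg u]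
    have hz0 : 0 < ‖((-u : ℝ) : ℂ) + (v : ℂ) * Complex.I‖ := by
      refine norm_pos_iff.2 fun hzero => ?_
      have him := congrArg Complex.im hzero
      simp at him
      linarith
    rw [Real.norm_of_nonneg (by positivity), ← hchar, mul_div_assoc', div_le_div_iff₀
      (by positivity) hz0]
    calc ‖charFun ν u‖ * ‖((-u : ℝ) : ℂ) + (v : ℂ) * Complex.I‖
        ≤ ‖charFun ν u‖ * (v * (1 + |u|)) := by gcongr
      _ = v * ‖charFun ν u‖ * (1 + |u|) := by ring
  have hac : μ ≪ ν := withDensity_absolutelyContinuous' hmeas.aemeasurable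
    (.of_forall fun s => (ENNReal.ofReal_pos.2 (Real.exp_pos _)).ne')
  exact hac (measure_singleton_of_integrable_charFun ν hcharint a)

/-- Derivative in the spot `S` of the forward call value `∫ (S e^s - k)⁺ μ(ds)`, when the
exercise boundary carries no mass. -/
theorem hasDerivAt_integral_max_mul_exp_sub (μ : Measure ℝ) [IsFiniteMeasure μ]
    (hexp : Integrable (fun s : ℝ => Real.exp s) μ) {k S x : ℝ} (hS : 0 < S)
    (hx : S * Real.exp x = k) (hatom : μ {x} = 0) :
    HasDerivAt (fun S : ℝ => ∫ s : ℝ, max (S * Real.exp s - k) 0 ∂μ)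
      (∫ s in Set.Ioi x, Real.exp s ∂μ) S := by
  rw [← integral_indicator measurableSet_Ioi]
  refine (hasDerivAt_integral_of_dominated_loc_of_lip (bound := fun s => Real.exp s)
    (F := fun S s => max (S * Real.exp s - k) 0) (s := Set.univ) univ_mem
    (.of_forall fun S => ?_) ?_ ?_ (.of_forall fun s => ?_) hexp ?_).2
  · exact Continuous.aestronglyMeasurable (by fun_prop)
  · exact ((hexp.const_mul S).sub (integrable_const k)).sup (integrable_zero _ _ _)
  · exact (Real.measurable_exp.indicator measurableSet_Ioi).aestronglyMeasurable
  · refine (LipschitzWith.of_dist_le_mul fun p q => ?_).lipschitzOnWith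
    rw [Real.dist_eq, Real.dist_eq, Real.coe_nnabs, abs_of_pos (Real.exp_pos s)]
    refine (abs_max_sub_max_le_abs _ _ _).trans (le_of_eq ?_)
    rw [show p * Real.exp s - k - (q * Real.exp s - k) = Real.exp s * (p - q) by ring, abs_mul,
      abs_of_pos (Real.exp_pos s)]
  · have hne : ∀ᵐ s ∂μ, s ≠ x := by
      rw [ae_iff]
      simpa using hatom
    filter_upwards [hne] with s hs
    have hcont : ContinuousAt (fun p : ℝ => p * Real.exp s - k) S := by fun_prop
    rcases lt_or_gt_of_ne hs with hlt | hgt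
    · have hneg : S * Real.exp s - k < 0 := by
        rw [← hx, sub_neg]
        gcongr
      rw [Set.indicator_of_notMem (by simpa using hlt.le)]
      refine (hasDerivAt_const S (0 : ℝ)).congr_of_eventuallyEq ?_
      filter_upwards [hcont.eventually_lt_const hneg] with p hp
      exact max_eq_right hp.le
    · have hpos : 0 < S * Real.exp s - k := by
        rw [← hx, sub_pos]
        gcongr
      rw [Set.indicator_of_mem (Set.mem_Ioi.2 hgt)]
      refine ((hasDerivAt_mul_const (Real.exp s)).sub_const k).congr_of_eventuallyEq ?_
      filter_upwards [hcont.eventually_const_lt hpos] with p hp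
      exact max_eq_left hp.le

/-- Delta of a call option: with `x(S) = ln(K/S) - rτ` and
`C(S) = S·∫(e^s - e^{x(S)})⁺ μ(ds)`, the function `C` is differentiable on `(0,∞)` with
`C'(S) = ∫_{(x(S),∞)} e^s μ(ds) = μ̃((x(S),∞))`. -/
theorem call_Delta
    (v τ : ℝ) (hv : 1 < v) (hτ : 0 < τ)
    (μ : Measure ℝ) [IsProbabilityMeasure μ]
    (hμv : Integrable (fun s : ℝ => Real.exp (v * s)) μ)
    (hmart1 : Integrable (fun s : ℝ => Real.exp s) μ)
    (hmart2 : ∫ s : ℝ, Real.exp s ∂μ = 1)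
    (φ : ℂ → ℂ)
    (hφ : ∀ z : ℂ, φ z = ∫ s : ℝ, Complex.exp (-(Complex.I * z * (s : ℂ))) ∂μ)
    (hint : Integrable (fun u : ℝ =>
      ‖φ ((u : ℂ) + (v : ℂ) * Complex.I)‖ / ‖(u : ℂ) + (v : ℂ) * Complex.I‖))
    (K r : ℝ) (hK : 0 < K) (hr : 0 ≤ r) :
    ∀ S ∈ Set.Ioi (0 : ℝ),
      HasDerivAt
        (fun S : ℝ => S * ∫ s : ℝ, max (Real.exp s - Real.exp (Real.log (K / S) - r * τ)) 0 ∂μ)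
        (∫ s in Set.Ioi (Real.log (K / S) - r * τ), Real.exp s ∂μ) S ∧
      (∫ s in Set.Ioi (Real.log (K / S) - r * τ), Real.exp s ∂μ) =
        ((μ.withDensity fun s => ENNReal.ofReal (Real.exp s))
          (Set.Ioi (Real.log (K / S) - r * τ))).toReal := by
  intro S hS
  have hS : 0 < S := hS
  have hdisc {p : ℝ} (hp : 0 < p) :
      p * Real.exp (Real.log (K / p) - r * τ) = K * Real.exp (-(r * τ)) := by
    rw [sub_eq_add_neg, Real.exp_add, Real.exp_log (by positivity), ← mul_assoc,
      mul_div_cancel₀ _ hp.ne']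
  refine ⟨?_, ?_⟩
  · refine (hasDerivAt_integral_max_mul_exp_sub μ hmart1 hS (hdisc hS)
      (measure_singleton_of_integrable_generalized_charFun hv μ hμv φ hφ hint
        _)).congr_of_eventuallyEq ?_
    filter_upwards [lt_mem_nhds hS] with p hp
    rw [← integral_const_mul]
    refine integral_congr_ae (.of_forall fun s => ?_)
    simp only
    rw [mul_max_of_nonneg _ _ hp.le, mul_zero, mul_sub, hdisc hp]
  · rw [withDensity_apply _ measurableSet_Ioi]
    exact integral_eq_lintegral_of_nonneg_ae (.of_forall fun s => (Real.exp_pos s).le)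
      Real.measurable_exp.aestronglyMeasurable
end

section
/- Assume ∫_ℝ |φ(u+iv)| / |u+iv| du < ∞. Fix K > 0, S > 0, and for r ∈ ℝ set x(r) := ln(K/S) − rτ and C(r) := S·∫_ℝ (e^{s} − e^{x(r)})⁺ μ(ds) (the call price as a function of the interest rate r). Then C is differentiable in r and the Rho satisfies dC/dr = τ·S·e^{x(r)}·μ((x(r),∞)). -/
open MeasureTheory

open ProbabilityTheory Filter Topology

open scoped NNReal

/-- Gaussian averages of the modulus of the transform of `μ` along the line `Im z = v` bound the
atoms of `μ`. -/
lemma exp_mul_measureReal_singleton_le_integral_gaussianReal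
    {μ : Measure ℝ} [IsProbabilityMeasure μ] {v : ℝ}
    (hμv : Integrable (fun s : ℝ => Real.exp (v * s)) μ) (a : ℝ) (w : ℝ≥0) :
    Real.exp (v * a) * μ.real {a} ≤
      ∫ u : ℝ, ‖∫ s : ℝ, Complex.exp (-(Complex.I * (u + v * Complex.I) * s)) ∂μ‖
        ∂(gaussianReal 0 w) := by
  set G := gaussianReal 0 w
  have hinteg : Integrable (fun p : ℝ × ℝ =>
      Complex.exp (p.2 * (a - p.1) * Complex.I) * Real.exp (v * p.1)) (μ.prod G) := by
    refine (hμv.comp_fst G).mono' (by fun_prop) (ae_of_all _ fun p => ?_)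
    rw [norm_mul, Complex.norm_real, Real.norm_of_nonneg (Real.exp_pos _).le]
    have : ‖Complex.exp (p.2 * (a - p.1) * Complex.I)‖ = 1 := by
      exact_mod_cast Complex.norm_exp_ofReal_mul_I (p.2 * (a - p.1))
    rw [this, one_mul]
  have hchar (s : ℝ) : ∫ u : ℝ, Complex.exp (u * (a - s) * Complex.I) * Real.exp (v * s) ∂G
      = ((Real.exp (v * s) * Real.exp (-(w * (a - s) ^ 2 / 2)) : ℝ) : ℂ) := by
    have h := charFun_gaussianReal (μ := 0) (v := w) (a - s)
    rw [charFun_apply_real] at h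
    rw [integral_mul_const, mul_comm]
    push_cast at h ⊢
    congr 1
    refine (integral_congr_ae (ae_of_all _ fun u => ?_)).trans (h.trans ?_)
    · simp only [mul_comm (u : ℂ)]
    · congr 1
      ring
  have hswap := integral_integral_swap (f := fun s u : ℝ =>
    Complex.exp (u * (a - s) * Complex.I) * Real.exp (v * s)) hinteg
  simp_rw [hchar] at hswap
  rw [integral_complex_ofReal] at hswap
  have hgauss : Integrable
      (fun s : ℝ => Real.exp (v * s) * Real.exp (-(w * (a - s) ^ 2 / 2))) μ := by
    refine hμv.mono' (by fun_prop) (ae_of_all _ fun s => ?_)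
    rw [Real.norm_of_nonneg (by positivity)]
    refine mul_le_of_le_one_right (Real.exp_pos _).le (Real.exp_le_one_iff.2 ?_)
    have : 0 ≤ (w : ℝ) * (a - s) ^ 2 / 2 := by positivity
    linarith
  calc Real.exp (v * a) * μ.real {a}
      = ∫ s in {a}, Real.exp (v * s) * Real.exp (-(w * (a - s) ^ 2 / 2)) ∂μ := by
        simp [Measure.real, mul_comm]
    _ ≤ ∫ s, Real.exp (v * s) * Real.exp (-(w * (a - s) ^ 2 / 2)) ∂μ :=
        setIntegral_le_integral hgauss (ae_of_all _ fun s => by positivity)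
    _ ≤ ‖((∫ s, Real.exp (v * s) * Real.exp (-(w * (a - s) ^ 2 / 2)) ∂μ : ℝ) : ℂ)‖ := by
        rw [Complex.norm_real]; exact le_abs_self _
    _ ≤ _ := by
        rw [hswap]
        refine (norm_integral_le_integral_norm _).trans (le_of_eq ?_)
        congr 1
        ext u
        have : ∀ s : ℝ, Complex.exp (u * (a - s) * Complex.I) * Real.exp (v * s) =
            Complex.exp ((u * a : ℝ) * Complex.I) *
              Complex.exp (-(Complex.I * (u + v * Complex.I) * s)) := by
          intro s
          rw [Complex.ofReal_exp, ← Complex.exp_add, ← Complex.exp_add]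
          congr 1
          push_cast
          linear_combination ((v : ℂ) * s) * Complex.I_sq
        simp_rw [this]
        rw [integral_const_mul, norm_mul, Complex.norm_exp_ofReal_mul_I, one_mul]

lemma gaussianPDFReal_zero_sq_le {T : ℝ≥0} (hT : 0 < T) (u : ℝ) :
    gaussianPDFReal 0 (T ^ 2) u ≤ (T : ℝ)⁻¹ * Real.exp (-((u / T) ^ 2 / 2)) := by
  have hT' : (0 : ℝ) < T := hT
  rw [gaussianPDFReal]
  push_cast
  have h1 : (√(2 * Real.pi * (T : ℝ) ^ 2))⁻¹ ≤ (T : ℝ)⁻¹ := by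
    refine inv_anti₀ hT' (Real.le_sqrt_of_sq_le ?_)
    nlinarith [Real.pi_gt_three, sq_nonneg (T : ℝ)]
  have h2 : -(u - 0) ^ 2 / (2 * (T : ℝ) ^ 2) = -((u / T) ^ 2 / 2) := by
    field_simp
    simp
  rw [h2]
  gcongr

lemma norm_mul_gaussianPDFReal_zero_sq_le {v : ℝ} (hv : 0 ≤ v) {T : ℝ≥0} (hT : 1 ≤ T) (u : ℝ) :
    ‖(u : ℂ) + v * Complex.I‖ * gaussianPDFReal 0 (T ^ 2) u ≤ 1 + v := by
  have hT' : (1 : ℝ) ≤ T := hT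
  have hT0 : (0 : ℝ) < T := by linarith
  have hnorm : ‖(u : ℂ) + v * Complex.I‖ ≤ |u| + v := by
    refine (norm_add_le _ _).trans ?_
    simp [abs_of_nonneg hv]
  have hexp : (|u| / T) * Real.exp (-((u / T) ^ 2 / 2)) ≤ 1 := by
    rw [Real.exp_neg, ← div_eq_mul_inv, div_le_one (Real.exp_pos _)]
    have h := Real.add_one_le_exp ((u / T) ^ 2 / 2)
    have h2 : (u / T) ^ 2 = (|u| / T) ^ 2 := by rw [div_pow, div_pow, sq_abs]
    rw [h2] at h ⊢
    nlinarith [sq_nonneg (|u| / T - 1)]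
  have hle1 : Real.exp (-((u / T) ^ 2 / 2)) ≤ 1 := by
    refine Real.exp_le_one_iff.2 ?_
    have : 0 ≤ (u / T) ^ 2 / 2 := by positivity
    linarith
  have hv1 : v * ((T : ℝ)⁻¹ * Real.exp (-((u / T) ^ 2 / 2))) ≤ v :=
    mul_le_of_le_one_right hv (mul_le_one₀ (inv_le_one_of_one_le₀ hT') (Real.exp_pos _).le hle1)
  calc ‖(u : ℂ) + v * Complex.I‖ * gaussianPDFReal 0 (T ^ 2) u
      ≤ (|u| + v) * ((T : ℝ)⁻¹ * Real.exp (-((u / T) ^ 2 / 2))) :=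
        mul_le_mul hnorm (gaussianPDFReal_zero_sq_le (by positivity) u)
          (gaussianPDFReal_nonneg _ _ _) (by positivity)
    _ = (|u| / T) * Real.exp (-((u / T) ^ 2 / 2))
        + v * ((T : ℝ)⁻¹ * Real.exp (-((u / T) ^ 2 / 2))) := by ring
    _ ≤ 1 + v := add_le_add hexp hv1

/-- If `‖f u‖ / ‖u + iv‖` is integrable, the averages of `‖f‖` over centred Gaussians tend to zero
as the variance tends to infinity. -/
lemma tendsto_integral_norm_gaussianReal_zero {v : ℝ} (hv : 0 < v) {f : ℝ → ℂ}
    (hf : Integrable (fun u : ℝ => ‖f u‖ / ‖(u : ℂ) + v * Complex.I‖)) :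
    Tendsto (fun n : ℕ => ∫ u, ‖f u‖ ∂(gaussianReal 0 (((n : ℝ≥0) + 1) ^ 2))) atTop (𝓝 0) := by
  have hne (u : ℝ) : ‖(u : ℂ) + v * Complex.I‖ ≠ 0 := by
    rw [norm_ne_zero_iff]
    intro h
    have := congrArg Complex.im h
    simp [hv.ne'] at this
  have heq (n : ℕ) : ∫ u, ‖f u‖ ∂(gaussianReal 0 (((n : ℝ≥0) + 1) ^ 2)) =
      ∫ u, (‖f u‖ / ‖(u : ℂ) + v * Complex.I‖) *
        (‖(u : ℂ) + v * Complex.I‖ * gaussianPDFReal 0 (((n : ℝ≥0) + 1) ^ 2) u) := by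
    rw [integral_gaussianReal_eq_integral_smul (by positivity)]
    congr 1
    ext u
    have := hne u
    rw [smul_eq_mul]
    field_simp
  simp_rw [heq]
  suffices h : Tendsto _ atTop (𝓝 (∫ _ : ℝ, (0 : ℝ))) by rwa [integral_zero] at h
  refine tendsto_integral_of_dominated_convergence
    (fun u => (‖f u‖ / ‖(u : ℂ) + v * Complex.I‖) * (1 + v)) (fun n => ?_)
    (hf.mul_const _) (fun n => ae_of_all _ fun u => ?_) (ae_of_all _ fun u => ?_)
  · refine hf.aestronglyMeasurable.mul (Measurable.aestronglyMeasurable ?_)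
    exact (by fun_prop : Measurable fun u : ℝ => ‖(u : ℂ) + v * Complex.I‖).mul
      (measurable_gaussianPDFReal _ _)
  · rw [Real.norm_of_nonneg (mul_nonneg (by positivity)
      (mul_nonneg (norm_nonneg _) (gaussianPDFReal_nonneg _ _ _)))]
    gcongr
    exact norm_mul_gaussianPDFReal_zero_sq_le hv.le le_add_self u
  · have hpdf : Tendsto (fun n : ℕ => gaussianPDFReal 0 (((n : ℝ≥0) + 1) ^ 2) u) atTop (𝓝 0) := by
      refine squeeze_zero (fun n => gaussianPDFReal_nonneg _ _ _) (fun n => ?_)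
        tendsto_one_div_add_atTop_nhds_zero_nat
      refine (gaussianPDFReal_zero_sq_le (by positivity) u).trans ?_
      push_cast
      rw [one_div]
      refine mul_le_of_le_one_right (by positivity) (Real.exp_le_one_iff.2 ?_)
      have : 0 ≤ (u / ((n : ℝ) + 1)) ^ 2 / 2 := by positivity
      linarith
    simpa using (hpdf.const_mul ‖(u : ℂ) + v * Complex.I‖).const_mul
      (‖f u‖ / ‖(u : ℂ) + v * Complex.I‖)

/-- The expected call payoff is differentiable in the strike, off the atoms of the underlying. -/
lemma hasDerivAt_integral_max_sub_zero {Ω : Type*} [MeasurableSpace Ω] {μ : Measure Ω}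
    [IsFiniteMeasure μ] {X : Ω → ℝ} (hX : Integrable X μ) (hXm : Measurable X) {k : ℝ}
    (hk : ∀ᵐ ω ∂μ, X ω ≠ k) :
    HasDerivAt (fun k : ℝ => ∫ ω, max (X ω - k) 0 ∂μ) (-μ.real {ω | k < X ω}) k := by
  have hmeas : MeasurableSet {ω | k < X ω} := measurableSet_lt measurable_const hXm
  have h := (hasDerivAt_integral_of_dominated_loc_of_lip (μ := μ) (𝕜 := ℝ) (x₀ := k)
    (F := fun k ω => max (X ω - k) 0) (F' := {ω | k < X ω}.indicator fun _ => (-1 : ℝ))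
    (bound := fun _ => 1) (s := Set.univ) univ_mem
    (Eventually.of_forall fun x => by fun_prop)
    ((hX.sub (integrable_const k)).pos_part)
    ((measurable_const.indicator hmeas).aestronglyMeasurable)
    (ae_of_all _ fun ω => ?_) (integrable_const 1) ?_).2
  · rwa [integral_indicator_const _ hmeas, smul_eq_mul, mul_neg_one] at h
  · refine LipschitzOnWith.of_dist_le_mul fun x _ y _ => ?_
    simp only [Real.dist_eq]
    refine (abs_max_sub_max_le_abs _ _ _).trans ?_
    rw [sub_sub_sub_cancel_left, abs_sub_comm]
    simp
  · filter_upwards [hk] with ω hω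
    rcases lt_or_gt_of_ne hω with h | h
    · rw [Set.indicator_of_notMem (by simpa using h.le)]
      refine (hasDerivAt_const k (0 : ℝ)).congr_of_eventuallyEq ?_
      filter_upwards [lt_mem_nhds h] with x hx
      exact max_eq_right (by linarith)
    · rw [Set.indicator_of_mem (by simpa using h)]
      refine ((hasDerivAt_id k).const_sub (X ω)).congr_of_eventuallyEq ?_
      filter_upwards [gt_mem_nhds h] with x hx
      exact max_eq_left (by simpa using hx.le)

/-- Rho of a call option: with `x(r) = ln(K/S) - rτ` and
`C(r) = S·∫(e^s - e^{x(r)})⁺ μ(ds)` viewed as a function of the interest rate `r`,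
`C` is differentiable and `dC/dr = τ·S·e^{x(r)}·μ((x(r),∞))`. -/
theorem call_Rho
    (v τ : ℝ) (hv : 1 < v) (hτ : 0 < τ)
    (μ : Measure ℝ) [IsProbabilityMeasure μ]
    (hμv : Integrable (fun s : ℝ => Real.exp (v * s)) μ)
    (hmart1 : Integrable (fun s : ℝ => Real.exp s) μ)
    (hmart2 : ∫ s : ℝ, Real.exp s ∂μ = 1)
    (φ : ℂ → ℂ)
    (hφ : ∀ z : ℂ, φ z = ∫ s : ℝ, Complex.exp (-(Complex.I * z * (s : ℂ))) ∂μ)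
    (hint : Integrable (fun u : ℝ =>
      ‖φ ((u : ℂ) + (v : ℂ) * Complex.I)‖ / ‖(u : ℂ) + (v : ℂ) * Complex.I‖))
    (K S : ℝ) (hK : 0 < K) (hS : 0 < S) :
    ∀ r : ℝ,
      HasDerivAt
        (fun r : ℝ => S * ∫ s : ℝ, max (Real.exp s - Real.exp (Real.log (K / S) - r * τ)) 0 ∂μ)
        (τ * S * Real.exp (Real.log (K / S) - r * τ) *
          (μ (Set.Ioi (Real.log (K / S) - r * τ))).toReal) r := by
  intro r
  have hatom (a : ℝ) : μ {a} = 0 := by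
    have hlim := tendsto_integral_norm_gaussianReal_zero (by linarith : 0 < v) hint
    have hle : Real.exp (v * a) * μ.real {a} ≤ 0 := ge_of_tendsto' hlim fun n => by
      simpa only [hφ] using exp_mul_measureReal_singleton_le_integral_gaussianReal hμv a _
    have hle' : μ.real {a} ≤ 0 := nonpos_of_mul_nonpos_right hle (Real.exp_pos _)
    exact (measureReal_eq_zero_iff).1 (le_antisymm hle' measureReal_nonneg)
  set x : ℝ := Real.log (K / S) - r * τ
  have hstrike : HasDerivAt (fun r : ℝ => Real.exp (Real.log (K / S) - r * τ))
      (Real.exp x * -(1 * τ)) r :=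
    (((hasDerivAt_id r).mul_const τ).const_sub (Real.log (K / S))).exp
  have hne : ∀ᵐ s ∂μ, Real.exp s ≠ Real.exp x := by
    filter_upwards [measure_eq_zero_iff_ae_notMem.1 (hatom x)] with s hs
    exact fun h => hs (Real.exp_injective h)
  have hcall := hasDerivAt_integral_max_sub_zero hmart1 Real.measurable_exp hne
  have hset : {s : ℝ | Real.exp x < Real.exp s} = Set.Ioi x := by ext s; simp
  rw [hset] at hcall
  refine ((hcall.comp r hstrike).const_mul S).congr_deriv ?_
  rw [Measure.real]
  ring
end

section
/- Assume ∫_ℝ |φ(u+iv)| du < ∞, so that μ has a continuous density f given by f(x) = (1/2π)∫_ℝ e^{i(u+iv)x} φ(u+iv) du. Fix K > 0, r ≥ 0, and for S > 0 set x(S) := ln(K/S) − rτ and C(S) := S·∫_ℝ (e^{s} − e^{x(S)})⁺ μ(ds). Then C is twice differentiable on (0,∞) and the Gamma satisfies C''(S) = e^{x(S)}·f(x(S)) / S. -/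
open MeasureTheory
open Filter Topology
open scoped FourierTransform SchwartzMap ContDiff

/-- If the Fourier transform of a finite measure is integrable, then its inverse Fourier transform
represents the measure when tested against Schwartz functions. -/
lemma integral_schwartz_eq_integral_fourierInv (ν : Measure ℝ) [IsFiniteMeasure ν] {ψ : ℝ → ℂ}
    (hψ : ψ = VectorFourier.fourierIntegral 𝐞 ν (innerₗ ℝ) fun _ => (1 : ℂ)) (hψi : Integrable ψ)
    (k : 𝓢(ℝ, ℂ)) :
    ∫ s, k s ∂ν = ∫ x, k x * 𝓕⁻ ψ x := by
  have hflip := VectorFourier.integral_fourierIntegral_smul_eq_flip (L := innerₗ ℝ) (μ := volume)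
    (ν := ν) (f := (𝓕⁻ k : 𝓢(ℝ, ℂ))) (g := fun _ : ℝ => (1 : ℂ)) Real.continuous_fourierChar
    continuous_inner (SchwartzMap.integrable _) (integrable_const _)
  have hflipInv := VectorFourier.integral_fourierIntegral_smul_eq_flip (L := -innerₗ ℝ)
    (μ := volume) (ν := volume) (f := k) (g := ψ) Real.continuous_fourierChar
    continuous_inner.neg k.integrable hψi
  rw [flip_innerₗ, ← hψ] at hflip
  have hk : VectorFourier.fourierIntegral 𝐞 volume (innerₗ ℝ) (𝓕⁻ k : 𝓢(ℝ, ℂ)) = k := by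
    change 𝓕 ((𝓕⁻ k : 𝓢(ℝ, ℂ)) : ℝ → ℂ) = k
    rw [← SchwartzMap.fourier_coe, FourierTransform.fourier_fourierInv_eq]
  have hkInv : VectorFourier.fourierIntegral 𝐞 volume (-innerₗ ℝ) k = (𝓕⁻ k : 𝓢(ℝ, ℂ)) := by
    rw [SchwartzMap.fourierInv_coe]; rfl
  have hL : (-innerₗ ℝ : ℝ →ₗ[ℝ] ℝ →ₗ[ℝ] ℝ).flip = -innerₗ ℝ := by
    ext; simp
  rw [hk] at hflip
  rw [hkInv, hL] at hflipInv
  simpa using! hflip.trans hflipInv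

/-- Locally finite measures on `ℝ` are determined by the integrals of smooth compactly supported
functions. -/
lemma MeasureTheory.Measure.ext_of_integral_contDiff {μ ν : Measure ℝ} [IsLocallyFiniteMeasure μ]
    [IsLocallyFiniteMeasure ν]
    (h : ∀ k : ℝ → ℝ, ContDiff ℝ ∞ k → HasCompactSupport k → ∫ x, k x ∂μ = ∫ x, k x ∂ν) :
    μ = ν := by
  refine Real.measure_ext_Ioo_rat fun a b => ?_
  rcases le_or_gt (b : ℝ) a with hab | hab
  · simp [Set.Ioo_eq_empty hab.not_gt]
  set c : ℝ := (a + b) / 2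
  set R : ℝ := (b - a) / 2 with hRdef
  have hR : 0 < R := by simp only [hRdef]; linarith
  have hball : Set.Ioo (a : ℝ) b = Metric.ball c R := by
    rw [Real.ball_eq_Ioo]; congr 1 <;> simp only [c, R] <;> ring
  rw [hball]
  let k : ℕ → ContDiffBump c := fun n =>
    { rIn := R * (1 - 1 / ((n : ℝ) + 2))
      rOut := R
      rIn_pos := by
        refine mul_pos hR (sub_pos.2 ?_)
        rw [div_lt_one (by positivity)]
        linarith [n.cast_nonneg (α := ℝ)]
      rIn_lt_rOut := mul_lt_of_lt_one_right hR (by simp; positivity) }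
  have key (ρ : Measure ℝ) [IsLocallyFiniteMeasure ρ] :
      Tendsto (fun n => ∫ x, k n x ∂ρ) atTop (𝓝 (ρ.real (Metric.ball c R))) := by
    rw [← integral_indicator_one measurableSet_ball]
    refine tendsto_integral_of_dominated_convergence ((Metric.ball c R).indicator 1)
      (fun n => (k n).continuous.aestronglyMeasurable) ?_ ?_ ?_
    · exact (integrable_indicator_iff measurableSet_ball).2
        (integrableOn_const Metric.isBounded_ball.measure_lt_top.ne)
    · refine fun n => ae_of_all _ fun x => ?_
      rw [Real.norm_of_nonneg (k n).nonneg]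
      by_cases hx : x ∈ Metric.ball c R
      · simpa [hx] using (k n).le_one
      · simp only [hx, not_false_eq_true, Set.indicator_of_notMem]
        exact ((k n).zero_of_le_dist (by simpa using hx)).le
    · refine ae_of_all _ fun x => ?_
      by_cases hx : x ∈ Metric.ball c R
      · have hlim : Tendsto (fun n => (k n).rIn) atTop (𝓝 R) := by
          have := (tendsto_const_nhds (x := (1 : ℝ)) (f := (atTop : Filter ℕ))).div_atTop
            (tendsto_natCast_atTop_atTop.atTop_add (tendsto_const_nhds (x := (2 : ℝ))))
          simpa [k] using (tendsto_const_nhds (x := R)).mul ((tendsto_const_nhds (x := (1 : ℝ))).sub this)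
        refine tendsto_const_nhds.congr' ?_
        filter_upwards [hlim.eventually (lt_mem_nhds (Metric.mem_ball.1 hx))] with n hn
        rw [(k n).one_of_mem_closedBall hn.le]
        simp [hx]
      · simp only [hx, not_false_eq_true, Set.indicator_of_notMem]
        refine tendsto_const_nhds.congr fun n => ?_
        exact ((k n).zero_of_le_dist (by simpa using hx)).symm
  have hreal := tendsto_nhds_unique (key μ)
    ((key ν).congr fun n => (h _ (k n).contDiff (k n).hasCompactSupport).symm)
  rwa [measureReal_eq_measureReal_iff Metric.isBounded_ball.measure_lt_top.ne
    Metric.isBounded_ball.measure_lt_top.ne] at hreal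

lemma nonneg_of_integral_contDiff_mul_nonneg {g : ℝ → ℝ} (hg : Continuous g)
    (h : ∀ k : ℝ → ℝ, ContDiff ℝ ∞ k → HasCompactSupport k → (∀ x, 0 ≤ k x) →
      0 ≤ ∫ x, k x * g x) (x : ℝ) : 0 ≤ g x := by
  by_contra! hx
  obtain ⟨R, hR, hball⟩ := Metric.eventually_nhds_iff_ball.1 (hg.continuousAt.eventually_lt_const hx)
  let k : ContDiffBump x := ⟨R / 2, R, by positivity, by linarith⟩
  have hpos := (k.continuous.mul hg).neg.integral_pos_of_hasCompactSupport_nonneg_nonzero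
    (μ := volume) (x := x) k.hasCompactSupport.mul_right.neg
    (fun y => by
      by_cases hy : y ∈ Metric.ball x R
      · exact neg_nonneg.2 (mul_nonpos_of_nonneg_of_nonpos k.nonneg (hball y hy).le)
      · simp [k.zero_of_le_dist (x := y) (by simpa using hy)])
    (neg_ne_zero.2 (mul_ne_zero (k.pos_of_mem_ball (Metric.mem_ball_self hR)).ne' hx.ne))
  have hnn := h k k.contDiff k.hasCompactSupport fun _ => k.nonneg
  rw [integral_neg'] at hpos
  exact (neg_pos.1 hpos).not_ge hnn

lemma integral_withDensity_ofReal {g : ℝ → ℝ} (hg : Continuous g) (hg0 : ∀ x, 0 ≤ g x)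
    {E : Type*} [NormedAddCommGroup E] [NormedSpace ℝ E] (ρ : Measure ℝ) (k : ℝ → E) :
    ∫ x, k x ∂ρ.withDensity (fun x => ENNReal.ofReal (g x)) = ∫ x, g x • k x ∂ρ := by
  rw [integral_withDensity_eq_integral_toReal_smul hg.measurable.ennreal_ofReal
    (ae_of_all _ fun _ => ENNReal.ofReal_lt_top)]
  simp only [ENNReal.toReal_ofReal (hg0 _)]

/-- Inversion: a finite measure with integrable Fourier transform has the inverse Fourier transform
of that function as density. -/
lemma eq_withDensity_of_fourierInv (ν : Measure ℝ) [IsFiniteMeasure ν] {ψ : ℝ → ℂ}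
    (hψ : ψ = VectorFourier.fourierIntegral 𝐞 ν (innerₗ ℝ) fun _ => (1 : ℂ)) (hψi : Integrable ψ)
    {g : ℝ → ℝ} (hg : ∀ x, (g x : ℂ) = 𝓕⁻ ψ x) :
    Continuous g ∧ (∀ x, 0 ≤ g x) ∧ ν = volume.withDensity fun x => ENNReal.ofReal (g x) := by
  have hgc : Continuous g := by
    have hre : g = fun x => (𝓕⁻ ψ x).re := by ext x; rw [← hg, Complex.ofReal_re]
    rw [hre]
    exact Complex.continuous_re.comp (VectorFourier.fourierIntegral_continuous
      Real.continuous_fourierChar continuous_inner.neg hψi)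
  have htest (k : ℝ → ℝ) (hk : ContDiff ℝ ∞ k) (hkc : HasCompactSupport k) :
      ∫ x, k x ∂ν = ∫ x, k x * g x := by
    have hkcomplex : HasCompactSupport fun x => (k x : ℂ) :=
      hkc.comp_left (g := ((↑) : ℝ → ℂ)) Complex.ofReal_zero
    have hksmooth : ContDiff ℝ ∞ fun x => (k x : ℂ) := Complex.ofRealCLM.contDiff.comp hk
    have := integral_schwartz_eq_integral_fourierInv ν hψ hψi (hkcomplex.toSchwartzMap hksmooth)
    change ∫ x, (k x : ℂ) ∂ν = ∫ x, (k x : ℂ) * 𝓕⁻ ψ x at this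
    simp only [← hg, ← Complex.ofReal_mul] at this
    rw [integral_complex_ofReal, integral_complex_ofReal] at this
    exact_mod_cast this
  have hg0 : ∀ x, 0 ≤ g x := nonneg_of_integral_contDiff_mul_nonneg hgc fun k hk hkc hk0 =>
    (integral_nonneg hk0).trans_eq (htest k hk hkc)
  refine ⟨hgc, hg0, ?_⟩
  have := IsLocallyFiniteMeasure.withDensity_ofReal (μ := volume) hgc
  refine Measure.ext_of_integral_contDiff fun k hk hkc => ?_
  rw [htest k hk hkc, integral_withDensity_ofReal hgc hg0]
  simp only [smul_eq_mul, mul_comm]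

lemma hasDerivAt_log_div_sub {K : ℝ} (hK : 0 < K) (a : ℝ) {S : ℝ} (hS : 0 < S) :
    HasDerivAt (fun S => Real.log (K / S) - a) (-S⁻¹) S := by
  have h : HasDerivAt (fun S => Real.log K - Real.log S - a) (-S⁻¹) S :=
    ((Real.hasDerivAt_log hS.ne').const_sub _).sub_const a
  refine h.congr_of_eventuallyEq ?_
  filter_upwards [lt_mem_nhds hS] with T hT
  rw [Real.log_div hK.ne' hT.ne']

/-- The tail integral of a continuous function against a measure with a continuous density is
differentiable in the lower endpoint. -/
lemma hasDerivAt_setIntegral_Ioi_withDensity {f h : ℝ → ℝ} (hf : Continuous f)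
    (hf0 : ∀ x, 0 ≤ f x) (hh : Continuous h)
    (hhi : Integrable h (volume.withDensity fun x => ENNReal.ofReal (f x))) (x : ℝ) :
    HasDerivAt
      (fun y => ∫ s in Set.Ioi y, h s ∂volume.withDensity fun x => ENNReal.ofReal (f x))
      (-(f x * h x)) x := by
  have hfh : Continuous fun s => f s * h s := hf.mul hh
  have hint : Integrable fun s => f s * h s := by
    rw [integrable_withDensity_iff_integrable_smul' hf.measurable.ennreal_ofReal
      (ae_of_all _ fun _ => ENNReal.ofReal_lt_top)] at hhi
    simpa only [ENNReal.toReal_ofReal (hf0 _), smul_eq_mul] using hhi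
  have heq (y : ℝ) :
      ∫ s in Set.Ioi y, h s ∂volume.withDensity (fun x => ENNReal.ofReal (f x)) =
        (∫ s in Set.Ioi x, f s * h s) - ∫ s in x..y, f s * h s := by
    rw [restrict_withDensity measurableSet_Ioi, integral_withDensity_ofReal hf hf0,
      ← intervalIntegral.integral_Ioi_sub_Ioi' hint.integrableOn hint.integrableOn]
    simp only [smul_eq_mul, sub_sub_cancel]
  simp only [heq]
  exact (intervalIntegral.integral_hasDerivAt_right (hfh.intervalIntegrable _ _)
    (hfh.stronglyMeasurableAtFilter _ _) hfh.continuousAt).const_sub _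

lemma integral_max_exp_sub_exp {μ : Measure ℝ} [IsFiniteMeasure μ]
    (hexp : Integrable (fun s : ℝ => Real.exp s) μ) (x : ℝ) :
    ∫ s, max (Real.exp s - Real.exp x) 0 ∂μ =
      ∫ s in Set.Ioi x, Real.exp s ∂μ - Real.exp x * ∫ _ in Set.Ioi x, (1 : ℝ) ∂μ := by
  rw [← integral_const_mul, ← integral_sub hexp.integrableOn (integrable_const _),
    ← integral_indicator measurableSet_Ioi]
  congr 1 with s
  by_cases hs : x < s
  · simp [hs, Real.exp_le_exp.2 hs.le]
  · simp [hs, Real.exp_le_exp.2 (not_lt.1 hs)]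

/-- The first derivative of the call price in the spot `S`. -/
lemma hasDerivAt_call {f : ℝ → ℝ} (hf : Continuous f) (hf0 : ∀ x, 0 ≤ f x) {μ : Measure ℝ}
    [IsFiniteMeasure μ] (hμ : μ = volume.withDensity fun x => ENNReal.ofReal (f x))
    (hexp : Integrable (fun s : ℝ => Real.exp s) μ) {K : ℝ} (hK : 0 < K) (a : ℝ) {S : ℝ}
    (hS : 0 < S) :
    HasDerivAt (fun S : ℝ => S * ∫ s : ℝ, max (Real.exp s - Real.exp (Real.log (K / S) - a)) 0 ∂μ)
      (∫ s in Set.Ioi (Real.log (K / S) - a), Real.exp s ∂μ) S := by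
  have hx := hasDerivAt_log_div_sub hK a hS
  have hA := (hasDerivAt_setIntegral_Ioi_withDensity hf hf0 Real.continuous_exp (hμ ▸ hexp)
    (Real.log (K / S) - a)).comp S hx
  have hB := (hasDerivAt_setIntegral_Ioi_withDensity hf hf0 (continuous_const (y := (1 : ℝ)))
    (hμ ▸ integrable_const _) (Real.log (K / S) - a)).comp S hx
  rw [← hμ] at hA hB
  simp only [integral_max_exp_sub_exp hexp]
  refine ((hasDerivAt_id S).mul (hA.sub (hx.exp.mul hB))).congr_deriv ?_
  simp only [Function.comp_apply, Pi.sub_apply, Pi.mul_apply, id]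
  field_simp
  ring

/-- Gamma of a call option: if `∫ |φ(u+iv)| du < ∞` then `μ` has a continuous density `f`
given by `f(x) = (1/2π)∫ e^{i(u+iv)x} φ(u+iv) du`, and with `x(S) = ln(K/S) - rτ` and
`C(S) = S·∫(e^s - e^{x(S)})⁺ μ(ds)`, the price `C` is twice differentiable on `(0,∞)` with
`C''(S) = e^{x(S)} f(x(S)) / S`. -/
theorem call_Gamma
    (v τ : ℝ) (hv : 1 < v) (hτ : 0 < τ)
    (μ : Measure ℝ) [IsProbabilityMeasure μ]
    (hμv : Integrable (fun s : ℝ => Real.exp (v * s)) μ)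
    (hmart1 : Integrable (fun s : ℝ => Real.exp s) μ)
    (hmart2 : ∫ s : ℝ, Real.exp s ∂μ = 1)
    (φ : ℂ → ℂ)
    (hφ : ∀ z : ℂ, φ z = ∫ s : ℝ, Complex.exp (-(Complex.I * z * (s : ℂ))) ∂μ)
    (hint : Integrable (fun u : ℝ => ‖φ ((u : ℂ) + (v : ℂ) * Complex.I)‖))
    (f : ℝ → ℝ)
    (hf : ∀ x : ℝ, ((f x : ℝ) : ℂ) =
      (1 / (2 * (Real.pi : ℂ))) *
        ∫ u : ℝ,
          Complex.exp (Complex.I * ((u : ℂ) + (v : ℂ) * Complex.I) * (x : ℂ)) *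
            φ ((u : ℂ) + (v : ℂ) * Complex.I))
    (K r : ℝ) (hK : 0 < K) (hr : 0 ≤ r) :
    Continuous f ∧
    μ = volume.withDensity (fun x => ENNReal.ofReal (f x)) ∧
    ∀ S ∈ Set.Ioi (0 : ℝ),
      DifferentiableAt ℝ
        (fun S : ℝ => S * ∫ s : ℝ, max (Real.exp s - Real.exp (Real.log (K / S) - r * τ)) 0 ∂μ)
        S ∧
      HasDerivAt
        (deriv fun S : ℝ =>
          S * ∫ s : ℝ, max (Real.exp s - Real.exp (Real.log (K / S) - r * τ)) 0 ∂μ)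
        (Real.exp (Real.log (K / S) - r * τ) * f (Real.log (K / S) - r * τ) / S) S := by
  set ν : Measure ℝ := μ.withDensity fun s => ENNReal.ofReal (Real.exp (v * s))
  have : IsFiniteMeasure ν := isFiniteMeasure_withDensity_ofReal hμv.2
  have hcexp : Continuous fun s : ℝ => Real.exp (v * s) := by fun_prop
  set ψ : ℝ → ℂ := fun ξ => φ (((2 * Real.pi * ξ : ℝ) : ℂ) + (v : ℂ) * Complex.I)
  have hψ : ψ = VectorFourier.fourierIntegral 𝐞 ν (innerₗ ℝ) fun _ => (1 : ℂ) := by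
    ext ξ
    simp only [ψ, hφ, VectorFourier.fourierIntegral, ν,
      integral_withDensity_ofReal hcexp fun _ => (Real.exp_pos _).le]
    congr 1 with s
    rw [Circle.smul_def, Real.fourierChar_apply, smul_eq_mul, mul_one, Complex.real_smul,
      Complex.ofReal_exp, ← Complex.exp_add]
    congr 1
    simp only [innerₗ_apply_apply, RCLike.inner_apply, conj_trivial]
    push_cast
    linear_combination (-(v : ℂ) * s) * Complex.I_sq
  have hψc : Continuous ψ := hψ ▸ VectorFourier.fourierIntegral_continuous
    Real.continuous_fourierChar continuous_inner (integrable_const _)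
  have hψi : Integrable ψ := (integrable_norm_iff hψc.aestronglyMeasurable).1
    (hint.comp_mul_left' Real.two_pi_pos.ne')
  have hg (x : ℝ) : ((Real.exp (v * x) * f x : ℝ) : ℂ) = 𝓕⁻ ψ x := by
    have hscale := Measure.integral_comp_mul_left (fun u : ℝ =>
      Complex.exp (Complex.I * ((u : ℂ) + (v : ℂ) * Complex.I) * (x : ℂ)) *
        φ ((u : ℂ) + (v : ℂ) * Complex.I)) (2 * Real.pi)
    rw [abs_of_pos (inv_pos.2 Real.two_pi_pos), Complex.real_smul] at hscale
    rw [Complex.ofReal_mul, hf, one_div]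
    push_cast at hscale
    rw [← hscale, Real.fourierInv_eq', ← integral_const_mul]
    congr 1 with ξ
    simp only [ψ, smul_eq_mul]
    rw [← mul_assoc, Complex.ofReal_exp, ← Complex.exp_add]
    push_cast
    congr 2
    simp only [RCLike.inner_apply, conj_trivial]
    push_cast
    linear_combination ((v : ℂ) * x) * Complex.I_sq
  obtain ⟨hgc, hg0, hν⟩ := eq_withDensity_of_fourierInv ν hψ hψi hg
  have hf0 (x : ℝ) : 0 ≤ f x := nonneg_of_mul_nonneg_right (hg0 x) (Real.exp_pos _)
  have hfc : Continuous f := by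
    have hfg : f = fun x => Real.exp (-(v * x)) * (Real.exp (v * x) * f x) := by
      ext x
      rw [← mul_assoc, ← Real.exp_add, neg_add_cancel, Real.exp_zero, one_mul]
    rw [hfg]
    exact (by fun_prop : Continuous fun x : ℝ => Real.exp (-(v * x))).mul hgc
  have hμ : μ = volume.withDensity fun x => ENNReal.ofReal (f x) := by
    have hmul : (fun x => ENNReal.ofReal (Real.exp (v * x) * f x)) =
        (fun x => ENNReal.ofReal (f x)) * fun x => ENNReal.ofReal (Real.exp (v * x)) := by
      ext x
      rw [mul_comm, ENNReal.ofReal_mul (hf0 x), Pi.mul_apply]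
    rw [hmul, withDensity_mul _ hfc.measurable.ennreal_ofReal hcexp.measurable.ennreal_ofReal] at hν
    have hinv (ρ : Measure ℝ) := withDensity_inv_same (μ := ρ) hcexp.measurable.ennreal_ofReal
      (ae_of_all _ fun s => (ENNReal.ofReal_pos.2 (Real.exp_pos _)).ne')
      (ae_of_all _ fun s => ENNReal.ofReal_ne_top)
    rw [← hinv μ, ← hinv (volume.withDensity fun x => ENNReal.ofReal (f x)), ← hν]
  refine ⟨hfc, hμ, fun S hS => ?_⟩
  have hderiv {T : ℝ} (hT : 0 < T) := hasDerivAt_call hfc hf0 hμ hmart1 hK (r * τ) hT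
  refine ⟨(hderiv hS).differentiableAt, ?_⟩
  have htail := (hasDerivAt_setIntegral_Ioi_withDensity hfc hf0 Real.continuous_exp (hμ ▸ hmart1)
    (Real.log (K / S) - r * τ)).comp S (hasDerivAt_log_div_sub hK (r * τ) hS)
  rw [← hμ] at htail
  refine (htail.congr_of_eventuallyEq ?_).congr_deriv (by ring)
  filter_upwards [lt_mem_nhds hS] with T hT
  exact (hderiv hT).deriv
end

section
/- Assume sup_{u∈ℝ} Re Ψ_J(−(u+iv)) < ∞ and fix 0 < Σ₁ < Σ₂ and x ∈ ℝ. For σ ∈ (Σ₁,Σ₂) and z = u+iv define Ψ_σ(−z) := iz(1+iz)σ²/2 + Ψ_J(−z) and the (normalized) call value V(σ) := (e^{x}/2π) ∫_ℝ e^{izx} · e^{τΨ_σ(−z)} / ( iz(1+iz) ) du. Then V is differentiable on (Σ₁,Σ₂) and the Vega satisfies V'(σ) = τσ·(e^{x}/2π) ∫_ℝ e^{izx} · e^{τΨ_σ(−z)} du (which in the Lévy model equals τσ·e^{x}·f_τ(x), f_τ the density of the log-return). -/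
open MeasureTheory

/-- The jump exponent along a horizontal line is measurable. -/
lemma measurable_jump_exponent (v : ℝ) (ν : Measure ℝ) [SFinite ν] :
    Measurable fun u : ℝ => ∫ y : ℝ,
      (Complex.exp (-(Complex.I * ((u : ℂ) + (v : ℂ) * Complex.I) * (y : ℂ))) - 1 +
        Complex.I * ((u : ℂ) + (v : ℂ) * Complex.I) * (Complex.exp (y : ℂ) - 1)) ∂ν := by
  have h : StronglyMeasurable (Function.uncurry fun u y : ℝ =>
      Complex.exp (-(Complex.I * ((u : ℂ) + (v : ℂ) * Complex.I) * (y : ℂ))) - 1 +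
        Complex.I * ((u : ℂ) + (v : ℂ) * Complex.I) * (Complex.exp (y : ℂ) - 1)) := by
    apply Continuous.stronglyMeasurable
    unfold Function.uncurry
    fun_prop
  exact h.integral_prod_right.measurable

/-- Differentiation under the integral sign in the volatility parameter, for an integrand with
Gaussian factor `exp (τ w σ² / 2)` where `Re w(u) = c - u²` and `w` is bounded away from `0`. -/
lemma hasDerivAt_integral_gaussian_factor {τ c δ K B a b : ℝ} (hτ : 0 < τ) (hc : 0 ≤ c)
    (hδ : 0 < δ) (ha : 0 < a) {A w Ψ : ℝ → ℂ} (hA : Measurable A) (hw : Measurable w)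
    (hΨ : Measurable Ψ) (hAK : ∀ u, ‖A u‖ ≤ K) (hwre : ∀ u, (w u).re = c - u ^ 2)
    (hwδ : ∀ u, δ ≤ ‖w u‖) (hB : ∀ u, (Ψ u).re ≤ B) {σ : ℝ} (hσ : σ ∈ Set.Ioo a b) :
    HasDerivAt
      (fun s : ℝ => ∫ u : ℝ, A u * Complex.exp (τ * (w u * (s : ℂ) ^ 2 / 2 + Ψ u)) / w u)
      (τ * σ * ∫ u : ℝ, A u * Complex.exp (τ * (w u * (σ : ℂ) ^ 2 / 2 + Ψ u))) σ := by
  have hK : 0 ≤ K := (norm_nonneg _).trans (hAK 0)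
  have hw0 : ∀ u, w u ≠ 0 := fun u => norm_pos_iff.1 (hδ.trans_le (hwδ u))
  set G : ℝ → ℝ := fun u =>
    K * Real.exp (τ * (c * b ^ 2 / 2 + B)) * Real.exp (-(τ * a ^ 2 / 2) * u ^ 2) with hG
  have hGint : Integrable G := (integrable_exp_neg_mul_sq (by positivity)).const_mul _
  have hbound : ∀ s ∈ Set.Ioo a b, ∀ u,
      ‖A u * Complex.exp (τ * (w u * (s : ℂ) ^ 2 / 2 + Ψ u))‖ ≤ G u := by
    intro s hs u
    have hre : ((τ : ℂ) * (w u * (s : ℂ) ^ 2 / 2 + Ψ u)).re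
        = τ * ((c - u ^ 2) * s ^ 2 / 2 + (Ψ u).re) := by
      have : (τ : ℂ) * (w u * (s : ℂ) ^ 2 / 2 + Ψ u)
          = (τ : ℂ) * (((s ^ 2 / 2 : ℝ) : ℂ) * w u + Ψ u) := by push_cast; ring
      rw [this, Complex.re_ofReal_mul, Complex.add_re, Complex.re_ofReal_mul, hwre]
      ring
    rw [norm_mul, Complex.norm_exp, hre, hG]
    dsimp only
    rw [mul_assoc, ← Real.exp_add]
    have has : a ^ 2 ≤ s ^ 2 := pow_le_pow_left₀ ha.le hs.1.le 2
    have hsb : s ^ 2 ≤ b ^ 2 := pow_le_pow_left₀ (ha.trans hs.1).le hs.2.le 2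
    refine mul_le_mul (hAK u) (Real.exp_le_exp.2 ?_) (Real.exp_pos _).le hK
    have h : (c - u ^ 2) * s ^ 2 / 2 + (Ψ u).re ≤ c * b ^ 2 / 2 + B - a ^ 2 / 2 * u ^ 2 := by
      linarith [hB u, mul_le_mul_of_nonneg_left hsb hc,
        mul_le_mul_of_nonneg_right has (sq_nonneg u)]
    calc _ ≤ τ * (c * b ^ 2 / 2 + B - a ^ 2 / 2 * u ^ 2) := mul_le_mul_of_nonneg_left h hτ.le
      _ = _ := by ring
  have hmeas : ∀ s : ℝ, Measurable fun u =>
      A u * Complex.exp (τ * (w u * (s : ℂ) ^ 2 / 2 + Ψ u)) := fun s => by fun_prop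
  have key := (hasDerivAt_integral_of_dominated_loc_of_deriv_le (μ := volume)
    (F := fun (s : ℝ) (u : ℝ) =>
      A u * Complex.exp (τ * (w u * (s : ℂ) ^ 2 / 2 + Ψ u)) / w u)
    (F' := fun (s : ℝ) (u : ℝ) =>
      τ * s * (A u * Complex.exp (τ * (w u * (s : ℂ) ^ 2 / 2 + Ψ u))))
    (bound := fun u => τ * b * G u) (Ioo_mem_nhds hσ.1 hσ.2)
    (Filter.Eventually.of_forall fun s => ((hmeas s).div hw).aestronglyMeasurable)
    ?_ ((hmeas σ).const_mul _).aestronglyMeasurable ?_ (hGint.const_mul _) ?_).2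
  · rwa [integral_const_mul] at key
  · refine (hGint.div_const δ).mono' ((hmeas σ).div hw).aestronglyMeasurable
      (Filter.Eventually.of_forall fun u => ?_)
    rw [norm_div]
    exact div_le_div₀ ((norm_nonneg _).trans (hbound σ hσ u)) (hbound σ hσ u) hδ (hwδ u)
  · refine Filter.Eventually.of_forall fun u s hs => ?_
    rw [norm_mul, norm_mul, Complex.norm_real, Complex.norm_real, Real.norm_of_nonneg hτ.le,
      Real.norm_of_nonneg (ha.trans hs.1).le]
    exact mul_le_mul (mul_le_mul_of_nonneg_left hs.2.le hτ.le) (hbound s hs u) (norm_nonneg _)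
      (mul_nonneg hτ.le ((ha.trans hs.1).trans hs.2).le)
  · refine Filter.Eventually.of_forall fun u s _ => ?_
    have hid : HasDerivAt (fun t : ℝ => (t : ℂ)) 1 s := Complex.ofRealCLM.hasDerivAt
    have h := ((((((hid.pow 2).const_mul (w u)).div_const 2).add_const (Ψ u)).const_mul
      (τ : ℂ)).cexp.const_mul (A u)).div_const (w u)
    refine h.congr_deriv ?_
    have := hw0 u
    simp only [Pi.pow_apply]
    field_simp
    ring

/-- Vega of a call option in the Lewis representation: with
`Ψ_σ(-z) = iz(1+iz)σ²/2 + Ψ_J(-z)` and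
`V(σ) = (e^x/2π) ∫ e^{izx} e^{τΨ_σ(-z)} / (iz(1+iz)) du`, the function `V` is
differentiable on `(Sig₁,Sig₂)` with `V'(σ) = τσ·(e^x/2π) ∫ e^{izx} e^{τΨ_σ(-z)} du`. -/
theorem call_Vega
    (v τ : ℝ) (hv : 1 < v) (hτ : 0 < τ)
    (ν : Measure ℝ) [SigmaFinite ν]
    (hν0 : ν {0} = 0)
    (hν1 : IntegrableOn (fun y : ℝ => y ^ 2) {y : ℝ | |y| ≤ 1} ν)
    (hν2 : ν {y : ℝ | 1 < |y|} < ⊤)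
    (hν3 : IntegrableOn (fun y : ℝ => Real.exp (v * y)) {y : ℝ | 1 < |y|} ν)
    (hν4 : IntegrableOn (fun y : ℝ => Real.exp y) {y : ℝ | 1 < |y|} ν)
    (ΨJ : ℝ → ℂ)
    (hΨJ : ∀ u : ℝ, ΨJ u =
      ∫ y : ℝ,
        (Complex.exp (-(Complex.I * ((u : ℂ) + (v : ℂ) * Complex.I) * (y : ℂ))) - 1 +
          Complex.I * ((u : ℂ) + (v : ℂ) * Complex.I) * (Complex.exp (y : ℂ) - 1)) ∂ν)
    (hsup : ∃ B : ℝ, ∀ u : ℝ, (ΨJ u).re ≤ B)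
    (Sig₁ Sig₂ x : ℝ) (hSig₁ : 0 < Sig₁) (hSig : Sig₁ < Sig₂) :
    ∀ σ ∈ Set.Ioo Sig₁ Sig₂,
      HasDerivAt
        (fun σ : ℝ => ((Real.exp x : ℂ) / (2 * (Real.pi : ℂ))) *
          ∫ u : ℝ,
            Complex.exp (Complex.I * ((u : ℂ) + (v : ℂ) * Complex.I) * (x : ℂ)) *
              Complex.exp ((τ : ℂ) *
                (Complex.I * ((u : ℂ) + (v : ℂ) * Complex.I) *
                    (1 + Complex.I * ((u : ℂ) + (v : ℂ) * Complex.I)) * (σ : ℂ) ^ 2 / 2 +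
                  ΨJ u)) /
              (Complex.I * ((u : ℂ) + (v : ℂ) * Complex.I) *
                (1 + Complex.I * ((u : ℂ) + (v : ℂ) * Complex.I))))
        ((τ : ℂ) * (σ : ℂ) * ((Real.exp x : ℂ) / (2 * (Real.pi : ℂ))) *
          ∫ u : ℝ,
            Complex.exp (Complex.I * ((u : ℂ) + (v : ℂ) * Complex.I) * (x : ℂ)) *
              Complex.exp ((τ : ℂ) *
                (Complex.I * ((u : ℂ) + (v : ℂ) * Complex.I) *
                    (1 + Complex.I * ((u : ℂ) + (v : ℂ) * Complex.I)) * (σ : ℂ) ^ 2 / 2 +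
                  ΨJ u))) σ := by
  intro σ hσ
  obtain ⟨B, hB⟩ := hsup
  have hz : ∀ u : ℝ, Complex.I * ((u : ℂ) + (v : ℂ) * Complex.I) = ⟨-v, u⟩ := fun u => by
    apply Complex.ext <;> simp
  have hz1 : ∀ u : ℝ, 1 + Complex.I * ((u : ℂ) + (v : ℂ) * Complex.I) = ⟨1 - v, u⟩ := fun u => by
    apply Complex.ext <;> simp [sub_eq_add_neg]
  have hΨm : Measurable ΨJ := by
    rw [funext hΨJ]
    exact measurable_jump_exponent v ν
  have key := hasDerivAt_integral_gaussian_factor (c := v * (v - 1)) (δ := v * (v - 1))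
    (K := Real.exp (-v * x)) hτ (by nlinarith) (by nlinarith) hSig₁
    (A := fun u : ℝ => Complex.exp (Complex.I * ((u : ℂ) + (v : ℂ) * Complex.I) * (x : ℂ)))
    (w := fun u : ℝ => Complex.I * ((u : ℂ) + (v : ℂ) * Complex.I) *
      (1 + Complex.I * ((u : ℂ) + (v : ℂ) * Complex.I)))
    (by fun_prop) (by fun_prop) hΨm
    (fun u => by rw [Complex.norm_exp, hz, Complex.re_mul_ofReal])
    (fun u => by rw [hz1, hz, Complex.mul_re]; ring)
    (fun u => by
      rw [hz1, hz, norm_mul]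
      refine mul_le_mul ?_ ?_ (by linarith) (norm_nonneg _)
      · simpa using (neg_le_abs _).trans (Complex.abs_re_le_norm (⟨-v, u⟩ : ℂ))
      · simpa using (neg_le_abs _).trans (Complex.abs_re_le_norm (⟨1 - v, u⟩ : ℂ)))
    hB hσ
  refine (key.const_mul ((Real.exp x : ℂ) / (2 * (Real.pi : ℂ)))).congr_deriv ?_
  ring
end

section
/- Fix σ > 0, x ∈ ℝ, 0 ≤ λ₁ < λ₂, and assume sup_{u∈ℝ} Re Ψ̄_J(−(u+iv)) < ∞. For λ ∈ (λ₁,λ₂) and z = u+iv define Ψ_λ(−z) := iz(1+iz)σ²/2 + λ·Ψ̄_J(−z) and D(λ) := (1/2π) ∫_ℝ e^{(1+iz)x} · e^{τΨ_λ(−z)} / ( iz(1+iz) ) du. Then D is differentiable on (λ₁,λ₂) and the jump-intensity sensitivity satisfies D'(λ) = τ·(1/2π) ∫_ℝ e^{(1+iz)x} · e^{τΨ_λ(−z)} · Ψ̄_J(−z) / ( iz(1+iz) ) du. -/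
open MeasureTheory

/-- The jump integrand `e^{-wy} - 1 + w(e^y - 1)` is quadratically small near the origin. -/
lemma norm_jumpIntegrand_le_of_abs_le_one (w : ℂ) {y : ℝ} (hy : |y| ≤ 1) :
    ‖Complex.exp (-(w * (y : ℂ))) - 1 + w * (Complex.exp (y : ℂ) - 1)‖ ≤
      3 * Real.exp (2 * ‖w‖) * y ^ 2 := by
  have hnorm : ‖-(w * (y : ℂ))‖ = ‖w‖ * |y| := by simp
  have hle : ‖w‖ * |y| ≤ ‖w‖ := mul_le_of_le_one_right (norm_nonneg w) hy
  have hexp : ‖Complex.exp (-(w * (y : ℂ))) - 1 - -(w * (y : ℂ))‖ ≤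
      (‖w‖ ^ 2 * y ^ 2) * Real.exp ‖w‖ := by
    have h := Complex.norm_exp_sub_sum_le_norm_mul_exp (-(w * (y : ℂ))) 2
    rw [hnorm, mul_pow, sq_abs] at h
    simp only [Finset.sum_range_succ, Finset.sum_range_zero, pow_zero, pow_one,
      Nat.factorial, Nat.cast_one, div_one, zero_add, mul_one, ← sub_sub] at h
    exact h.trans (by gcongr)
  have hcomp : ‖w * (Complex.exp (y : ℂ) - 1 - (y : ℂ))‖ ≤ ‖w‖ * y ^ 2 := by
    rw [norm_mul]
    have h := Complex.norm_exp_sub_one_sub_id_le (x := (y : ℂ)) (by simpa using hy)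
    rw [Complex.norm_real, Real.norm_eq_abs, sq_abs] at h
    gcongr
  have hquad : ‖w‖ ^ 2 ≤ 2 * Real.exp ‖w‖ := by
    have := Real.quadratic_le_exp_of_nonneg (norm_nonneg w)
    nlinarith [norm_nonneg w]
  have hlin : ‖w‖ ≤ Real.exp (2 * ‖w‖) := by
    have := Real.add_one_le_exp (2 * ‖w‖)
    linarith [norm_nonneg w]
  have hsq : Real.exp (2 * ‖w‖) = Real.exp ‖w‖ * Real.exp ‖w‖ := by
    rw [← Real.exp_add, two_mul]
  calc ‖Complex.exp (-(w * (y : ℂ))) - 1 + w * (Complex.exp (y : ℂ) - 1)‖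
      = ‖(Complex.exp (-(w * (y : ℂ))) - 1 - -(w * (y : ℂ))) +
          w * (Complex.exp (y : ℂ) - 1 - (y : ℂ))‖ := by congr 1; ring
    _ ≤ (‖w‖ ^ 2 * y ^ 2) * Real.exp ‖w‖ + ‖w‖ * y ^ 2 :=
        (norm_add_le _ _).trans (add_le_add hexp hcomp)
    _ ≤ ((2 * Real.exp ‖w‖) * y ^ 2) * Real.exp ‖w‖ + Real.exp (2 * ‖w‖) * y ^ 2 := by
        gcongr
    _ = 3 * Real.exp (2 * ‖w‖) * y ^ 2 := by rw [hsq]; ring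

/-- The jump integrand is controlled by the exponential moments of orders `-re w` and `1`. -/
lemma norm_jumpIntegrand_le (w : ℂ) (y : ℝ) :
    ‖Complex.exp (-(w * (y : ℂ))) - 1 + w * (Complex.exp (y : ℂ) - 1)‖ ≤
      3 * Real.exp (2 * ‖w‖) * (Real.exp (-w.re * y) + Real.exp y + 2) := by
  have h1 : ‖Complex.exp (-(w * (y : ℂ)))‖ = Real.exp (-w.re * y) := by
    simp [Complex.norm_exp]
  have h2 : ‖Complex.exp (y : ℂ)‖ = Real.exp y := by simp [Complex.norm_exp]
  have hlin : ‖w‖ ≤ Real.exp (2 * ‖w‖) := by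
    have := Real.add_one_le_exp (2 * ‖w‖)
    linarith [norm_nonneg w]
  have hone : 1 ≤ Real.exp (2 * ‖w‖) := Real.one_le_exp (by positivity)
  calc ‖Complex.exp (-(w * (y : ℂ))) - 1 + w * (Complex.exp (y : ℂ) - 1)‖
      ≤ (Real.exp (-w.re * y) + 1) + ‖w‖ * (Real.exp y + 1) := by
        refine (norm_add_le _ _).trans (add_le_add ?_ ?_)
        · simpa [h1] using norm_sub_le (Complex.exp (-(w * (y : ℂ)))) 1
        · rw [norm_mul]
          gcongr
          simpa [h2] using norm_sub_le (Complex.exp (y : ℂ)) 1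
    _ ≤ Real.exp (2 * ‖w‖) * (Real.exp (-w.re * y) + 1) +
          Real.exp (2 * ‖w‖) * (Real.exp y + 1) := by
        gcongr
        exact le_mul_of_one_le_left (by positivity) hone
    _ = Real.exp (2 * ‖w‖) * (Real.exp (-w.re * y) + Real.exp y + 2) := by ring
    _ ≤ 3 * Real.exp (2 * ‖w‖) * (Real.exp (-w.re * y) + Real.exp y + 2) := by
        gcongr
        linarith

/-- On a vertical line, the jump exponent grows at most exponentially. -/
lemma exists_norm_integral_jumpIntegrand_le {v : ℝ} {ν : Measure ℝ}
    (hsmall : IntegrableOn (fun y : ℝ => y ^ 2) {y : ℝ | |y| ≤ 1} ν)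
    (hlarge : ν {y : ℝ | 1 < |y|} < ⊤)
    (hexpv : IntegrableOn (fun y : ℝ => Real.exp (v * y)) {y : ℝ | 1 < |y|} ν)
    (hexp : IntegrableOn (fun y : ℝ => Real.exp y) {y : ℝ | 1 < |y|} ν) :
    ∃ C : ℝ, ∀ w : ℂ, w.re = -v →
      ‖∫ y : ℝ, (Complex.exp (-(w * (y : ℂ))) - 1 + w * (Complex.exp (y : ℂ) - 1)) ∂ν‖ ≤
        C * Real.exp (2 * ‖w‖) := by
  have hs : MeasurableSet {y : ℝ | |y| ≤ 1} := measurableSet_le measurable_norm measurable_const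
  have ht : MeasurableSet {y : ℝ | 1 < |y|} := measurableSet_lt measurable_const measurable_norm
  have hmoment : IntegrableOn (fun y : ℝ => Real.exp (v * y) + Real.exp y + 2)
      {y : ℝ | 1 < |y|} ν :=
    (hexpv.add hexp).add (integrableOn_const hlarge.ne)
  let g : ℝ → ℝ := fun y => {y : ℝ | |y| ≤ 1}.indicator (fun y => y ^ 2) y +
    {y : ℝ | 1 < |y|}.indicator (fun y => Real.exp (v * y) + Real.exp y + 2) y
  have hg : Integrable g ν :=
    (hsmall.integrable_indicator hs).add (hmoment.integrable_indicator ht)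
  refine ⟨3 * ∫ y, g y ∂ν, fun w hw => ?_⟩
  have hbound := norm_integral_le_of_norm_le (hg.const_mul (3 * Real.exp (2 * ‖w‖)))
    (f := fun y : ℝ => Complex.exp (-(w * (y : ℂ))) - 1 + w * (Complex.exp (y : ℂ) - 1)) <| by
      refine Filter.Eventually.of_forall fun y => ?_
      rcases le_or_gt |y| 1 with hy | hy
      · simpa [g, hy, hy.not_gt] using norm_jumpIntegrand_le_of_abs_le_one w hy
      · simpa [g, hy, hy.not_ge, hw] using norm_jumpIntegrand_le w y
  rw [integral_const_mul] at hbound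
  linarith

/-- A Gaussian dominates an exponential. -/
lemma integrable_exp_mul_abs_mul_exp_neg_mul_sq {a : ℝ} (ha : 0 < a) :
    Integrable fun u : ℝ => Real.exp (2 * |u|) * Real.exp (-a * u ^ 2) := by
  refine ((integrable_exp_neg_mul_sq (half_pos ha)).const_mul (Real.exp (2 / a))).mono'
    (by fun_prop) (Filter.Eventually.of_forall fun u => ?_)
  rw [Real.norm_of_nonneg (by positivity), ← Real.exp_add, ← Real.exp_add]
  refine Real.exp_le_exp.mpr ?_
  have h : 0 ≤ (a * |u| - 2) ^ 2 / (2 * a) := by positivity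
  have heq : (a * |u| - 2) ^ 2 / (2 * a) = a / 2 * u ^ 2 - 2 * |u| + 2 / a := by
    rw [← sq_abs u]
    field_simp
    ring
  linarith

/-- Differentiation under the integral sign in an exponential parameter, when the exponent has
real part bounded above. -/
lemma hasDerivAt_integral_mul_exp_mul {α : Type*} [MeasurableSpace α] {μ : Measure α}
    {A Φ : α → ℂ} {B l₁ l₂ l : ℝ} (hl₁ : 0 ≤ l₁) (hl : l ∈ Set.Ioo l₁ l₂)
    (hA : Integrable A μ) (hAΦ : Integrable (fun u => A u * Φ u) μ)
    (hΦ : AEStronglyMeasurable Φ μ) (hB : ∀ u, (Φ u).re ≤ B) :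
    HasDerivAt (fun l : ℝ => ∫ u, A u * Complex.exp ((l : ℂ) * Φ u) ∂μ)
      (∫ u, A u * Complex.exp ((l : ℂ) * Φ u) * Φ u ∂μ) l := by
  have hmeas (m : ℝ) : AEStronglyMeasurable (fun u => Complex.exp ((m : ℂ) * Φ u)) μ :=
    Complex.continuous_exp.comp_aestronglyMeasurable (hΦ.const_mul _)
  have hexp (m : ℝ) (hm : m ∈ Set.Ioo l₁ l₂) (u : α) :
      ‖Complex.exp ((m : ℂ) * Φ u)‖ ≤ Real.exp (l₂ * |B|) := by
    rw [Complex.norm_exp, Complex.re_ofReal_mul]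
    have hm0 : 0 ≤ m := hl₁.trans hm.1.le
    refine Real.exp_le_exp.mpr ?_
    calc m * (Φ u).re ≤ m * |B| := by
          gcongr
          exact (hB u).trans (le_abs_self B)
      _ ≤ l₂ * |B| := by
          gcongr
          exact hm.2.le
  refine (hasDerivAt_integral_of_dominated_loc_of_deriv_le
    (F' := fun m u => A u * Complex.exp ((m : ℂ) * Φ u) * Φ u)
    (bound := fun u => Real.exp (l₂ * |B|) * ‖A u * Φ u‖) (isOpen_Ioo.mem_nhds hl)
    (Filter.Eventually.of_forall fun m => hA.aestronglyMeasurable.mul (hmeas m))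
    (hA.mul_bdd (hmeas l) (Filter.Eventually.of_forall (hexp l hl)))
    ((hA.aestronglyMeasurable.mul (hmeas l)).mul hΦ)
    (Filter.Eventually.of_forall fun u m hm => ?_) (hAΦ.norm.const_mul _)
    (Filter.Eventually.of_forall fun u m _ => ?_)).2
  · rw [mul_right_comm, norm_mul, mul_comm]
    gcongr
    exact hexp m hm u
  · have h : HasDerivAt (fun m : ℝ => (m : ℂ) * Φ u) (Φ u) m := by
      simpa using (Complex.ofRealCLM.hasDerivAt (x := m)).mul_const (Φ u)
    simpa [mul_assoc] using h.cexp.const_mul (A u)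

/-- The Lewis kernel decays like a Gaussian on a horizontal line `im z = v` with `v > 1`. -/
lemma norm_lewisKernel_le {v : ℝ} (hv : 1 < v) (τ σ x u : ℝ) :
    ‖Complex.exp ((1 + Complex.I * ((u : ℂ) + (v : ℂ) * Complex.I)) * (x : ℂ)) *
        Complex.exp ((τ : ℂ) * (Complex.I * ((u : ℂ) + (v : ℂ) * Complex.I) *
          (1 + Complex.I * ((u : ℂ) + (v : ℂ) * Complex.I)) * (σ : ℂ) ^ 2 / 2)) /
        (Complex.I * ((u : ℂ) + (v : ℂ) * Complex.I) *
          (1 + Complex.I * ((u : ℂ) + (v : ℂ) * Complex.I)))‖ ≤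
      Real.exp ((1 - v) * x) * Real.exp (τ * σ ^ 2 / 2 * (v ^ 2 - v)) / (v * (v - 1)) *
        Real.exp (-(τ * σ ^ 2 / 2) * u ^ 2) := by
  have hw : Complex.I * ((u : ℂ) + (v : ℂ) * Complex.I) = ⟨-v, u⟩ := by
    apply Complex.ext <;> simp
  rw [hw]
  have h1 : ‖Complex.exp ((1 + (⟨-v, u⟩ : ℂ)) * (x : ℂ))‖ = Real.exp ((1 - v) * x) := by
    rw [Complex.norm_exp]
    simp [sub_eq_add_neg]
  have h2 : ‖Complex.exp ((τ : ℂ) * ((⟨-v, u⟩ : ℂ) * (1 + (⟨-v, u⟩ : ℂ)) * (σ : ℂ) ^ 2 / 2))‖ =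
      Real.exp (τ * σ ^ 2 / 2 * (v ^ 2 - v)) * Real.exp (-(τ * σ ^ 2 / 2) * u ^ 2) := by
    have hfac : (τ : ℂ) * ((⟨-v, u⟩ : ℂ) * (1 + (⟨-v, u⟩ : ℂ)) * (σ : ℂ) ^ 2 / 2) =
        ((τ * σ ^ 2 / 2 : ℝ) : ℂ) * ((⟨-v, u⟩ : ℂ) * (1 + (⟨-v, u⟩ : ℂ))) := by
      push_cast
      ring
    rw [hfac, Complex.norm_exp, Complex.re_ofReal_mul, ← Real.exp_add]
    congr 1
    simp only [Complex.mul_re, Complex.add_re, Complex.add_im, Complex.one_re, Complex.one_im]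
    ring
  have h3 : v * (v - 1) ≤ ‖(⟨-v, u⟩ : ℂ) * (1 + (⟨-v, u⟩ : ℂ))‖ := by
    rw [norm_mul]
    have ha : v ≤ ‖(⟨-v, u⟩ : ℂ)‖ := by
      simpa [abs_of_pos (zero_lt_one.trans hv)] using Complex.abs_re_le_norm (⟨-v, u⟩ : ℂ)
    have hb : v - 1 ≤ ‖1 + (⟨-v, u⟩ : ℂ)‖ := by
      have h := (neg_le_abs _).trans (Complex.abs_re_le_norm (1 + (⟨-v, u⟩ : ℂ)))
      simp only [Complex.add_re, Complex.one_re] at h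
      linarith
    exact mul_le_mul ha hb (by linarith) (norm_nonneg _)
  have hpos : 0 < v * (v - 1) := mul_pos (by linarith) (by linarith)
  rw [norm_div, norm_mul, h1, h2]
  exact (div_le_div_of_nonneg_left (by positivity) hpos h3).trans_eq (by ring)

/-- Jump-intensity sensitivity in the Lewis representation: with
`Ψ_λ(-z) = iz(1+iz)σ²/2 + λ·Ψ̄_J(-z)` and
`D(λ) = (1/2π) ∫ e^{(1+iz)x} e^{τΨ_λ(-z)} / (iz(1+iz)) du`, the function `D` is
differentiable on `(λ₁,λ₂)` with
`D'(λ) = τ·(1/2π) ∫ e^{(1+iz)x} e^{τΨ_λ(-z)} Ψ̄_J(-z) / (iz(1+iz)) du`. -/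
theorem call_lambda_sensitivity
    (v τ : ℝ) (hv : 1 < v) (hτ : 0 < τ)
    (ν : Measure ℝ) [SigmaFinite ν]
    (hν0 : ν {0} = 0)
    (hν1 : IntegrableOn (fun y : ℝ => y ^ 2) {y : ℝ | |y| ≤ 1} ν)
    (hν2 : ν {y : ℝ | 1 < |y|} < ⊤)
    (hν3 : IntegrableOn (fun y : ℝ => Real.exp (v * y)) {y : ℝ | 1 < |y|} ν)
    (hν4 : IntegrableOn (fun y : ℝ => Real.exp y) {y : ℝ | 1 < |y|} ν)
    (ΨJ : ℝ → ℂ)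
    (hΨJ : ∀ u : ℝ, ΨJ u =
      ∫ y : ℝ,
        (Complex.exp (-(Complex.I * ((u : ℂ) + (v : ℂ) * Complex.I) * (y : ℂ))) - 1 +
          Complex.I * ((u : ℂ) + (v : ℂ) * Complex.I) * (Complex.exp (y : ℂ) - 1)) ∂ν)
    (hsup : ∃ B : ℝ, ∀ u : ℝ, (ΨJ u).re ≤ B)
    (σ x l₁ l₂ : ℝ) (hσ : 0 < σ) (hl₁ : 0 ≤ l₁) (hl : l₁ < l₂) :
    ∀ l ∈ Set.Ioo l₁ l₂,
      HasDerivAt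
        (fun l : ℝ => (1 / (2 * (Real.pi : ℂ))) *
          ∫ u : ℝ,
            Complex.exp ((1 + Complex.I * ((u : ℂ) + (v : ℂ) * Complex.I)) * (x : ℂ)) *
              Complex.exp ((τ : ℂ) *
                (Complex.I * ((u : ℂ) + (v : ℂ) * Complex.I) *
                    (1 + Complex.I * ((u : ℂ) + (v : ℂ) * Complex.I)) * (σ : ℂ) ^ 2 / 2 +
                  (l : ℂ) * ΨJ u)) /
              (Complex.I * ((u : ℂ) + (v : ℂ) * Complex.I) *
                (1 + Complex.I * ((u : ℂ) + (v : ℂ) * Complex.I))))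
        ((τ : ℂ) * (1 / (2 * (Real.pi : ℂ))) *
          ∫ u : ℝ,
            Complex.exp ((1 + Complex.I * ((u : ℂ) + (v : ℂ) * Complex.I)) * (x : ℂ)) *
              Complex.exp ((τ : ℂ) *
                (Complex.I * ((u : ℂ) + (v : ℂ) * Complex.I) *
                    (1 + Complex.I * ((u : ℂ) + (v : ℂ) * Complex.I)) * (σ : ℂ) ^ 2 / 2 +
                  (l : ℂ) * ΨJ u)) * ΨJ u /
              (Complex.I * ((u : ℂ) + (v : ℂ) * Complex.I) *
                (1 + Complex.I * ((u : ℂ) + (v : ℂ) * Complex.I)))) l := by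
  obtain ⟨B, hB⟩ := hsup
  obtain ⟨C, hC⟩ := exists_norm_integral_jumpIntegrand_le hν1 hν2 hν3 hν4
  intro l hl
  have hΨmeas : StronglyMeasurable ΨJ := by
    rw [funext hΨJ]
    refine StronglyMeasurable.integral_prod_right (ν := ν) (f := fun u y : ℝ =>
      Complex.exp (-(Complex.I * ((u : ℂ) + (v : ℂ) * Complex.I) * (y : ℂ))) - 1 +
        Complex.I * ((u : ℂ) + (v : ℂ) * Complex.I) * (Complex.exp (y : ℂ) - 1)) ?_
    refine Continuous.stronglyMeasurable ?_
    simp only [Function.uncurry_def]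
    fun_prop
  have hΨbound (u : ℝ) : ‖ΨJ u‖ ≤ |C| * Real.exp (2 * v) * Real.exp (2 * |u|) := by
    have hnorm : ‖Complex.I * ((u : ℂ) + (v : ℂ) * Complex.I)‖ ≤ v + |u| := by
      have h := norm_add_le (u : ℂ) ((v : ℂ) * Complex.I)
      simp only [norm_mul, Complex.norm_I, mul_one, one_mul, Complex.norm_real,
        Real.norm_eq_abs, abs_of_pos (zero_lt_one.trans hv)] at h ⊢
      linarith
    rw [hΨJ u, mul_assoc, ← Real.exp_add, ← mul_add]
    refine (hC _ (by simp)).trans ?_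
    gcongr
    exact le_abs_self C
  let A : ℝ → ℂ := fun u =>
    Complex.exp ((1 + Complex.I * ((u : ℂ) + (v : ℂ) * Complex.I)) * (x : ℂ)) *
      Complex.exp ((τ : ℂ) * (Complex.I * ((u : ℂ) + (v : ℂ) * Complex.I) *
        (1 + Complex.I * ((u : ℂ) + (v : ℂ) * Complex.I)) * (σ : ℂ) ^ 2 / 2)) /
      (Complex.I * ((u : ℂ) + (v : ℂ) * Complex.I) *
        (1 + Complex.I * ((u : ℂ) + (v : ℂ) * Complex.I)))
  have hAmeas : Measurable A := by fun_prop
  have ha : 0 < τ * σ ^ 2 / 2 := by positivity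
  have hA : Integrable A :=
    ((integrable_exp_neg_mul_sq ha).const_mul _).mono' hAmeas.aestronglyMeasurable
      (Filter.Eventually.of_forall (norm_lewisKernel_le hv τ σ x))
  have hAΨ : Integrable fun u => A u * ((τ : ℂ) * ΨJ u) := by
    refine ((integrable_exp_mul_abs_mul_exp_neg_mul_sq ha).const_mul
      (Real.exp ((1 - v) * x) * Real.exp (τ * σ ^ 2 / 2 * (v ^ 2 - v)) / (v * (v - 1)) *
        (τ * (|C| * Real.exp (2 * v))))).mono'
      (hAmeas.aestronglyMeasurable.mul (hΨmeas.aestronglyMeasurable.const_mul _))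
      (Filter.Eventually.of_forall fun u => ?_)
    rw [norm_mul, norm_mul, Complex.norm_real, Real.norm_of_nonneg hτ.le]
    have hK := norm_lewisKernel_le hv τ σ x u
    calc ‖A u‖ * (τ * ‖ΨJ u‖) ≤ _ * (τ * _) :=
          mul_le_mul hK (mul_le_mul_of_nonneg_left (hΨbound u) hτ.le) (by positivity)
            ((norm_nonneg _).trans hK)
      _ = _ := by ring
  have hderiv := (hasDerivAt_integral_mul_exp_mul hl₁ hl hA hAΨ
    (hΨmeas.aestronglyMeasurable.const_mul _) (B := τ * B) (fun u => by
      rw [Complex.re_ofReal_mul]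
      exact mul_le_mul_of_nonneg_left (hB u) hτ.le)).const_mul (1 / (2 * (Real.pi : ℂ)))
  refine (hderiv.congr_deriv ?_).congr_of_eventuallyEq (Filter.Eventually.of_forall fun m => ?_)
  · symm
    rw [mul_comm (τ : ℂ), mul_assoc, ← integral_const_mul]
    refine congrArg (_ * ·) (integral_congr_ae (Filter.Eventually.of_forall fun u => ?_))
    simp only [A]
    rw [mul_add (τ : ℂ), Complex.exp_add, mul_left_comm (l : ℂ)]
    ring
  · refine congrArg (_ * ·) (integral_congr_ae (Filter.Eventually.of_forall fun u => ?_))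
    simp only [A]
    rw [mul_add (τ : ℂ), Complex.exp_add, mul_left_comm (m : ℂ)]
    ring
end

section
/- Assume additionally ∫_ℝ |φ(u+iv)| du < ∞. Define C(x) := ∫_ℝ (e^{s} − e^{x})⁺ μ(ds) and Ẽ(x) := ∫_{(x,∞)} e^{s} μ(ds). Then for every x ∈ ℝ the Fubini identity behind the Theta and jump-sensitivity formulas holds: (1/2π) ∫_ℝ e^{(1+i(u+iv))x} · φ(u+iv) · Ψ_J(−(u+iv)) / ( i(u+iv)·(1+i(u+iv)) ) du = ∫_ℝ ( e^{y}·C(x−y) − C(x) − (e^{y}−1)·Ẽ(x) ) ν(dy). -/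
open MeasureTheory

/-- Fourier inversion at a continuity point, in the angular-frequency normalization. -/
lemma eq_integral_exp_mul_of_continuousAt {f g : ℝ → ℂ} (hf : Integrable f) (hg : Integrable g)
    (hfg : ∀ u : ℝ, g u = ∫ x : ℝ, Complex.exp (-(Complex.I * u * x)) * f x)
    {x : ℝ} (hx : ContinuousAt f x) :
    f x = 1 / (2 * (Real.pi : ℂ)) * ∫ u : ℝ, Complex.exp (Complex.I * u * x) * g u := by
  have hF : FourierTransform.fourier f = fun w : ℝ => g (2 * Real.pi * w) := by
    ext w
    rw [Real.fourier_real_eq_integral_exp_smul, hfg]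
    refine integral_congr_ae (.of_forall fun t => ?_)
    simp only [smul_eq_mul]
    congr 2
    push_cast
    ring
  have hpi : 2 * Real.pi ≠ 0 := by positivity
  have hF' : Integrable (FourierTransform.fourier f) := by
    rw [hF]
    exact hg.comp_mul_left' hpi
  rw [← hf.fourierInv_fourier_eq hF' hx, hF, Real.fourierInv_eq']
  have h := Measure.integral_comp_mul_left
    (fun u : ℝ => Complex.exp (Complex.I * u * x) * g u) (2 * Real.pi)
  rw [abs_of_pos (by positivity), Complex.real_smul] at h
  have : (((2 * Real.pi)⁻¹ : ℝ) : ℂ) = 1 / (2 * (Real.pi : ℂ)) := by push_cast; simp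
  rw [← this, ← h]
  refine integral_congr_ae (.of_forall fun t => ?_)
  simp only [smul_eq_mul]
  congr 2
  simp
  ring

lemma integrable_exp_mul_mul_of_le_one {a : ℂ} (ha : 0 < a.re) {h : ℝ → ℝ} (hh : Antitone h)
    (h0 : ∀ t, 0 ≤ h t) (h1 : ∀ t, h t ≤ 1) (hz : ∀ t, 0 ≤ t → h t = 0) :
    Integrable (fun t : ℝ => Complex.exp (a * t) * (h t : ℂ)) := by
  have hi := (integrable_indicator_iff measurableSet_Iic).2 (integrableOn_exp_mul_complex_Iic ha 0)
  refine hi.mono (Measurable.aestronglyMeasurable ?_) (.of_forall fun t => ?_)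
  · have := hh.measurable
    fun_prop
  · rcases le_or_gt t 0 with ht | ht
    · simp only [Set.indicator, Set.mem_Iic, ht, if_true, norm_mul, Complex.norm_real]
      rw [Real.norm_of_nonneg (h0 t)]
      exact mul_le_of_le_one_right (norm_nonneg _) (h1 t)
    · simp [hz t ht.le]

lemma integrable_exp_complex_mul {v : ℝ} {μ : Measure ℝ}
    (hμ : Integrable (fun s : ℝ => Real.exp (v * s)) μ) {w : ℂ} (hw : w.re = v) :
    Integrable (fun s : ℝ => Complex.exp (w * s)) μ := by
  refine hμ.mono (by fun_prop) (.of_forall fun s => ?_)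
  simp [Complex.norm_exp, hw]

open Filter Topology Set in
/-- Inversion formula for the price `x ↦ ∫ e^s h(x - s) μ(ds)` of an antitone, right-continuous
payoff profile `h` vanishing on `[0, ∞)`. Continuity points of the price are dense, and
right-continuity extends the formula to every `x`. -/
lemma integral_exp_mul_comp_sub_eq {v : ℝ} (hv : 1 < v) {μ : Measure ℝ} [IsProbabilityMeasure μ]
    (hμv : Integrable (fun s : ℝ => Real.exp (v * s)) μ)
    (hμ1 : Integrable (fun s : ℝ => Real.exp s) μ)
    {h : ℝ → ℝ} (hh : Antitone h) (hc : ∀ t, ContinuousWithinAt h (Ioi t) t)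
    (h0 : ∀ t, 0 ≤ h t) (h1 : ∀ t, h t ≤ 1) (hz : ∀ t, 0 ≤ t → h t = 0)
    {p H : ℝ → ℂ} (hp : ∀ u : ℝ, p u = ∫ s : ℝ, Complex.exp ((v - Complex.I * u) * s) ∂μ)
    (hH : ∀ u : ℝ, H u = ∫ t : ℝ, Complex.exp ((v - Complex.I * u - 1) * t) * (h t : ℂ))
    (hint : Integrable (fun u => p u * H u)) (x : ℝ) :
    ((∫ s, Real.exp s * h (x - s) ∂μ : ℝ) : ℂ) = 1 / (2 * (Real.pi : ℂ)) *
      ∫ u : ℝ, Complex.exp ((1 - (v - Complex.I * u)) * x) * (p u * H u) := by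
  have hm := hh.measurable
  have hsint (x : ℝ) : Integrable (fun s => Real.exp s * h (x - s)) μ := by
    refine hμ1.mono (by fun_prop) (.of_forall fun s => ?_)
    rw [norm_mul, Real.norm_of_nonneg (h0 _)]
    exact mul_le_of_le_one_right (norm_nonneg _) (h1 _)
  set F : ℝ → ℝ := fun x => ∫ s, Real.exp s * h (x - s) ∂μ with hF
  have hFanti : Antitone F := fun a b hab => integral_mono (hsint b) (hsint a) fun s =>
    mul_le_mul_of_nonneg_left (hh (by linarith)) (Real.exp_pos s).le
  have hFc (x : ℝ) : ContinuousWithinAt F (Ioi x) x := by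
    refine tendsto_integral_filter_of_dominated_convergence (fun s => Real.exp s)
      (.of_forall fun y => (hsint y).aestronglyMeasurable)
      (.of_forall fun y => .of_forall fun s => ?_) hμ1 (.of_forall fun s => ?_)
    · rw [norm_mul, Real.norm_of_nonneg (h0 _), Real.norm_of_nonneg (Real.exp_pos s).le]
      exact mul_le_of_le_one_right (Real.exp_pos s).le (h1 _)
    · refine Tendsto.const_mul _ ?_
      refine Tendsto.comp (hc (x - s)) ?_
      refine tendsto_nhdsWithin_iff.2 ⟨?_, ?_⟩
      · exact Continuous.continuousWithinAt (by fun_prop)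
      · filter_upwards [self_mem_nhdsWithin] with y hy
        simpa using hy
  set f : ℝ → ℂ := fun x => Complex.exp ((v - 1) * x) * (F x : ℂ) with hf
  have hconv (u x : ℝ) : Complex.exp (-(Complex.I * u * x)) * f x =
      convolution (fun s : ℝ => Complex.exp ((v - Complex.I * u) * s))
        (fun t : ℝ => Complex.exp ((v - Complex.I * u - 1) * t) * (h t : ℂ))
        (ContinuousLinearMap.mul ℂ ℂ) μ x := by
    simp only [hf, hF, convolution, ContinuousLinearMap.mul_apply', ← integral_complex_ofReal,
      ← integral_const_mul]
    refine integral_congr_ae (.of_forall fun s => ?_)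
    simp only [← mul_assoc, ← Complex.exp_add, Complex.ofReal_mul, Complex.ofReal_exp]
    congr 2
    push_cast
    ring
  have hi1 (u : ℝ) : Integrable (fun s : ℝ => Complex.exp ((v - Complex.I * u) * s)) μ :=
    integrable_exp_complex_mul hμv (by simp)
  have hi2 (u : ℝ) :
      Integrable (fun t : ℝ => Complex.exp ((v - Complex.I * u - 1) * t) * (h t : ℂ)) :=
    integrable_exp_mul_mul_of_le_one (by simpa using hv) hh h0 h1 hz
  have hfi : Integrable f := by
    have := ((hi1 0).convolution_integrand (ContinuousLinearMap.mul ℂ ℂ)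
      (hi2 0)).integral_prod_left
    refine this.congr (.of_forall fun x => ?_)
    refine (hconv 0 x).symm.trans ?_
    simp
  have hft (u : ℝ) : p u * H u = ∫ x : ℝ, Complex.exp (-(Complex.I * u * x)) * f x := by
    simp_rw [hconv]
    rw [integral_convolution _ (hi1 u) (hi2 u), hp, hH]
    rfl
  set G : ℝ → ℂ := fun x =>
    1 / (2 * (Real.pi : ℂ)) * ∫ u : ℝ, Complex.exp (Complex.I * u * x) * (p u * H u) with hG
  have hGc : Continuous G := by
    refine continuous_const.mul (continuous_of_dominated (bound := fun u => ‖p u * H u‖)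
      (fun x => ?_) (fun x => .of_forall fun u => ?_) hint.norm (.of_forall fun u => by fun_prop))
    · exact AEStronglyMeasurable.mul (by fun_prop) hint.aestronglyMeasurable
    · rw [norm_mul, Complex.norm_exp]
      simp
  have hfG : f x = G x := by
    have hd : Dense {x | ContinuousAt F x} := by
      simpa [compl_ofPred] using hFanti.countable_not_continuousAt.dense_compl ℝ
    have hx : x ∈ closure (Ioi x ∩ {x | ContinuousAt F x}) := by
      refine closure_minimal (hd.open_subset_closure_inter isOpen_Ioi) isClosed_closure ?_
      simp
    have := mem_closure_iff_nhdsWithin_neBot.1 hx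
    have hfc : ContinuousWithinAt f (Ioi x) x := by
      refine ContinuousWithinAt.mul (Continuous.continuousWithinAt (by fun_prop)) ?_
      exact Complex.continuous_ofReal.continuousAt.comp_continuousWithinAt (hFc x)
    refine tendsto_nhds_unique (hfc.mono_left (nhdsWithin_mono x inter_subset_left))
      (Tendsto.congr' ?_ (hGc.continuousWithinAt (s := Ioi x ∩ {x | ContinuousAt F x}) (x := x)))
    filter_upwards [self_mem_nhdsWithin] with y hy
    refine (eq_integral_exp_mul_of_continuousAt hfi hint hft ?_).symm
    exact ContinuousAt.mul (by fun_prop) (Complex.continuous_ofReal.continuousAt.comp hy.2)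
  have : (F x : ℂ) = Complex.exp ((1 - v) * x) * f x := by
    simp only [hf, ← mul_assoc, ← Complex.exp_add]
    ring_nf
    simp
  rw [this, hfG, hG]
  simp only
  rw [mul_left_comm, ← integral_const_mul]
  congr 2
  ext u
  rw [← mul_assoc, ← Complex.exp_add]
  ring_nf

lemma antitone_indicator_Iio_one : Antitone (Set.indicator (Set.Iio (0 : ℝ)) (1 : ℝ → ℝ)) := by
  intro a b hab
  by_cases hb : b < 0
  · simp [Set.indicator, hb, hab.trans_lt hb]
  · rw [Set.indicator_of_notMem (by simpa using hb)]
    exact Set.indicator_nonneg (by simp) a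

lemma continuousWithinAt_indicator_Iio_one (t : ℝ) :
    ContinuousWithinAt (Set.indicator (Set.Iio (0 : ℝ)) (1 : ℝ → ℝ)) (Set.Ioi t) t := by
  rcases lt_or_ge t 0 with ht | ht
  · refine ContinuousAt.continuousWithinAt
      ((continuousAt_const (y := (1 : ℝ))).congr ?_)
    filter_upwards [Iio_mem_nhds ht] with y hy
    simp [hy]
  · refine (continuousWithinAt_const (b := (0 : ℝ))).congr (fun y hy => ?_) ?_
    · exact Set.indicator_of_notMem (by simpa using ht.trans (le_of_lt hy)) _
    · exact Set.indicator_of_notMem (by simpa using ht) _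

lemma integral_exp_mul_indicator_Iio {a : ℂ} (ha : 0 < a.re) :
    ∫ t : ℝ, Complex.exp (a * t) * ((Set.indicator (Set.Iio 0) 1 t : ℝ) : ℂ) = 1 / a := by
  have : (fun t : ℝ => Complex.exp (a * t) * ((Set.indicator (Set.Iio 0) 1 t : ℝ) : ℂ)) =
      Set.indicator (Set.Iio 0) fun t : ℝ => Complex.exp (a * t) := by
    ext t
    by_cases ht : t ∈ Set.Iio (0 : ℝ) <;> simp [ht]
  rw [this, integral_indicator measurableSet_Iio, ← integral_Iic_eq_integral_Iio,
    integral_exp_mul_complex_Iic ha]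
  simp

lemma integral_exp_mul_max_one_sub_exp {a : ℂ} (ha : 0 < a.re) :
    ∫ t : ℝ, Complex.exp (a * t) * ((max (1 - Real.exp t) 0 : ℝ) : ℂ) = 1 / ((a + 1) * a) := by
  have ha' : 0 < (a + 1).re := by simp; linarith
  have : (fun t : ℝ => Complex.exp (a * t) * ((max (1 - Real.exp t) 0 : ℝ) : ℂ)) =
      Set.indicator (Set.Iic 0) fun t : ℝ => Complex.exp (a * t) - Complex.exp ((a + 1) * t) := by
    ext t
    rcases le_or_gt t 0 with ht | ht
    · have : Real.exp t ≤ 1 := Real.exp_le_one_iff.2 ht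
      rw [Set.indicator_of_mem (show t ∈ Set.Iic 0 from ht), max_eq_left (by linarith), add_mul,
        Complex.exp_add]
      push_cast
      ring_nf
    · have : 1 < Real.exp t := Real.one_lt_exp_iff.2 ht
      rw [Set.indicator_of_notMem (by simpa using ht), max_eq_right (by linarith)]
      simp
  rw [this, integral_indicator measurableSet_Iic,
    integral_sub (integrableOn_exp_mul_complex_Iic ha 0) (integrableOn_exp_mul_complex_Iic ha' 0),
    integral_exp_mul_complex_Iic ha, integral_exp_mul_complex_Iic ha']
  have h1 : a ≠ 0 := by rintro rfl; simp at ha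
  have h2 : a + 1 ≠ 0 := by intro h; simp [h] at ha'
  simp
  field_simp
  ring

lemma norm_exp_sub_one_sub_id_le_of_re_le_s14 {z : ℂ} {c : ℝ} (hz : z.re ≤ c) :
    ‖Complex.exp z - 1 - z‖ ≤ (Real.exp c + 2) * ‖z‖ ^ 2 := by
  rcases le_or_gt ‖z‖ 1 with h | h
  · refine (Complex.norm_exp_sub_one_sub_id_le h).trans ?_
    nlinarith [Real.exp_pos c, sq_nonneg ‖z‖]
  · have h1 : ‖Complex.exp z - 1 - z‖ ≤ ‖Complex.exp z‖ + 1 + ‖z‖ := by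
      refine (norm_sub_le _ _).trans ?_
      gcongr
      simpa using norm_sub_le (Complex.exp z) 1
    have h2 : ‖Complex.exp z‖ ≤ Real.exp c := by
      rw [Complex.norm_exp]
      exact Real.exp_le_exp.2 hz
    have h3 : 1 ≤ ‖z‖ ^ 2 := one_le_pow₀ h.le
    have h4 : ‖z‖ ≤ ‖z‖ ^ 2 := le_self_pow₀ h.le two_ne_zero
    nlinarith [Real.exp_pos c]

section jumpBound

variable {v : ℝ} {w : ℂ} {y : ℝ}

lemma norm_jump_div_le_of_abs_le (hv : 1 < v) (hw : w.re = v) (hy : |y| ≤ 1) :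
    ‖(Complex.exp (w * y) - 1 - w * (Complex.exp y - 1)) / (w * (w - 1))‖ ≤
      ((Real.exp v + 2) * v + 1) / (v - 1) * y ^ 2 := by
  have hw1 : v - 1 ≤ ‖w - 1‖ := by simpa [hw] using Complex.re_le_norm (w - 1)
  have hw0 : v ≤ ‖w‖ := by simpa [hw] using Complex.re_le_norm w
  have hww : ‖w‖ ≤ ‖w - 1‖ + 1 := by simpa using norm_add_le (w - 1) 1
  have hb : 0 < v - 1 := by linarith
  have hA : ‖Complex.exp (w * y) - 1 - w * y‖ ≤ (Real.exp v + 2) * (‖w‖ ^ 2 * y ^ 2) := by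
    refine (norm_exp_sub_one_sub_id_le_of_re_le_s14 (c := v) ?_).trans_eq ?_
    · simp only [Complex.re_mul_ofReal, hw]
      nlinarith [(abs_le.1 hy).2]
    · simp [mul_pow]
  have hB : ‖Complex.exp y - 1 - y‖ ≤ y ^ 2 := by
    simpa using Complex.norm_exp_sub_one_sub_id_le (x := (y : ℂ)) (by simpa using hy)
  have hK : ‖Complex.exp (w * y) - 1 - w * (Complex.exp y - 1)‖ ≤
      (Real.exp v + 2) * (‖w‖ ^ 2 * y ^ 2) + ‖w‖ * y ^ 2 := by
    calc _ = ‖(Complex.exp (w * y) - 1 - w * y) - w * (Complex.exp y - 1 - y)‖ := by ring_nf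
      _ ≤ _ := norm_sub_le _ _
      _ ≤ _ := by rw [norm_mul]; gcongr
  rw [norm_div, norm_mul, div_le_iff₀ (mul_pos (by linarith) (by linarith))]
  refine hK.trans ?_
  rw [div_mul_eq_mul_div, div_mul_eq_mul_div, le_div_iff₀ hb]
  have key : ‖w‖ * (v - 1) ≤ v * ‖w - 1‖ := by nlinarith
  have := Real.exp_pos v
  calc _ = (Real.exp v + 2) * y ^ 2 * ‖w‖ * (‖w‖ * (v - 1)) + ‖w‖ * y ^ 2 * (v - 1) := by ring
    _ ≤ (Real.exp v + 2) * y ^ 2 * ‖w‖ * (v * ‖w - 1‖) + ‖w‖ * y ^ 2 * ‖w - 1‖ := by gcongr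
    _ = _ := by ring

lemma norm_jump_div_le (hv : 1 < v) (hw : w.re = v) :
    ‖(Complex.exp (w * y) - 1 - w * (Complex.exp y - 1)) / (w * (w - 1))‖ ≤
      (Real.exp (v * y) + Real.exp y + 2) / (v - 1) := by
  have hw1 : v - 1 ≤ ‖w - 1‖ := by simpa [hw] using Complex.re_le_norm (w - 1)
  have hw0 : 1 ≤ ‖w‖ := hv.le.trans (by simpa [hw] using Complex.re_le_norm w)
  have hb : 0 < v - 1 := by linarith
  have hA : ‖Complex.exp (w * y)‖ = Real.exp (v * y) := by simp [Complex.norm_exp, hw]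
  have hB : ‖Complex.exp y‖ = Real.exp y := by simp [Complex.norm_exp]
  have hK : ‖Complex.exp (w * y) - 1 - w * (Complex.exp y - 1)‖ ≤
      Real.exp (v * y) + 1 + ‖w‖ * (Real.exp y + 1) := by
    refine (norm_sub_le _ _).trans ?_
    rw [norm_mul]
    gcongr
    · simpa [hA] using norm_sub_le (Complex.exp (w * y)) 1
    · simpa [hB] using norm_sub_le (Complex.exp (y : ℂ)) 1
  have := Real.exp_pos (v * y)
  have := Real.exp_pos y
  rw [norm_div, norm_mul]
  calc _ ≤ (‖w‖ * (Real.exp (v * y) + Real.exp y + 2)) / (‖w‖ * (v - 1)) := by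
        gcongr
        nlinarith
    _ = _ := by field_simp

/-- The normalized jump kernel is dominated, uniformly on the line `Re w = v`, by a `ν`-integrable
function. -/
lemma exists_integrable_bound_jump_div (hv : 1 < v) {ν : Measure ℝ}
    (hν1 : IntegrableOn (fun y : ℝ => y ^ 2) {y : ℝ | |y| ≤ 1} ν)
    (hν2 : ν {y : ℝ | 1 < |y|} < ⊤)
    (hν3 : IntegrableOn (fun y : ℝ => Real.exp (v * y)) {y : ℝ | 1 < |y|} ν)
    (hν4 : IntegrableOn (fun y : ℝ => Real.exp y) {y : ℝ | 1 < |y|} ν) :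
    ∃ B : ℝ → ℝ, Integrable B ν ∧ ∀ (w : ℂ) (y : ℝ), w.re = v →
      ‖(Complex.exp (w * y) - 1 - w * (Complex.exp y - 1)) / (w * (w - 1))‖ ≤ B y := by
  have hm : MeasurableSet {y : ℝ | |y| ≤ 1} := measurableSet_le (by fun_prop) (by fun_prop)
  have hc : {y : ℝ | |y| ≤ 1}ᶜ = {y : ℝ | 1 < |y|} := by ext y; simp
  classical
  refine ⟨Set.piecewise {y : ℝ | |y| ≤ 1}
    (fun y => ((Real.exp v + 2) * v + 1) / (v - 1) * y ^ 2)
    (fun y => (Real.exp (v * y) + Real.exp y + 2) / (v - 1)),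
    Integrable.piecewise hm (hν1.const_mul _) ?_, fun w y hw => ?_⟩
  · rw [hc]
    exact ((hν3.add hν4).add (integrableOn_const hν2.ne)).div_const _
  · by_cases hy : y ∈ {y : ℝ | |y| ≤ 1}
    · rw [Set.piecewise_eq_of_mem _ _ _ hy]
      exact norm_jump_div_le_of_abs_le hv hw hy
    · rw [Set.piecewise_eq_of_notMem _ _ _ hy]
      exact norm_jump_div_le hv hw

end jumpBound

/-- Fubini identity behind the Theta and jump-sensitivity formulas:
`(1/2π) ∫ e^{(1+iz)x} φ(z) Ψ_J(-z) / (iz(1+iz)) du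
  = ∫ (e^y C(x-y) - C(x) - (e^y - 1) Ẽ(x)) ν(dy)`,
where `C(x) = ∫ (e^s - e^x)⁺ μ(ds)` and `Ẽ(x) = ∫_{(x,∞)} e^s μ(ds)`. -/
theorem fubini_identity
    (v τ : ℝ) (hv : 1 < v) (hτ : 0 < τ)
    (ν : Measure ℝ) [SigmaFinite ν]
    (hν0 : ν {0} = 0)
    (hν1 : IntegrableOn (fun y : ℝ => y ^ 2) {y : ℝ | |y| ≤ 1} ν)
    (hν2 : ν {y : ℝ | 1 < |y|} < ⊤)
    (hν3 : IntegrableOn (fun y : ℝ => Real.exp (v * y)) {y : ℝ | 1 < |y|} ν)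
    (hν4 : IntegrableOn (fun y : ℝ => Real.exp y) {y : ℝ | 1 < |y|} ν)
    (ΨJ : ℝ → ℂ)
    (hΨJ : ∀ u : ℝ, ΨJ u =
      ∫ y : ℝ,
        (Complex.exp (-(Complex.I * ((u : ℂ) + (v : ℂ) * Complex.I) * (y : ℂ))) - 1 +
          Complex.I * ((u : ℂ) + (v : ℂ) * Complex.I) * (Complex.exp (y : ℂ) - 1)) ∂ν)
    (μ : Measure ℝ) [IsProbabilityMeasure μ]
    (hμv : Integrable (fun s : ℝ => Real.exp (v * s)) μ)
    (hmart1 : Integrable (fun s : ℝ => Real.exp s) μ)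
    (hmart2 : ∫ s : ℝ, Real.exp s ∂μ = 1)
    (φ : ℂ → ℂ)
    (hφ : ∀ z : ℂ, φ z = ∫ s : ℝ, Complex.exp (-(Complex.I * z * (s : ℂ))) ∂μ)
    (hint : Integrable (fun u : ℝ => ‖φ ((u : ℂ) + (v : ℂ) * Complex.I)‖)) :
    ∀ x : ℝ,
      (1 / (2 * (Real.pi : ℂ))) *
        (∫ u : ℝ,
          Complex.exp ((1 + Complex.I * ((u : ℂ) + (v : ℂ) * Complex.I)) * (x : ℂ)) *
            φ ((u : ℂ) + (v : ℂ) * Complex.I) * ΨJ u /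
              (Complex.I * ((u : ℂ) + (v : ℂ) * Complex.I) *
                (1 + Complex.I * ((u : ℂ) + (v : ℂ) * Complex.I)))) =
      ((∫ y : ℝ,
          (Real.exp y * (∫ s : ℝ, max (Real.exp s - Real.exp (x - y)) 0 ∂μ) -
            (∫ s : ℝ, max (Real.exp s - Real.exp x) 0 ∂μ) -
            (Real.exp y - 1) * ∫ s in Set.Ioi x, Real.exp s ∂μ) ∂ν : ℝ) : ℂ) := by
  intro x
  set p : ℝ → ℂ := fun u => φ ((u : ℂ) + (v : ℂ) * Complex.I) with hp_def
  have hz (u : ℝ) : Complex.I * ((u : ℂ) + (v : ℂ) * Complex.I) = -(v - Complex.I * u) := by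
    linear_combination (v : ℂ) * Complex.I_sq
  have hp (u : ℝ) : p u = ∫ s : ℝ, Complex.exp ((v - Complex.I * u) * s) ∂μ := by
    simp only [hp_def, hφ, hz, neg_mul, neg_neg]
  have hpm : AEStronglyMeasurable p := by
    have : StronglyMeasurable
        fun q : ℝ × ℝ => Complex.exp ((v - Complex.I * q.1) * q.2) :=
      Continuous.stronglyMeasurable (by fun_prop)
    exact (this.integral_prod_right (ν := μ)).aestronglyMeasurable.congr
      (.of_forall fun u => (hp u).symm)
  have hpi : Integrable p := (integrable_norm_iff hpm).1 hint
  have hb : 0 < v - 1 := by linarith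
  have hre (u : ℝ) : ((v : ℂ) - Complex.I * u).re = v := by simp
  have hw1 (u : ℝ) : v - 1 ≤ ‖(v : ℂ) - Complex.I * u - 1‖ := by
    simpa using Complex.re_le_norm ((v : ℂ) - Complex.I * u - 1)
  have hw0 (u : ℝ) : 1 ≤ ‖(v : ℂ) - Complex.I * u‖ :=
    hv.le.trans (by simpa using Complex.re_le_norm ((v : ℂ) - Complex.I * u))
  have hne1 (u : ℝ) : (v : ℂ) - Complex.I * u - 1 ≠ 0 := norm_pos_iff.1 (hb.trans_le (hw1 u))
  have hne0 (u : ℝ) : (v : ℂ) - Complex.I * u ≠ 0 :=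
    norm_pos_iff.1 (zero_lt_one.trans_le (hw0 u))
  have hi1 : Integrable fun u : ℝ => p u * (1 / ((v : ℂ) - Complex.I * u - 1)) := by
    refine hpi.mul_bdd (c := 1 / (v - 1)) (Measurable.aestronglyMeasurable (by fun_prop))
      (.of_forall fun u => ?_)
    rw [norm_div, norm_one]
    exact one_div_le_one_div_of_le hb (hw1 u)
  have hi2 : Integrable fun u : ℝ =>
      p u * (1 / (((v : ℂ) - Complex.I * u) * ((v : ℂ) - Complex.I * u - 1))) := by
    refine hpi.mul_bdd (c := 1 / (v - 1)) (Measurable.aestronglyMeasurable (by fun_prop))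
      (.of_forall fun u => ?_)
    rw [norm_div, norm_one, norm_mul]
    exact one_div_le_one_div_of_le hb (by nlinarith [hw0 u, hw1 u])
  have hexp (x : ℝ) {g : ℝ → ℂ} (hg : Integrable g) :
      Integrable fun u : ℝ => Complex.exp ((1 - (v - Complex.I * u)) * x) * g u := by
    refine hg.bdd_mul (c := Real.exp ((1 - v) * x)) (by fun_prop) (.of_forall fun u => ?_)
    simp [Complex.norm_exp]
  have hC (x : ℝ) : ((∫ s : ℝ, max (Real.exp s - Real.exp x) 0 ∂μ : ℝ) : ℂ) =
      1 / (2 * (Real.pi : ℂ)) * ∫ u : ℝ, Complex.exp ((1 - (v - Complex.I * u)) * x) *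
        (p u * (1 / (((v : ℂ) - Complex.I * u) * ((v : ℂ) - Complex.I * u - 1)))) := by
    rw [← integral_exp_mul_comp_sub_eq hv hμv hmart1 (h := fun t => max (1 - Real.exp t) 0)
      (fun a b hab => max_le_max_right 0 (by gcongr))
      (fun t => Continuous.continuousWithinAt (by fun_prop))
      (fun t => le_max_right _ _)
      (fun t => max_le (by linarith [Real.exp_pos t]) zero_le_one)
      (fun t ht => max_eq_right (by linarith [Real.one_le_exp ht])) hp (fun u => ?_) hi2]
    · congr 2
      ext s
      rw [mul_max_of_nonneg _ _ (Real.exp_pos s).le, mul_sub, ← Real.exp_add]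
      simp
    · rw [integral_exp_mul_max_one_sub_exp (by simpa using hv), sub_add_cancel]
  have hE : ((∫ s in Set.Ioi x, Real.exp s ∂μ : ℝ) : ℂ) =
      1 / (2 * (Real.pi : ℂ)) * ∫ u : ℝ, Complex.exp ((1 - (v - Complex.I * u)) * x) *
        (p u * (1 / ((v : ℂ) - Complex.I * u - 1))) := by
    rw [← integral_exp_mul_comp_sub_eq hv hμv hmart1 (h := Set.indicator (Set.Iio 0) 1)
      antitone_indicator_Iio_one continuousWithinAt_indicator_Iio_one
      (fun t => Set.indicator_nonneg (by simp) t)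
      (fun t => Set.indicator_le_self' (by simp) t)
      (fun t ht => Set.indicator_of_notMem (by simpa using ht) _) hp (fun u => ?_) hi1]
    · rw [← integral_indicator measurableSet_Ioi]
      congr 2
      ext s
      by_cases hs : x < s
      · simp [Set.indicator, hs]
      · simp [Set.indicator, hs]
    · rw [integral_exp_mul_indicator_Iio (by simpa using hv)]
  obtain ⟨B, hB, hKB⟩ := exists_integrable_bound_jump_div hv hν1 hν2 hν3 hν4
  set K : ℝ → ℝ → ℂ := fun u y =>
    (Complex.exp (((v : ℂ) - Complex.I * u) * y) - 1 -
      ((v : ℂ) - Complex.I * u) * (Complex.exp y - 1)) /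
        (((v : ℂ) - Complex.I * u) * ((v : ℂ) - Complex.I * u - 1)) with hK
  set f : ℝ → ℝ → ℂ := fun u y =>
    Complex.exp ((1 - (v - Complex.I * u)) * x) * p u * K u y with hf
  have hprod : Integrable (Function.uncurry f) (volume.prod ν) := by
    refine ((hexp x hpi).norm.mul_prod hB).mono' ?_ (.of_forall fun q => ?_)
    · refine AEStronglyMeasurable.mul (hexp x hpi).aestronglyMeasurable.comp_fst ?_
      exact Measurable.aestronglyMeasurable (by fun_prop)
    · simp only [Function.uncurry, hf, norm_mul (_ * _)]
      gcongr
      exact hKB _ _ (hre _)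
  have hL (u : ℝ) : Complex.exp ((1 + Complex.I * ((u : ℂ) + (v : ℂ) * Complex.I)) * (x : ℂ)) *
        φ ((u : ℂ) + (v : ℂ) * Complex.I) * ΨJ u /
          (Complex.I * ((u : ℂ) + (v : ℂ) * Complex.I) *
            (1 + Complex.I * ((u : ℂ) + (v : ℂ) * Complex.I))) = ∫ y, f u y ∂ν := by
    simp only [hf, hK]
    rw [integral_const_mul, integral_div, hΨJ, mul_div_assoc]
    simp only [hz, neg_mul, neg_neg, ← sub_eq_add_neg]
    congr 2
    ring
  have hR (y : ℝ) : 1 / (2 * (Real.pi : ℂ)) * ∫ u, f u y =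
      ((Real.exp y * (∫ s : ℝ, max (Real.exp s - Real.exp (x - y)) 0 ∂μ) -
        (∫ s : ℝ, max (Real.exp s - Real.exp x) 0 ∂μ) -
        (Real.exp y - 1) * ∫ s in Set.Ioi x, Real.exp s ∂μ : ℝ) : ℂ) := by
    have hsplit (u : ℝ) : f u y =
        Complex.exp y * (Complex.exp ((1 - (v - Complex.I * u)) * ((x - y : ℝ) : ℂ)) *
          (p u * (1 / (((v : ℂ) - Complex.I * u) * ((v : ℂ) - Complex.I * u - 1))))) -
        Complex.exp ((1 - (v - Complex.I * u)) * x) *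
          (p u * (1 / (((v : ℂ) - Complex.I * u) * ((v : ℂ) - Complex.I * u - 1)))) -
        (Complex.exp y - 1) * (Complex.exp ((1 - (v - Complex.I * u)) * x) *
          (p u * (1 / ((v : ℂ) - Complex.I * u - 1)))) := by
      have he : Complex.exp ((1 - (v - Complex.I * u)) * x) *
          Complex.exp (((v : ℂ) - Complex.I * u) * y) =
          Complex.exp y * Complex.exp ((1 - (v - Complex.I * u)) * ((x - y : ℝ) : ℂ)) := by
        rw [← Complex.exp_add, ← Complex.exp_add]
        congr 1
        push_cast
        ring
      simp only [hf, hK]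
      have h0 := hne0 u
      have h1 := hne1 u
      rw [← mul_assoc (Complex.exp (y : ℂ)), ← he]
      field_simp
    simp_rw [hsplit]
    rw [integral_sub (((hexp _ hi2).const_mul _).sub' (hexp _ hi2)) ((hexp _ hi1).const_mul _),
      integral_sub ((hexp _ hi2).const_mul _) (hexp _ hi2), integral_const_mul,
      integral_const_mul]
    push_cast
    rw [hC, hC, hE]
    push_cast
    ring
  simp_rw [hL]
  rw [integral_integral_swap hprod, ← integral_const_mul, ← integral_complex_ofReal]
  simp_rw [hR]
end
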